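/- Suppose cr(K_{a,b}) = Z(a,b) holds for all positive integers a, b (Zarankiewicz's conjecture). Then for all positive integers m and n, cr(K_{1,m,n}) = Z(m+1,n+1) − ⌊m/2⌋⌊n/2⌋. -/

import Mathlib

open SimpleGraph

variable {V : Type*}

/-- A drawing of a simple graph in the plane: an injective placement of the
vertices in `ℝ²` together with, for each edge, a continuous arc joining the
positions of its endpoints (parametrised compatibly in both directions),
such that no arc passes through the position of a vertex other than its
endpoints. -/
structure Drawing (G : SimpleGraph V) where
  pos : V → ℝ × ℝ
  pos_inj : Function.Injective pos
  arc : V → V → ℝ → ℝ × ℝ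
  arc_cont : ∀ ⦃a b⦄, G.Adj a b → ContinuousOn (arc a b) (Set.Icc 0 1)
  arc_zero : ∀ ⦃a b⦄, G.Adj a b → arc a b 0 = pos a
  arc_one : ∀ ⦃a b⦄, G.Adj a b → arc a b 1 = pos b
  arc_symm : ∀ ⦃a b⦄, G.Adj a b → ∀ t, arc b a t = arc a b (1 - t)
  arc_avoid : ∀ ⦃a b⦄, G.Adj a b → ∀ c, c ≠ a → c ≠ b →
      pos c ∉ arc a b '' Set.Icc 0 1

namespace Drawing

variable {G : SimpleGraph V} (D : Drawing G)

/-- The set of points of the plane used by the edge `e`. -/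
def edgePoints (e : Sym2 V) : Set (ℝ × ℝ) :=
  {p | ∃ a b, e = s(a, b) ∧ G.Adj a b ∧ p ∈ D.arc a b '' Set.Icc 0 1}

/-- The positions of the endpoints of an edge. -/
def ends (e : Sym2 V) : Set (ℝ × ℝ) := {p | ∃ a ∈ e, p = D.pos a}

/-- `p` is a crossing of the (distinct) edges `e` and `f` in the drawing `D`:
a common point of the two edges other than an endpoint. -/
def IsCrossing (e f : Sym2 V) (p : ℝ × ℝ) : Prop :=
  e ∈ G.edgeSet ∧ f ∈ G.edgeSet ∧ e ≠ f ∧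
    p ∈ D.edgePoints e ∧ p ∈ D.edgePoints f ∧ p ∉ D.ends e ∧ p ∉ D.ends f

/-- The crossings between an edge of `A` and an edge of `B`: a crossing is
recorded as a point of the plane together with the unordered pair of edges
crossing there. -/
def crossings (A B : Set (Sym2 V)) : Set ((ℝ × ℝ) × Sym2 (Sym2 V)) :=
  {q | ∃ e f, q.2 = s(e, f) ∧ e ∈ A ∧ f ∈ B ∧ D.IsCrossing e f q.1}

/-- `cr_D(A, B)`: the number of crossings between an edge of `A` and an
edge of `B`. -/
noncomputable def crBetween (A B : Set (Sym2 V)) : ℕ := Nat.card (D.crossings A B)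

/-- `cr(D)`: the total number of crossings of the drawing `D`. -/
noncomputable def crNum : ℕ := D.crBetween G.edgeSet G.edgeSet

/-- A good drawing: no edge crosses itself (each arc is a simple arc),
no two adjacent edges cross, no two edges cross more than once, and no three
edges cross at a common point. -/
structure IsGood : Prop where
  arc_inj : ∀ ⦃a b⦄, G.Adj a b → Set.InjOn (D.arc a b) (Set.Icc 0 1)
  adj_no_cross : ∀ e f : Sym2 V, (∃ a, a ∈ e ∧ a ∈ f) → ∀ p, ¬ D.IsCrossing e f p
  cross_once : ∀ e f : Sym2 V, {p | D.IsCrossing e f p}.Subsingleton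
  no_triple : ∀ p, ∀ e f g : Sym2 V, e ≠ f → e ≠ g → f ≠ g →
      ¬ (D.IsCrossing e f p ∧ D.IsCrossing f g p ∧ D.IsCrossing e g p)

end Drawing

/-- The crossing number of a graph: the minimum number of crossings among
all good drawings of `G` in the plane. -/
noncomputable def crossingNumber (G : SimpleGraph V) : ℕ :=
  sInf {n | ∃ D : Drawing G, D.IsGood ∧ D.crNum = n}

/-- The Zarankiewicz function `Z(m,n) = ⌊m/2⌋⌊(m-1)/2⌋⌊n/2⌋⌊(n-1)/2⌋`. -/
def Z (m n : ℕ) : ℕ := m / 2 * ((m - 1) / 2) * (n / 2) * ((n - 1) / 2)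

/-- The complete bipartite graph `K_{a,b}`. -/
abbrev bipK (a b : ℕ) : SimpleGraph (Fin a ⊕ Fin b) :=
  completeBipartiteGraph (Fin a) (Fin b)

/-- The complete tripartite graph `K_{a,b,c}`. -/
abbrev triK (a b c : ℕ) : SimpleGraph (Σ i : Fin 3, ![Fin a, Fin b, Fin c] i) :=
  completeMultipartiteGraph ![Fin a, Fin b, Fin c]

/-- The complete 4-partite graph `K_{a,b,c,d}`. -/
abbrev quadK (a b c d : ℕ) : SimpleGraph (Σ i : Fin 4, ![Fin a, Fin b, Fin c, Fin d] i) :=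
  completeMultipartiteGraph ![Fin a, Fin b, Fin c, Fin d]

/-- `E(V₁, V₂)`: the set of pairs `{v₁, v₂}` with `v₁ ∈ V₁` and `v₂ ∈ V₂`. -/
def pairEdges {α : Type*} (V₁ V₂ : Set α) : Set (Sym2 α) :=
  {e | ∃ a ∈ V₁, ∃ b ∈ V₂, e = s(a, b)}

section partA
/-- The cross product of two plane vectors. -/
def crs (p q : ℝ × ℝ) : ℝ := p.1 * q.2 - p.2 * q.1

lemma seg_disj_of_lin (α β γ : ℝ) {p q r s : ℝ × ℝ}
    (hp : α * p.1 + β * p.2 ≤ γ) (hq : α * q.1 + β * q.2 ≤ γ)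
    (hr : γ < α * r.1 + β * r.2) (hs : γ < α * s.1 + β * s.2) :
    Disjoint (segment ℝ p q) (segment ℝ r s) := by
  rw [Set.disjoint_left]
  rintro z ⟨a, b, ha, hb, hab, rfl⟩ ⟨c, d, hc, hd, hcd, h⟩
  have h1 := congrArg Prod.fst h
  have h2 := congrArg Prod.snd h
  simp at h1 h2
  have e1 : α * (a * p.1 + b * q.1) + β * (a * p.2 + b * q.2) ≤ γ := by
    have : γ = a * γ + b * γ := by rw [← add_mul, hab, one_mul]
    nlinarith [mul_le_mul_of_nonneg_left hp ha, mul_le_mul_of_nonneg_left hq hb]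
  have e2 : γ < α * (c * r.1 + d * s.1) + β * (c * r.2 + d * s.2) := by
    have e : γ = c * γ + d * γ := by rw [← add_mul, hcd, one_mul]
    rcases hc.eq_or_lt with h0 | h0
    · subst h0
      have : d = 1 := by linarith
      subst this
      nlinarith
    · nlinarith [mul_lt_mul_of_pos_left hr h0, mul_le_mul_of_nonneg_left hs.le hd]
  rw [h1, h2] at e2
  linarith

/-- Weak separation: the two segments touch the separating line in at most
one, different, endpoint each. -/
lemma seg_disj_of_weak (α β γ : ℝ) {p q r s : ℝ × ℝ}
    (hp : α * p.1 + β * p.2 = γ) (hq : α * q.1 + β * q.2 < γ)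
    (hr : α * r.1 + β * r.2 = γ) (hs : γ < α * s.1 + β * s.2) (hne : p ≠ r) :
    Disjoint (segment ℝ p q) (segment ℝ r s) := by
  rw [Set.disjoint_left]
  rintro z ⟨a, b, ha, hb, hab, rfl⟩ ⟨c, d, hc, hd, hcd, h⟩
  have h1 := congrArg Prod.fst h
  have h2 := congrArg Prod.snd h
  simp at h1 h2
  have e0 : b * (γ - (α * q.1 + β * q.2)) + d * ((α * s.1 + β * s.2) - γ) = 0 := by
    have ha' : a = 1 - b := by linarith
    have hc' : c = 1 - d := by linarith
    subst ha' hc'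
    linear_combination α * h1 + β * h2 + (1 - b) * hp - (1 - d) * hr
  have hb0 : b = 0 := by
    by_contra hb0
    have : 0 < b := lt_of_le_of_ne hb (Ne.symm hb0)
    nlinarith [mul_pos this (sub_pos.2 hq), mul_nonneg hd (sub_pos.2 hs).le]
  have hd0 : d = 0 := by
    by_contra hd0
    have : 0 < d := lt_of_le_of_ne hd (Ne.symm hd0)
    nlinarith [mul_pos this (sub_pos.2 hs), mul_nonneg hb (sub_pos.2 hq).le]
  subst hb0 hd0
  have : a = 1 := by linarith
  have : c = 1 := by linarith
  subst_vars
  simp at h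
  exact hne h.symm

lemma seg_compact (p q : ℝ × ℝ) : IsCompact (segment ℝ p q) := by
  rw [segment_eq_image]
  exact isCompact_Icc.image (by fun_prop)

lemma seg_disj_of_clm (f : StrongDual ℝ (ℝ × ℝ)) (γ : ℝ) {p q r s : ℝ × ℝ}
    (hp : f p < γ) (hq : f q < γ) (hr : γ < f r) (hs : γ < f s) :
    Disjoint (segment ℝ p q) (segment ℝ r s) := by
  have key : ∀ z : ℝ × ℝ, f z = f (1, 0) * z.1 + f (0, 1) * z.2 := by
    intro z
    have : z = z.1 • ((1 : ℝ), (0 : ℝ)) + z.2 • ((0 : ℝ), (1 : ℝ)) := by ext <;> simp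
    conv_lhs => rw [this]
    simp only [map_add, map_smul, smul_eq_mul]; ring
  rw [key] at hp hq hr hs
  exact seg_disj_of_lin _ _ γ hp.le hq.le hr hs

lemma seg_disj_eventually {X : Type*} {l : Filter X} {p q r s : X → ℝ × ℝ} {p0 q0 r0 s0 : ℝ × ℝ}
    (hp : Filter.Tendsto p l (nhds p0)) (hq : Filter.Tendsto q l (nhds q0))
    (hr : Filter.Tendsto r l (nhds r0)) (hs : Filter.Tendsto s l (nhds s0))
    (h : Disjoint (segment ℝ p0 q0) (segment ℝ r0 s0)) :
    ∀ᶠ x in l, Disjoint (segment ℝ (p x) (q x)) (segment ℝ (r x) (s x)) := by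
  obtain ⟨f, u, v, h1, h2, h3⟩ := geometric_hahn_banach_compact_closed
    (convex_segment (𝕜 := ℝ) p0 q0) (seg_compact _ _)
    (convex_segment (𝕜 := ℝ) r0 s0) (seg_compact _ _).isClosed h
  have t : ∀ {g : X → ℝ × ℝ} {g0}, Filter.Tendsto g l (nhds g0) →
      Filter.Tendsto (fun x => f (g x)) l (nhds (f g0)) := fun hg =>
    (f.continuous.tendsto _).comp hg
  have a1 := (t hp).eventually_lt_const (h1 _ (left_mem_segment ℝ p0 q0))
  have a2 := (t hq).eventually_lt_const (h1 _ (right_mem_segment ℝ p0 q0))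
  have a3 := (t hr).eventually_const_lt (h2.trans (h3 _ (left_mem_segment ℝ r0 s0)))
  have a4 := (t hs).eventually_const_lt (h2.trans (h3 _ (right_mem_segment ℝ r0 s0)))
  filter_upwards [a1, a2, a3, a4] with x b1 b2 b3 b4
  exact seg_disj_of_clm f u b1 b2 b3 b4

/-- Orientation of three points. -/
def ori (p q r : ℝ × ℝ) : ℝ := (q.1 - p.1) * (r.2 - p.2) - (q.2 - p.2) * (r.1 - p.1)

/-- Concurrency determinant of the three lines through `a b`, `c d`, `e f`. -/
def conc (a b c d e f : ℝ × ℝ) : ℝ :=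
  (b.2 - a.2) * ((c.1 - d.1) * ((f.2 - e.2) * e.1 + (e.1 - f.1) * e.2)
      - ((d.2 - c.2) * c.1 + (c.1 - d.1) * c.2) * (e.1 - f.1))
  - (a.1 - b.1) * ((d.2 - c.2) * ((f.2 - e.2) * e.1 + (e.1 - f.1) * e.2)
      - ((d.2 - c.2) * c.1 + (c.1 - d.1) * c.2) * (f.2 - e.2))
  + ((b.2 - a.2) * a.1 + (a.1 - b.1) * a.2) * ((d.2 - c.2) * (e.1 - f.1)
      - (c.1 - d.1) * (f.2 - e.2))

lemma ori_eq_zero_of_mem {p q z : ℝ × ℝ} (h : z ∈ segment ℝ p q) : ori p q z = 0 := by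
  obtain ⟨a, b, ha, hb, hab, rfl⟩ := h
  have : a = 1 - b := by linarith
  subst this
  simp [ori]; ring

lemma conc_eq_zero_of_mem {a b c d e f z : ℝ × ℝ} (h1 : z ∈ segment ℝ a b)
    (h2 : z ∈ segment ℝ c d) (h3 : z ∈ segment ℝ e f) : conc a b c d e f = 0 := by
  have k1 := ori_eq_zero_of_mem h1
  have k2 := ori_eq_zero_of_mem h2
  have k3 := ori_eq_zero_of_mem h3
  have key : ∀ A B C D E F G H I x y : ℝ, A * x + B * y = C → D * x + E * y = F →
      G * x + H * y = I →
      A * (E * I - F * H) - B * (D * I - F * G) + C * (D * H - E * G) = 0 := by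
    intro A B C D E F G H I x y h1 h2 h3
    subst h1 h2 h3
    ring
  have := key (b.2 - a.2) (a.1 - b.1) ((b.2 - a.2) * a.1 + (a.1 - b.1) * a.2)
    (d.2 - c.2) (c.1 - d.1) ((d.2 - c.2) * c.1 + (c.1 - d.1) * c.2)
    (f.2 - e.2) (e.1 - f.1) ((f.2 - e.2) * e.1 + (e.1 - f.1) * e.2) z.1 z.2
    (by simp only [ori] at k1; linarith) (by simp only [ori] at k2; linarith)
    (by simp only [ori] at k3; linarith)
  simpa [conc] using this

lemma seg_inter_of_ori {p q r z : ℝ × ℝ} (h : ori p q r ≠ 0) (h1 : z ∈ segment ℝ p q)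
    (h2 : z ∈ segment ℝ p r) : z = p := by
  obtain ⟨a, b, ha, hb, hab, rfl⟩ := h1
  have k := ori_eq_zero_of_mem h2
  have : a = 1 - b := by linarith
  subst this
  have : b * ori p q r = 0 := by
    simp only [ori, Prod.fst_add, Prod.snd_add, Prod.smul_fst, Prod.smul_snd, smul_eq_mul] at k ⊢
    linear_combination -k
  have hb0 : b = 0 := by simpa [h] using this
  subst hb0
  simp
end partA

section partB
/-- Labels of the points of a polygonal drawing: vertices and bends. -/
def lab {V E : Type} (src tgt : E → V) (N : E → ℕ) (e : E) (i : ℕ) : V ⊕ E × ℕ :=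
  if i = 0 then Sum.inl (src e) else if N e ≤ i then Sum.inl (tgt e) else Sum.inr (e, i)

/-- Two segments with no common label. -/
def SegFree {L : Type} (a b c d : L) : Prop := a ≠ c ∧ a ≠ d ∧ b ≠ c ∧ b ≠ d

/-- A polygonal drawing (not necessarily in general position) in which edges
`e`, `f` may only cross if `C e f`. -/
structure PL {V E : Type} (src tgt : E → V) (C : E → E → Prop) where
  N : E → ℕ
  hN : ∀ e, 0 < N e
  P : V ⊕ E × ℕ → ℝ × ℝ
  cross_imp : ∀ e f i j, i < N e → j < N f →
    SegFree (lab src tgt N e i) (lab src tgt N e (i + 1))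
      (lab src tgt N f j) (lab src tgt N f (j + 1)) →
    ¬ Disjoint (segment ℝ (P (lab src tgt N e i)) (P (lab src tgt N e (i + 1))))
      (segment ℝ (P (lab src tgt N f j)) (P (lab src tgt N f (j + 1)))) → C e f
  uniq : ∀ e f i j i' j', i < N e → j < N f → i' < N e → j' < N f →
    SegFree (lab src tgt N e i) (lab src tgt N e (i + 1))
      (lab src tgt N f j) (lab src tgt N f (j + 1)) →
    SegFree (lab src tgt N e i') (lab src tgt N e (i' + 1))
      (lab src tgt N f j') (lab src tgt N f (j' + 1)) →
    ¬ Disjoint (segment ℝ (P (lab src tgt N e i)) (P (lab src tgt N e (i + 1))))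
      (segment ℝ (P (lab src tgt N f j)) (P (lab src tgt N f (j + 1)))) →
    ¬ Disjoint (segment ℝ (P (lab src tgt N e i')) (P (lab src tgt N e (i' + 1))))
      (segment ℝ (P (lab src tgt N f j')) (P (lab src tgt N f (j' + 1)))) → i = i' ∧ j = j'

/-- General position of a family of points. -/
structure GenPos {L : Type} (F : Set L) (P : L → ℝ × ℝ) : Prop where
  inj : ∀ a ∈ F, ∀ b ∈ F, a ≠ b → P a ≠ P b
  tri : ∀ a ∈ F, ∀ b ∈ F, ∀ c ∈ F, a ≠ b → a ≠ c → b ≠ c → ori (P a) (P b) (P c) ≠ 0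
  six : ∀ a ∈ F, ∀ b ∈ F, ∀ c ∈ F, ∀ d ∈ F, ∀ e ∈ F, ∀ f ∈ F,
    [a, b, c, d, e, f].Nodup → conc (P a) (P b) (P c) (P d) (P e) (P f) ≠ 0

lemma dense_of_analytic {L : Type} [Fintype L] (g : (L → ℝ × ℝ) → ℝ)
    (hg : ∀ P v : L → ℝ × ℝ, AnalyticOnNhd ℝ (fun t : ℝ => g (fun i => P i + t • v i)) Set.univ)
    (v : L → ℝ × ℝ) (hv : g v ≠ 0) : Dense {P | g P ≠ 0} := by
  intro P
  rw [mem_closure_iff_nhds]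
  intro U hU
  have hc : Filter.Tendsto (fun t : ℝ => (fun i => P i + t • (v i - P i))) (nhdsWithin 0 {0}ᶜ) (nhds P) := by
    have : Continuous (fun t : ℝ => (fun i => P i + t • (v i - P i))) := by fun_prop
    have := this.tendsto 0
    simp only [zero_smul, add_zero] at this
    exact this.mono_left nhdsWithin_le_nhds
  have h1 : ∀ᶠ t in nhdsWithin (0:ℝ) {0}ᶜ, (fun i => P i + t • (v i - P i)) ∈ U := hc hU
  have h2 : ∀ᶠ t in nhdsWithin (0:ℝ) {0}ᶜ, g (fun i => P i + t • (v i - P i)) ≠ 0 := by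
    by_contra hcon
    have hf : ∃ᶠ t in nhdsWithin (0:ℝ) {0}ᶜ, g (fun i => P i + t • (v i - P i)) = 0 := by
      exact (Filter.not_eventually.1 hcon).mono (fun t h => not_not.1 h)
    have := (hg P (fun i => v i - P i)).eqOn_zero_of_preconnected_of_frequently_eq_zero
      isPreconnected_univ (Set.mem_univ 0) hf (Set.mem_univ 1)
    apply hv
    simpa using this
  obtain ⟨t, ht1, ht2⟩ := (h1.and h2).exists
  exact ⟨_, ht1, ht2⟩

lemma exists_genPos {L : Type} [Fintype L] (O : Set (L → ℝ × ℝ)) (hO : IsOpen O) (hne : O.Nonempty) :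
    ∃ P ∈ O, GenPos Set.univ P := by
  classical
  -- distinct points
  have d1 : ∀ ab : L × L, Dense {P : L → ℝ × ℝ | ab.1 ≠ ab.2 → (P ab.1).1 - (P ab.2).1 ≠ 0} := by
    rintro ⟨a, b⟩
    by_cases h : a = b
    · simp [h]
    refine (dense_of_analytic (fun P => (P a).1 - (P b).1) ?_ (fun i => if i = a then (1, 0) else 0) ?_).mono
      (fun P hP _ => hP)
    · intro P v t _
      simp only [Prod.fst_add, Prod.smul_fst, smul_eq_mul]
      fun_prop
    · simp [Ne.symm h]
  have o1 : ∀ ab : L × L, IsOpen {P : L → ℝ × ℝ | ab.1 ≠ ab.2 → (P ab.1).1 - (P ab.2).1 ≠ 0} := by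
    intro ab
    by_cases h : ab.1 = ab.2
    · simp [h]
    · simp only [ne_eq, h, not_false_eq_true, forall_const]
      exact isOpen_ne_fun (by fun_prop) (by fun_prop)
  have d2 : ∀ q : L × L × L, Dense {P : L → ℝ × ℝ | q.1 ≠ q.2.1 → q.1 ≠ q.2.2 → q.2.1 ≠ q.2.2 →
      ori (P q.1) (P q.2.1) (P q.2.2) ≠ 0} := by
    rintro ⟨a, b, c⟩
    by_cases h1 : a = b
    · simp [h1]
    by_cases h2 : a = c
    · simp [h2]
    by_cases h3 : b = c
    · simp [h3]
    refine (dense_of_analytic (fun P => ori (P a) (P b) (P c)) ?_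
      (fun i => if i = a then 0 else if i = b then (1, 0) else (0, 1)) ?_).mono
      (fun P hP _ _ _ => hP)
    · intro P v t _
      simp only [ori, Prod.fst_add, Prod.smul_fst, Prod.snd_add, Prod.smul_snd, smul_eq_mul]
      fun_prop
    · simp [ori, Ne.symm h1, Ne.symm h2, Ne.symm h3]
  have o2 : ∀ q : L × L × L, IsOpen {P : L → ℝ × ℝ | q.1 ≠ q.2.1 → q.1 ≠ q.2.2 → q.2.1 ≠ q.2.2 →
      ori (P q.1) (P q.2.1) (P q.2.2) ≠ 0} := by
    rintro ⟨a, b, c⟩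
    by_cases h1 : a = b
    · simp [h1]
    by_cases h2 : a = c
    · simp [h2]
    by_cases h3 : b = c
    · simp [h3]
    simp only [ne_eq, h1, h2, h3, not_false_eq_true, forall_const]
    exact isOpen_ne_fun (by unfold ori; fun_prop) (by fun_prop)
  have d3 : ∀ q : L × L × L × L × L × L, Dense {P : L → ℝ × ℝ |
      [q.1, q.2.1, q.2.2.1, q.2.2.2.1, q.2.2.2.2.1, q.2.2.2.2.2].Nodup →
      conc (P q.1) (P q.2.1) (P q.2.2.1) (P q.2.2.2.1) (P q.2.2.2.2.1) (P q.2.2.2.2.2) ≠ 0} := by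
    rintro ⟨a, b, c, d, e, f⟩
    by_cases h : [a, b, c, d, e, f].Nodup
    swap
    · simp [h]
    refine (dense_of_analytic (fun P => conc (P a) (P b) (P c) (P d) (P e) (P f)) ?_
      (fun i => if i = a ∨ i = c then 0 else if i = d ∨ i = e then (1, 0) else (0, 1)) ?_).mono
      (fun P hP _ => hP)
    · intro P v t _
      simp only [conc, Prod.fst_add, Prod.smul_fst, Prod.snd_add, Prod.smul_snd, smul_eq_mul]
      fun_prop
    · simp only [List.nodup_cons, List.mem_cons, not_or, List.not_mem_nil, not_false_eq_true] at h
      obtain ⟨⟨h1, h2, h3, h4, h5, -⟩, ⟨h6, h7, h8, h9, -⟩, ⟨h10, h11, h12, -⟩, ⟨h13, h14, -⟩, ⟨h15, -⟩, -⟩ := h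
      simp [conc, *, Ne.symm h1, Ne.symm h2, Ne.symm h3, Ne.symm h4, Ne.symm h5, Ne.symm h6,
        Ne.symm h7, Ne.symm h8, Ne.symm h9, Ne.symm h10, Ne.symm h11, Ne.symm h12, Ne.symm h13,
        Ne.symm h14, Ne.symm h15]
  have o3 : ∀ q : L × L × L × L × L × L, IsOpen {P : L → ℝ × ℝ |
      [q.1, q.2.1, q.2.2.1, q.2.2.2.1, q.2.2.2.2.1, q.2.2.2.2.2].Nodup →
      conc (P q.1) (P q.2.1) (P q.2.2.1) (P q.2.2.2.1) (P q.2.2.2.2.1) (P q.2.2.2.2.2) ≠ 0} := by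
    intro q
    by_cases h : [q.1, q.2.1, q.2.2.1, q.2.2.2.1, q.2.2.2.2.1, q.2.2.2.2.2].Nodup
    swap
    · simp only [h, false_imp_iff]; simp
    simp only [h, true_imp_iff]
    exact isOpen_ne_fun (by unfold conc; fun_prop) (by fun_prop)
  have D1 := dense_iInter_of_isOpen o1 d1
  have D2 := dense_iInter_of_isOpen o2 d2
  have D3 := dense_iInter_of_isOpen o3 d3
  have O1 := isOpen_iInter_of_finite o1
  have O2 := isOpen_iInter_of_finite o2
  have D := (D1.inter_of_isOpen_left D2 O1).inter_of_isOpen_left D3 (O1.inter O2)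
  obtain ⟨P, hP, hP'⟩ := D.inter_open_nonempty O hO hne
  simp only [Set.mem_inter_iff, Set.mem_iInter, Set.mem_ofPred_eq] at hP'
  obtain ⟨⟨h1, h2⟩, h3⟩ := hP'
  refine ⟨P, hP, ⟨?_, ?_, ?_⟩⟩
  · intro a _ b _ hab heq
    exact h1 (a, b) hab (by simp [heq])
  · intro a _ b _ c _ hab hac hbc
    exact h2 (a, b, c) hab hac hbc
  · intro a _ b _ c _ d _ e _ f _ hn
    exact h3 (a, b, c, d, e, f) hn

/-- The labels used by a polygonal drawing. -/
def used {V E : Type} (N : E → ℕ) : Set (V ⊕ E × ℕ) :=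
  {l | ∀ p, l = Sum.inr p → p.2 < N p.1}

lemma lab_used {V E : Type} (src tgt : E → V) (N : E → ℕ) (e : E) (i : ℕ) :
    lab src tgt N e i ∈ used (V := V) N := by
  intro p hp
  unfold lab at hp
  split_ifs at hp
  simp at hp
  subst hp
  simp; omega

lemma used_finite {V E : Type} [Finite V] [Finite E] (N : E → ℕ) : (used (V := V) N).Finite := by
  classical
  cases nonempty_fintype E
  have : used (V := V) N ⊆ Set.range Sum.inl ∪ Sum.inr '' (Set.univ ×ˢ Set.Iio (Finset.univ.sup N)) := by
    rintro (v | ⟨e, i⟩) h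
    · simp
    · right
      refine ⟨(e, i), ⟨trivial, ?_⟩, rfl⟩
      exact lt_of_lt_of_le (h _ rfl) (Finset.le_sup (f := N) (Finset.mem_univ e))
  refine Set.Finite.subset ?_ this
  exact (Set.finite_range _).union ((Set.finite_univ.prod (Set.finite_Iio _)).image _)

theorem PL.generic {V E : Type} [Finite V] [Finite E] {src tgt : E → V} {C : E → E → Prop}
    (S : PL src tgt C) : ∃ S' : PL src tgt C, GenPos (used (V := V) S'.N) S'.P := by
  classical
  cases nonempty_fintype E
  have hfin := used_finite (V := V) S.N
  have := hfin.fintype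
  let ext : ((used (V := V) S.N) → ℝ × ℝ) → V ⊕ E × ℕ → ℝ × ℝ :=
    fun P l => if h : l ∈ used (V := V) S.N then P ⟨l, h⟩ else 0
  let lb := lab src tgt S.N
  have hext : ∀ P e i, ext P (lb e i) = P ⟨lb e i, lab_used src tgt S.N e i⟩ := by
    intro P e i
    simp only [ext]
    rw [dif_pos]
  let P0 : (used (V := V) S.N) → ℝ × ℝ := fun l => S.P l
  have hP0 : ∀ e i, ext P0 (lb e i) = S.P (lb e i) := fun e i => hext _ _ _
  let Cond : ((used (V := V) S.N) → ℝ × ℝ) → Prop := fun P =>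
    ∀ e f, ∀ i : Fin (S.N e), ∀ j : Fin (S.N f),
    Disjoint (segment ℝ (S.P (lb e i)) (S.P (lb e (i + 1))))
      (segment ℝ (S.P (lb f j)) (S.P (lb f (j + 1)))) →
    Disjoint (segment ℝ (ext P (lb e i)) (ext P (lb e (i + 1))))
      (segment ℝ (ext P (lb f j)) (ext P (lb f (j + 1))))
  have hev : ∀ᶠ P in nhds P0, Cond P := by
    simp only [Cond, Filter.eventually_all]
    intro e f i j h
    have tt : ∀ e i, Filter.Tendsto (fun P => ext P (lb e i)) (nhds P0) (nhds (S.P (lb e i))) := by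
      intro e i
      simp only [hext]
      exact (continuous_apply _).tendsto _
    exact seg_disj_eventually (tt _ _) (tt _ _) (tt _ _) (tt _ _) h
  obtain ⟨O, hO1, hO2, hO3⟩ := eventually_nhds_iff.1 hev
  obtain ⟨P, hP, hG⟩ := exists_genPos O hO2 ⟨P0, hO3⟩
  have hC := hO1 P hP
  have hC' : ∀ e f i j, i < S.N e → j < S.N f →
    ¬ Disjoint (segment ℝ (ext P (lb e i)) (ext P (lb e (i + 1))))
      (segment ℝ (ext P (lb f j)) (ext P (lb f (j + 1)))) →
    ¬ Disjoint (segment ℝ (S.P (lb e i)) (S.P (lb e (i + 1))))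
      (segment ℝ (S.P (lb f j)) (S.P (lb f (j + 1)))) := by
    intro e f i j hi hj h1 h2
    exact h1 (hC e f ⟨i, hi⟩ ⟨j, hj⟩ h2)
  refine ⟨⟨S.N, S.hN, ext P, ?_, ?_⟩, ?_⟩
  · intro e f i j hi hj hf h
    exact S.cross_imp e f i j hi hj hf (hC' e f i j hi hj h)
  · intro e f i j i' j' hi hj hi' hj' hf hf' h h'
    exact S.uniq e f i j i' j' hi hj hi' hj' hf hf' (hC' e f i j hi hj h) (hC' e f i' j' hi' hj' h')
  · have hx : ∀ a (ha : a ∈ used (V := V) S.N), ext P a = P ⟨a, ha⟩ := by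
      intro a ha; simp only [ext]; rw [dif_pos ha]
    refine ⟨?_, ?_, ?_⟩
    · intro a ha b hb hab
      simp only [hx a ha, hx b hb]
      exact hG.inj _ trivial _ trivial (by simpa using hab)
    · intro a ha b hb c hc hab hac hbc
      simp only [hx a ha, hx b hb, hx c hc]
      exact hG.tri _ trivial _ trivial _ trivial (by simpa using hab) (by simpa using hac) (by simpa using hbc)
    · intro a ha b hb c hc d hd e he f hf hn
      simp only [hx a ha, hx b hb, hx c hc, hx d hd, hx e he, hx f hf]
      exact hG.six _ trivial _ trivial _ trivial _ trivial _ trivial _ trivial (by simpa using hn)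
end partB

section partC
/-- A presentation of the edges of a graph by sources and targets. -/
structure Pres {V E : Type} (G : SimpleGraph V) (src tgt : E → V) : Prop where
  adj : ∀ e, G.Adj (src e) (tgt e)
  surj : ∀ u v, G.Adj u v → ∃ e, s(src e, tgt e) = s(u, v)
  inj : ∀ e f, s(src e, tgt e) = s(src f, tgt f) → e = f

/-- Existence of a crossing of two edges. -/
def Cr {V E : Type} {G : SimpleGraph V} (D : Drawing G) (src tgt : E → V) (e f : E) : Prop :=
  ∃ p, D.IsCrossing s(src e, tgt e) s(src f, tgt f) p

open Classical in
/-- Indicator. -/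
noncomputable def ind (p : Prop) : ℕ := if p then 1 else 0

lemma Cr.symm' {V E : Type} {G : SimpleGraph V} {D : Drawing G} {src tgt : E → V} {e f : E}
    (h : Cr D src tgt e f) : Cr D src tgt f e := by
  obtain ⟨p, h1, h2, h3, h4, h5, h6, h7⟩ := h
  exact ⟨p, h2, h1, h3.symm, h5, h4, h7, h6⟩

theorem crNum_count {V E : Type} [Finite V] [Fintype E] {G : SimpleGraph V} {src tgt : E → V}
    (hp : Pres G src tgt) (D : Drawing G) (hD : D.IsGood) :
    2 * D.crNum = ∑ e, ∑ f, ind (Cr D src tgt e f) := by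
  classical
  let H : SimpleGraph E :=
    { Adj := Cr D src tgt
      symm := ⟨fun e f h => h.symm'⟩
      loopless := ⟨by rintro e ⟨p, h1, h2, h3, h4⟩; exact h3 rfl⟩ }
  let s_ : E → Sym2 V := fun e => s(src e, tgt e)
  have hs : Function.Injective s_ := fun e f h => hp.inj e f h
  have hg : Function.Injective (Sym2.map s_) := Sym2.map.injective hs
  have key : (Prod.snd '' D.crossings G.edgeSet G.edgeSet) = Sym2.map s_ '' H.edgeSet := by
    ext q
    constructor
    · rintro ⟨⟨p, q'⟩, ⟨e, f, h1, h2, h3, h4⟩, rfl⟩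
      obtain ⟨e, rfl⟩ : ∃ e', s_ e' = e := by
        induction e with | h a b => exact hp.surj a b h2
      obtain ⟨f, rfl⟩ : ∃ e', s_ e' = f := by
        induction f with | h a b => exact hp.surj a b h3
      exact ⟨s(e, f), ⟨p, h4⟩, by simpa using h1.symm⟩
    · rintro ⟨q, hq, rfl⟩
      induction q with
      | h e f =>
        obtain ⟨p, h⟩ := hq
        exact ⟨(p, s(s_ e, s_ f)), ⟨s_ e, s_ f, rfl, h.1, h.2.1, h⟩, by simp⟩
  have inj : Set.InjOn Prod.snd (D.crossings G.edgeSet G.edgeSet) := by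
    rintro ⟨p, q⟩ ⟨e, f, h1, h2, h3, h4⟩ ⟨p', q'⟩ ⟨e', f', h1', h2', h3', h4'⟩ h
    simp only at h h1 h1' h4 h4'
    subst h
    rw [h1] at h1'
    have : D.IsCrossing e f p' := by
      rcases Sym2.eq_iff.1 h1' with ⟨rfl, rfl⟩ | ⟨rfl, rfl⟩
      · exact h4'
      · obtain ⟨h1, h2, h3, h4, h5, h6, h7⟩ := h4'
        exact ⟨h2, h1, h3.symm, h5, h4, h7, h6⟩
    rw [hD.cross_once e f h4 this]
  have hcard : D.crNum = H.edgeFinset.card := by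
    have e1 : D.crNum = (D.crossings G.edgeSet G.edgeSet).ncard := rfl
    rw [e1, ← inj.ncard_image, key, Set.ncard_image_of_injective _ hg,
      ← SimpleGraph.coe_edgeFinset, Set.ncard_coe_finset]
  rw [hcard, ← H.sum_degrees_eq_twice_card_edges]
  refine Finset.sum_congr rfl fun e _ => ?_
  rw [← H.card_neighborFinset_eq_degree]
  have : ∀ f, ind (Cr D src tgt e f) = if f ∈ H.neighborFinset e then 1 else 0 := by
    intro f
    simp only [SimpleGraph.mem_neighborFinset, ind]
    rfl
  rw [Finset.sum_congr rfl (fun f _ => this f), Finset.sum_ite_mem, Finset.univ_inter,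
    Finset.card_eq_sum_ones]

/-- Clamp to the unit interval. -/
noncomputable def clamp (t : ℝ) : ℝ := max 0 (min 1 t)

/-- The polygonal arc through the points `c 0, …, c N`. -/
noncomputable def plArc (c : ℕ → ℝ × ℝ) (N : ℕ) (t : ℝ) : ℝ × ℝ :=
  c 0 + ∑ i ∈ Finset.range N, clamp (N * t - i) • (c (i + 1) - c i)

lemma plArc_cont (c : ℕ → ℝ × ℝ) (N : ℕ) : Continuous (plArc c N) := by
  unfold plArc clamp
  fun_prop

lemma plArc_eq (c : ℕ → ℝ × ℝ) (N : ℕ) (t : ℝ) (i : ℕ) (hi : i < N) (s : ℝ) (hs : 0 ≤ s) (hs1 : s ≤ 1)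
    (ht : N * t = i + s) : plArc c N t = c i + s • (c (i + 1) - c i) := by
  have key : ∀ k, k ≤ i → c 0 + ∑ j ∈ Finset.range k, clamp (N * t - j) • (c (j + 1) - c j) = c k := by
    intro k
    induction k with
    | zero => simp
    | succ k ih =>
      intro hk
      rw [Finset.sum_range_succ, ← add_assoc, ih (by omega)]
      have : clamp (N * t - k) = 1 := by
        have : (k : ℝ) + 1 ≤ i := by exact_mod_cast hk
        rw [ht, clamp, min_eq_left (by linarith), max_eq_right (by norm_num)]
      rw [this]; simp
  have key2 : ∀ k, i + 1 ≤ k → c 0 + ∑ j ∈ Finset.range k, clamp (N * t - j) • (c (j + 1) - c j)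
      = c i + s • (c (i + 1) - c i) := by
    intro k hk
    induction k, hk using Nat.le_induction with
    | base =>
      rw [Finset.sum_range_succ, ← add_assoc, key i le_rfl]
      have : clamp (N * t - i) = s := by
        rw [ht, clamp, min_eq_right (by linarith), max_eq_right (by linarith)]; ring
      rw [this]
    | succ k hk ih =>
      rw [Finset.sum_range_succ, ← add_assoc, ih]
      have : clamp (N * t - k) = 0 := by
        have : (i : ℝ) + 1 ≤ k := by exact_mod_cast hk
        rw [ht, clamp, max_eq_left]
        exact (min_le_right _ _).trans (by linarith)
      rw [this]; simp
  exact key2 N hi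

lemma exists_param (N : ℕ) (hN : 0 < N) (t : ℝ) (ht : t ∈ Set.Icc (0:ℝ) 1) :
    ∃ i < N, ∃ s : ℝ, 0 ≤ s ∧ s ≤ 1 ∧ N * t = i + s := by
  have hN' : (0:ℝ) < N := by exact_mod_cast hN
  by_cases h : t = 1
  · refine ⟨N - 1, by omega, 1, by norm_num, le_rfl, ?_⟩
    rw [h, Nat.cast_sub hN]; simp
  have h1 : t < 1 := lt_of_le_of_ne ht.2 h
  have h0 : 0 ≤ N * t := mul_nonneg hN'.le ht.1
  refine ⟨⌊N * t⌋₊, ?_, N * t - ⌊N * t⌋₊, ?_, ?_, by ring⟩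
  · rw [Nat.floor_lt h0]; nlinarith
  · linarith [Nat.floor_le h0]
  · linarith [Nat.lt_floor_add_one (N * t)]

lemma plArc_image (c : ℕ → ℝ × ℝ) (N : ℕ) (hN : 0 < N) (p : ℝ × ℝ) :
    p ∈ plArc c N '' Set.Icc 0 1 ↔ ∃ i < N, p ∈ segment ℝ (c i) (c (i + 1)) := by
  have hN' : (0:ℝ) < N := by exact_mod_cast hN
  constructor
  · rintro ⟨t, ht, rfl⟩
    obtain ⟨i, hi, s, h0, h1, h⟩ := exists_param N hN t ht
    refine ⟨i, hi, ?_⟩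
    rw [plArc_eq c N t i hi s h0 h1 h, segment_eq_image']
    exact ⟨s, ⟨h0, h1⟩, rfl⟩
  · rintro ⟨i, hi, h⟩
    rw [segment_eq_image'] at h
    obtain ⟨s, ⟨h0, h1⟩, rfl⟩ := h
    have hi' : (i : ℝ) + 1 ≤ N := by exact_mod_cast hi
    refine ⟨(i + s) / N, ⟨by positivity, ?_⟩, ?_⟩
    · rw [div_le_one hN']; linarith
    · exact plArc_eq c N _ i hi s h0 h1 (by field_simp)

lemma seg_inter_unique {a b c d z w : ℝ × ℝ} (h : ori a b c ≠ 0)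
    (h1 : z ∈ segment ℝ a b) (h2 : z ∈ segment ℝ c d)
    (h3 : w ∈ segment ℝ a b) (h4 : w ∈ segment ℝ c d) : z = w := by
  rw [segment_eq_image'] at h1 h2 h3 h4
  obtain ⟨s, -, rfl⟩ := h1
  obtain ⟨u, -, e1⟩ := h2
  obtain ⟨s', -, rfl⟩ := h3
  obtain ⟨u', -, e2⟩ := h4
  have a1 := congrArg Prod.fst e1
  have a2 := congrArg Prod.snd e1
  have a3 := congrArg Prod.fst e2
  have a4 := congrArg Prod.snd e2
  simp at a1 a2 a3 a4
  have : (s' - s) * ori a b c = 0 := by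
    have e : (s' - s) * ori a b c = ori (a + s • (b - a)) (a + s' • (b - a)) c := by
      simp [ori]; ring
    rw [e]; simp only [ori, Prod.fst_add, Prod.snd_add, Prod.smul_fst, Prod.smul_snd, smul_eq_mul, Prod.fst_sub, Prod.snd_sub, ← a1, ← a2, ← a3, ← a4]
    ring
  have : s' = s := by
    rcases mul_eq_zero.1 this with h' | h'
    · linarith
    · exact absurd h' h
  rw [this]
end partC

section partD
section toDrawing

variable {V E : Type} {src tgt : E → V} {C : E → E → Prop}

lemma lab_zero (N : E → ℕ) (e : E) : lab src tgt N e 0 = Sum.inl (src e) := by simp [lab]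

lemma lab_N (N : E → ℕ) (e : E) (h : 0 < N e) : lab src tgt N e (N e) = Sum.inl (tgt e) := by
  simp [lab, h.ne']

lemma lab_inj (N : E → ℕ) (e : E) (hne : src e ≠ tgt e) {i j : ℕ} (hi : i ≤ N e) (hj : j ≤ N e)
    (h : lab src tgt N e i = lab src tgt N e j) : i = j := by
  unfold lab at h
  split_ifs at h <;> simp_all <;> omega

lemma lab_inl (N : E → ℕ) (e : E) {i : ℕ} {v : V} (h : lab src tgt N e i = Sum.inl v) :
    v = src e ∨ v = tgt e := by
  unfold lab at h
  split_ifs at h <;> simp_all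

lemma lab_common (N : E → ℕ) {e f : E} (hef : e ≠ f) {i j : ℕ}
    (h : lab src tgt N e i = lab src tgt N f j) :
    ∃ v, lab src tgt N e i = Sum.inl v ∧ (v = src e ∨ v = tgt e) ∧ (v = src f ∨ v = tgt f) := by
  unfold lab at h ⊢
  split_ifs at h ⊢ <;> simp_all

lemma GenPos.vertex_on {F : Set (V ⊕ E × ℕ)} {P : V ⊕ E × ℕ → ℝ × ℝ} (hG : GenPos F P)
    {l a b : V ⊕ E × ℕ} (hl : l ∈ F) (ha : a ∈ F) (hb : b ∈ F) (hab : a ≠ b)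
    (h : P l ∈ segment ℝ (P a) (P b)) : l = a ∨ l = b := by
  by_contra hcon
  push Not at hcon
  exact hG.tri a ha b hb l hl hab (Ne.symm hcon.1) (Ne.symm hcon.2) (ori_eq_zero_of_mem h)

/-- The chain of an edge. -/
def PL.ch (S : PL src tgt C) (e : E) (i : ℕ) : ℝ × ℝ := S.P (lab src tgt S.N e i)

variable {G : SimpleGraph V}

open Classical in
/-- The arcs of a polygonal drawing. -/
noncomputable def PL.arc (S : PL src tgt C) (a b : V) (t : ℝ) : ℝ × ℝ :=
  if h : ∃ e, src e = a ∧ tgt e = b then plArc (S.ch h.choose) (S.N h.choose) t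
  else if h : ∃ e, src e = b ∧ tgt e = a then plArc (S.ch h.choose) (S.N h.choose) (1 - t)
  else 0

lemma PL.arc_eq (hp : Pres G src tgt) (S : PL src tgt C) (e : E) (t : ℝ) :
    S.arc (src e) (tgt e) t = plArc (S.ch e) (S.N e) t := by
  have h : ∃ e', src e' = src e ∧ tgt e' = tgt e := ⟨e, rfl, rfl⟩
  rw [PL.arc, dif_pos h]
  have : h.choose = e := hp.inj _ _ (by rw [h.choose_spec.1, h.choose_spec.2])
  rw [this]

lemma PL.arc_eq' (hp : Pres G src tgt) (S : PL src tgt C) (e : E) (t : ℝ) :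
    S.arc (tgt e) (src e) t = plArc (S.ch e) (S.N e) (1 - t) := by
  have h : ∃ e', src e' = src e ∧ tgt e' = tgt e := ⟨e, rfl, rfl⟩
  have h' : ¬ ∃ e', src e' = tgt e ∧ tgt e' = src e := by
    rintro ⟨e', h1, h2⟩
    have : e' = e := hp.inj _ _ (by rw [h1, h2]; exact Sym2.eq_swap)
    subst this
    exact (hp.adj e').ne h1
  rw [PL.arc, dif_neg h', dif_pos h]
  have : h.choose = e := hp.inj _ _ (by rw [h.choose_spec.1, h.choose_spec.2])
  rw [this]

lemma Pres.cases (hp : Pres G src tgt) {a b : V} (h : G.Adj a b) :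
    ∃ e, (src e = a ∧ tgt e = b) ∨ (src e = b ∧ tgt e = a) := by
  obtain ⟨e, he⟩ := hp.surj a b h
  exact ⟨e, Sym2.eq_iff.1 he⟩

/-- `p` lies on the `i`-th segment of `e`. -/
def PL.On (S : PL src tgt C) (e : E) (i : ℕ) (p : ℝ × ℝ) : Prop :=
  i < S.N e ∧ p ∈ segment ℝ (S.ch e i) (S.ch e (i + 1))

lemma PL.arc_image (hp : Pres G src tgt) (S : PL src tgt C) (e : E) (p : ℝ × ℝ) :
    p ∈ S.arc (src e) (tgt e) '' Set.Icc 0 1 ↔ ∃ i, S.On e i p := by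
  have : S.arc (src e) (tgt e) = plArc (S.ch e) (S.N e) := funext fun t => S.arc_eq hp e t
  rw [this, plArc_image _ _ (S.hN e)]
  rfl

lemma PL.arc_image' (hp : Pres G src tgt) (S : PL src tgt C) (e : E) (p : ℝ × ℝ) :
    p ∈ S.arc (tgt e) (src e) '' Set.Icc 0 1 ↔ ∃ i, S.On e i p := by
  have h1 : S.arc (tgt e) (src e) = plArc (S.ch e) (S.N e) ∘ (fun t => 1 - t) :=
    funext fun t => S.arc_eq' hp e t
  rw [h1, Set.image_comp]
  have : (fun t : ℝ => 1 - t) '' Set.Icc 0 1 = Set.Icc 0 1 := by simp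
  rw [this, plArc_image _ _ (S.hN e)]
  rfl


lemma PL.same_edge
    (hC : ∀ e f, C e f → ∀ v, (v = src e ∨ v = tgt e) → (v = src f ∨ v = tgt f) → False)
    (hp : Pres G src tgt) (S : PL src tgt C) (hG : GenPos (used (V := V) S.N) S.P)
    {e : E} {i j : ℕ} {p : ℝ × ℝ} (h1 : S.On e i p) (h2 : S.On e j p) (hij : i < j) :
    j = i + 1 ∧ p = S.ch e (i + 1) := by
  have hne := (hp.adj e).ne
  obtain ⟨hi, h1⟩ := h1
  obtain ⟨hj, h2⟩ := h2
  have hl : ∀ a b, a ≤ S.N e → b ≤ S.N e → a ≠ b → lab src tgt S.N e a ≠ lab src tgt S.N e b :=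
    fun a b ha hb hab h => hab (lab_inj S.N e hne ha hb h)
  by_cases hj1 : j = i + 1
  · subst hj1
    refine ⟨rfl, ?_⟩
    rw [segment_symm] at h1
    refine seg_inter_of_ori ?_ h1 h2
    exact hG.tri _ (lab_used _ _ _ _ _) _ (lab_used _ _ _ _ _) _ (lab_used _ _ _ _ _) (hl _ _ (by omega) (by omega) (by omega))
      (hl _ _ (by omega) (by omega) (by omega)) (hl _ _ (by omega) (by omega) (by omega))
  · exfalso
    have := S.cross_imp e e i j hi hj ⟨hl _ _ (by omega) (by omega) (by omega),
      hl _ _ (by omega) (by omega) (by omega), hl _ _ (by omega) (by omega) (by omega),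
      hl _ _ (by omega) (by omega) (by omega)⟩ (Set.not_disjoint_iff.2 ⟨p, h1, h2⟩)
    exact hC _ _ this _ (Or.inl rfl) (Or.inl rfl)

lemma PL.arc_injOn
    (hC : ∀ e f, C e f → ∀ v, (v = src e ∨ v = tgt e) → (v = src f ∨ v = tgt f) → False)
    (hp : Pres G src tgt) (S : PL src tgt C) (hG : GenPos (used (V := V) S.N) S.P)
    (e : E) : Set.InjOn (plArc (S.ch e) (S.N e)) (Set.Icc 0 1) := by
  have hne := (hp.adj e).ne
  have hN : (0:ℝ) < S.N e := by exact_mod_cast S.hN e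
  have hl : ∀ a b, a ≤ S.N e → b ≤ S.N e → a ≠ b → S.ch e a ≠ S.ch e b :=
    fun a b ha hb hab => hG.inj _ (lab_used _ _ _ _ _) _ (lab_used _ _ _ _ _)
      fun h => hab (lab_inj S.N e hne ha hb h)
  have inj1 : ∀ i < S.N e, ∀ s s' : ℝ, S.ch e i + s • (S.ch e (i + 1) - S.ch e i) =
      S.ch e i + s' • (S.ch e (i + 1) - S.ch e i) → s = s' := by
    intro i hi s s' h
    have h' := add_left_cancel h
    exact smul_left_injective ℝ (sub_ne_zero.2 (hl (i+1) i (by omega) (by omega) (by omega))) h'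
  have on : ∀ i < S.N e, ∀ s : ℝ, 0 ≤ s → s ≤ 1 →
      S.On e i (S.ch e i + s • (S.ch e (i + 1) - S.ch e i)) := by
    intro i hi s h0 h1
    refine ⟨hi, ?_⟩
    rw [segment_eq_image']; exact ⟨s, ⟨h0, h1⟩, rfl⟩
  have main : ∀ i < S.N e, ∀ j < S.N e, ∀ s s' : ℝ, 0 ≤ s → s ≤ 1 → 0 ≤ s' → s' ≤ 1 → i < j →
      S.ch e i + s • (S.ch e (i + 1) - S.ch e i) = S.ch e j + s' • (S.ch e (j + 1) - S.ch e j) →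
      (i : ℝ) + s = j + s' := by
    intro i hi j hj s s' h0 h1 h0' h1' hij h
    have o1 := on i hi s h0 h1
    have o2 := on j hj s' h0' h1'
    rw [← h] at o2
    obtain ⟨rfl, h3⟩ := S.same_edge hC hp hG o1 o2 hij
    have e1 : s = 1 := inj1 i hi s 1 (by rw [h3]; simp)
    have e2 : s' = 0 := inj1 (i+1) hj s' 0 (by rw [← h, h3]; simp)
    rw [e1, e2]; push_cast; ring
  intro t ht t' ht' h
  obtain ⟨i, hi, s, h0, h1, hs⟩ := exists_param _ (S.hN e) t ht
  obtain ⟨j, hj, s', h0', h1', hs'⟩ := exists_param _ (S.hN e) t' ht'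
  rw [plArc_eq _ _ t i hi s h0 h1 hs, plArc_eq _ _ t' j hj s' h0' h1' hs'] at h
  have : (i : ℝ) + s = j + s' := by
    rcases lt_trichotomy i j with hij | hij | hij
    · exact main i hi j hj s s' h0 h1 h0' h1' hij h
    · subst hij; rw [inj1 i hi s s' h]
    · exact (main j hj i hi s' s h0' h1' h0 h1 hij h.symm).symm
  rw [← hs, ← hs'] at this
  exact mul_left_cancel₀ hN.ne' this

/-- The drawing of a generic polygonal drawing. -/
noncomputable def PL.draw (hp : Pres G src tgt) (S : PL src tgt C)
    (hG : GenPos (used (V := V) S.N) S.P) : Drawing G where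
  pos v := S.P (Sum.inl v)
  pos_inj a b h := by
    by_contra hab
    exact hG.inj (Sum.inl a) (by rintro p ⟨⟩) (Sum.inl b) (by rintro p ⟨⟩) (by simpa using hab) h
  arc := S.arc
  arc_cont a b hab := by
    obtain ⟨e, ⟨rfl, rfl⟩ | ⟨rfl, rfl⟩⟩ := hp.cases hab
    · rw [show S.arc (src e) (tgt e) = plArc (S.ch e) (S.N e) from funext fun t => S.arc_eq hp e t]
      exact (plArc_cont _ _).continuousOn
    · rw [show S.arc (tgt e) (src e) = fun t => plArc (S.ch e) (S.N e) (1 - t) from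
        funext fun t => S.arc_eq' hp e t]
      exact ((plArc_cont _ _).comp (by fun_prop)).continuousOn
  arc_zero a b hab := by
    obtain ⟨e, ⟨rfl, rfl⟩ | ⟨rfl, rfl⟩⟩ := hp.cases hab
    · rw [S.arc_eq hp, plArc_eq _ _ 0 0 (S.hN e) 0 le_rfl zero_le_one (by simp)]
      simp [PL.ch, lab_zero]
    · rw [S.arc_eq' hp, plArc_eq _ _ (1 - 0) (S.N e - 1) (by have := S.hN e; omega) 1 zero_le_one le_rfl
        (by have := S.hN e; push_cast [Nat.cast_sub this]; ring)]
      have := S.hN e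
      simp [PL.ch, Nat.sub_add_cancel this, lab_N _ _ this]
  arc_one a b hab := by
    obtain ⟨e, ⟨rfl, rfl⟩ | ⟨rfl, rfl⟩⟩ := hp.cases hab
    · rw [S.arc_eq hp, plArc_eq _ _ 1 (S.N e - 1) (by have := S.hN e; omega) 1 zero_le_one le_rfl
        (by have := S.hN e; push_cast [Nat.cast_sub this]; ring)]
      have := S.hN e
      simp [PL.ch, Nat.sub_add_cancel this, lab_N _ _ this]
    · rw [S.arc_eq' hp, plArc_eq _ _ (1 - 1) 0 (S.hN e) 0 le_rfl zero_le_one (by simp)]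
      simp [PL.ch, lab_zero]
  arc_symm a b hab t := by
    obtain ⟨e, ⟨rfl, rfl⟩ | ⟨rfl, rfl⟩⟩ := hp.cases hab
    · rw [S.arc_eq hp, S.arc_eq' hp]
    · rw [S.arc_eq hp, S.arc_eq' hp]; simp
  arc_avoid a b hab c hca hcb := by
    have main : ∀ e i, S.On e i (S.P (Sum.inl c)) → c = src e ∨ c = tgt e := by
      rintro e i ⟨hi, h⟩
      have hne : lab src tgt S.N e i ≠ lab src tgt S.N e (i + 1) := fun h => by
        have := lab_inj S.N e (hp.adj e).ne (by omega) (by omega) h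
        omega
      rcases hG.vertex_on (l := Sum.inl c) (by rintro p ⟨⟩) (lab_used _ _ _ _ _) (lab_used _ _ _ _ _) hne h with h | h
      · exact lab_inl _ _ h.symm
      · exact lab_inl _ _ h.symm
    obtain ⟨e, ⟨rfl, rfl⟩ | ⟨rfl, rfl⟩⟩ := hp.cases hab
    · rw [S.arc_image hp]
      rintro ⟨i, h⟩
      rcases main e i h with h | h
      · exact hca h
      · exact hcb h
    · rw [S.arc_image' hp]
      rintro ⟨i, h⟩
      rcases main e i h with h | h
      · exact hcb h
      · exact hca h

lemma PL.draw_edgePoints (hp : Pres G src tgt) (S : PL src tgt C)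
    (hG : GenPos (used (V := V) S.N) S.P) {e : E} {p : ℝ × ℝ}
    (h : p ∈ (S.draw hp hG).edgePoints s(src e, tgt e)) : ∃ i, S.On e i p := by
  obtain ⟨a, b, h1, h2, h3⟩ := h
  rcases Sym2.eq_iff.1 h1 with ⟨rfl, rfl⟩ | ⟨rfl, rfl⟩
  · exact (S.arc_image hp e p).1 h3
  · exact (S.arc_image' hp e p).1 h3

lemma PL.crossing_free (hp : Pres G src tgt) (S : PL src tgt C)
    (hG : GenPos (used (V := V) S.N) S.P) {e f : E} {p : ℝ × ℝ}
    (h : (S.draw hp hG).IsCrossing s(src e, tgt e) s(src f, tgt f) p) :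
    ∃ i j, S.On e i p ∧ S.On f j p ∧ SegFree (lab src tgt S.N e i) (lab src tgt S.N e (i + 1))
      (lab src tgt S.N f j) (lab src tgt S.N f (j + 1)) := by
  obtain ⟨-, -, hne, h1, h2, h3, h4⟩ := h
  have hef : e ≠ f := by rintro rfl; exact hne rfl
  obtain ⟨i, hi⟩ := S.draw_edgePoints hp hG h1
  obtain ⟨j, hj⟩ := S.draw_edgePoints hp hG h2
  refine ⟨i, j, hi, hj, ?_⟩
  have nE : lab src tgt S.N e i ≠ lab src tgt S.N e (i + 1) := fun h => by
    have := lab_inj S.N e (hp.adj e).ne hi.1.le hi.1 h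
    omega
  have nF : lab src tgt S.N f j ≠ lab src tgt S.N f (j + 1) := fun h => by
    have := lab_inj S.N f (hp.adj f).ne hj.1.le hj.1 h
    omega
  -- a common label would be the crossing point
  have main : ∀ a b a' b' : ℕ, lab src tgt S.N e a = lab src tgt S.N f b →
      lab src tgt S.N e a ≠ lab src tgt S.N e a' → lab src tgt S.N f b ≠ lab src tgt S.N f b' →
      p ∈ segment ℝ (S.ch e a) (S.ch e a') → p ∈ segment ℝ (S.ch f b) (S.ch f b') → False := by
    intro a b a' b' hab ha hb hpa hpb
    obtain ⟨v, hv, hv1, hv2⟩ := lab_common S.N hef hab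
    have hd : lab src tgt S.N e a' ≠ lab src tgt S.N f b' := by
      intro hab'
      obtain ⟨w, hw, hw1, hw2⟩ := lab_common S.N hef hab'
      have hvw : v ≠ w := by rintro rfl; exact ha (hv.trans hw.symm)
      apply hef
      apply hp.inj
      rcases hv1 with rfl | rfl <;> rcases hw1 with rfl | rfl <;> rcases hv2 with h | h <;>
        rcases hw2 with h' | h' <;> simp_all
    have : p = S.ch e a := by
      have e1 : S.ch f b = S.ch e a := by simp only [PL.ch, hab]
      rw [e1] at hpb
      refine seg_inter_of_ori ?_ hpa hpb
      exact hG.tri _ (lab_used _ _ _ _ _) _ (lab_used _ _ _ _ _) _ (lab_used _ _ _ _ _) ha (hab ▸ hb) hd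
    apply h3
    refine ⟨v, ?_, ?_⟩
    · rcases hv1 with rfl | rfl <;> simp
    · rw [this]; simp only [PL.ch, hv]; rfl
  have hi' := hi.2
  have hj' := hj.2
  rw [segment_symm] at hi' hj'
  exact ⟨fun h => main _ _ _ _ h nE nF hi.2 hj.2, fun h => main _ _ _ _ h nE nF.symm hi.2 hj',
    fun h => main _ _ _ _ h nE.symm nF hi' hj.2, fun h => main _ _ _ _ h nE.symm nF.symm hi' hj'⟩

lemma Pres.edge (hp : Pres G src tgt) {e : Sym2 V} (h : e ∈ G.edgeSet) :
    ∃ e', s(src e', tgt e') = e := by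
  induction e with | h a b => exact hp.surj a b h

lemma PL.draw_good
    (hC : ∀ e f, C e f → ∀ v, (v = src e ∨ v = tgt e) → (v = src f ∨ v = tgt f) → False)
    (hp : Pres G src tgt) (S : PL src tgt C)
    (hG : GenPos (used (V := V) S.N) S.P) : (S.draw hp hG).IsGood where
  arc_inj a b hab := by
    obtain ⟨e, ⟨rfl, rfl⟩ | ⟨rfl, rfl⟩⟩ := hp.cases hab
    · have := S.arc_injOn hC hp hG e
      rw [← show S.arc (src e) (tgt e) = plArc (S.ch e) (S.N e) from
        funext fun t => S.arc_eq hp e t] at this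
      exact this
    · have := S.arc_injOn hC hp hG e
      intro t ht t' ht' h
      have h' : plArc (S.ch e) (S.N e) (1 - t) = plArc (S.ch e) (S.N e) (1 - t') := by
        rw [← S.arc_eq' hp, ← S.arc_eq' hp]; exact h
      have := this ⟨by linarith [ht.2], by linarith [ht.1]⟩ ⟨by linarith [ht'.2], by linarith [ht'.1]⟩ h'
      linarith
  adj_no_cross e f hv p h := by
    obtain ⟨e, rfl⟩ := hp.edge h.1
    obtain ⟨f, rfl⟩ := hp.edge h.2.1
    obtain ⟨v, h1, h2⟩ := hv
    obtain ⟨i, j, hi, hj, hf⟩ := S.crossing_free hp hG h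
    have := S.cross_imp e f i j hi.1 hj.1 hf (Set.not_disjoint_iff.2 ⟨p, hi.2, hj.2⟩)
    exact hC e f this v (by simpa using h1) (by simpa using h2)
  cross_once e f p h p' h' := by
    obtain ⟨e, rfl⟩ := hp.edge h.1
    obtain ⟨f, rfl⟩ := hp.edge h.2.1
    obtain ⟨i, j, hi, hj, hf⟩ := S.crossing_free hp hG h
    obtain ⟨i', j', hi', hj', hf'⟩ := S.crossing_free hp hG h'
    obtain ⟨rfl, rfl⟩ := S.uniq e f i j i' j' hi.1 hj.1 hi'.1 hj'.1 hf hf'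
      (Set.not_disjoint_iff.2 ⟨p, hi.2, hj.2⟩) (Set.not_disjoint_iff.2 ⟨p', hi'.2, hj'.2⟩)
    refine seg_inter_unique ?_ hi.2 hj.2 hi'.2 hj'.2
    refine hG.tri _ (lab_used _ _ _ _ _) _ (lab_used _ _ _ _ _) _ (lab_used _ _ _ _ _) ?_ hf.1 hf.2.2.1
    intro h
    have := lab_inj S.N e (hp.adj e).ne hi.1.le hi.1 h
    omega
  no_triple p e f g hef heg hfg := by
    rintro ⟨h1, h2, h3⟩
    obtain ⟨e, rfl⟩ := hp.edge h1.1
    obtain ⟨f, rfl⟩ := hp.edge h2.1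
    obtain ⟨g, rfl⟩ := hp.edge h3.2.1
    have nn : ∀ e i, S.On e i p → lab src tgt S.N e i ≠ lab src tgt S.N e (i + 1) := by
      intro e i hi h
      have := lab_inj S.N e (hp.adj e).ne hi.1.le hi.1 h
      omega
    -- a crossing point is not a label
    have nl : ∀ e f, e ≠ f → ∀ i j, S.On e i p → S.On f j p →
        SegFree (lab src tgt S.N e i) (lab src tgt S.N e (i + 1))
        (lab src tgt S.N f j) (lab src tgt S.N f (j + 1)) →
        ∀ k, S.On e k p → k = i := by
      intro e f hef i j hi hj hf k hk
      by_contra hki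
      have : p = S.ch e i ∨ p = S.ch e (i + 1) := by
        rcases lt_or_gt_of_ne hki with h | h
        · obtain ⟨rfl, hq⟩ := S.same_edge hC hp hG hk hi h
          exact Or.inl hq
        · obtain ⟨rfl, hq⟩ := S.same_edge hC hp hG hi hk h
          exact Or.inr hq
      have hj2 := hj.2
      rcases this with h | h <;> rw [h] at hj2 <;>
        rcases hG.vertex_on (lab_used _ _ _ _ _) (lab_used _ _ _ _ _) (lab_used _ _ _ _ _) (nn f j hj) hj2 with h' | h'
      · exact hf.1 h'
      · exact hf.2.1 h'
      · exact hf.2.2.1 h'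
      · exact hf.2.2.2 h'
    have hef' : e ≠ f := by rintro rfl; exact hef rfl
    have heg' : e ≠ g := by rintro rfl; exact heg rfl
    have hfg' : f ≠ g := by rintro rfl; exact hfg rfl
    obtain ⟨i, j, hi, hj, hij⟩ := S.crossing_free hp hG h1
    obtain ⟨j', k, hj', hk, hjk⟩ := S.crossing_free hp hG h2
    obtain ⟨i', k', hi', hk', hik⟩ := S.crossing_free hp hG h3
    obtain rfl := nl e f hef' i j hi hj hij i' hi'
    obtain rfl := nl f g hfg' j' k hj' hk hjk j hj
    have sw : SegFree (lab src tgt S.N g k) (lab src tgt S.N g (k + 1))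
        (lab src tgt S.N f j) (lab src tgt S.N f (j + 1)) :=
      ⟨hjk.1.symm, hjk.2.2.1.symm, hjk.2.1.symm, hjk.2.2.2.symm⟩
    obtain rfl := nl g f hfg'.symm k j hk hj sw k' hk'
    refine hG.six _ (lab_used _ _ _ _ _) _ (lab_used _ _ _ _ _) _ (lab_used _ _ _ _ _) _ (lab_used _ _ _ _ _) _ (lab_used _ _ _ _ _)
      _ (lab_used _ _ _ _ _) ?_ (conc_eq_zero_of_mem hi.2 hj.2 hk.2)
    simp only [List.nodup_cons, List.mem_cons, not_or, List.not_mem_nil, not_false_eq_true,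
      List.nodup_nil, and_true]
    exact ⟨⟨nn e _ hi, hij.1, hij.2.1, hik.1, hik.2.1⟩, ⟨hij.2.2.1, hij.2.2.2, hik.2.2.1, hik.2.2.2⟩,
      ⟨nn f _ hj, hjk.1, hjk.2.1⟩, ⟨hjk.2.2.1, hjk.2.2.2⟩, nn g _ hk⟩

theorem PL.toDrawing [Fintype V] [Fintype E] (hp : Pres G src tgt) (S : PL src tgt C)
    (hC : ∀ e f, C e f → ∀ v, (v = src e ∨ v = tgt e) → (v = src f ∨ v = tgt f) → False) :
    ∃ D : Drawing G, D.IsGood ∧ 2 * D.crNum ≤ ∑ e, ∑ f, ind (C e f) := by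
  classical
  obtain ⟨S', hG⟩ := S.generic
  refine ⟨S'.draw hp hG, S'.draw_good hC hp hG, ?_⟩
  rw [crNum_count hp _ (S'.draw_good hC hp hG)]
  refine Finset.sum_le_sum fun e _ => Finset.sum_le_sum fun f _ => ?_
  unfold ind
  by_cases h : Cr (S'.draw hp hG) src tgt e f
  · obtain ⟨p, h'⟩ := id h
    obtain ⟨i, j, hi, hj, hf⟩ := S'.crossing_free hp hG h'
    have := S'.cross_imp e f i j hi.1 hj.1 hf (Set.not_disjoint_iff.2 ⟨p, hi.2, hj.2⟩)
    rw [if_pos h, if_pos this]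
  · rw [if_neg h]; exact Nat.zero_le _

end toDrawing
end partD

section partE
/-- Squared Euclidean distance. -/
def sqd (p s : ℝ × ℝ) : ℝ := (p.1 - s.1) ^ 2 + (p.2 - s.2) ^ 2

lemma sqd_cont (s : ℝ × ℝ) : Continuous (fun p => sqd p s) := by unfold sqd; fun_prop

lemma sqd_comb (a b : ℝ) (hab : a + b = 1) (x y s : ℝ × ℝ) :
    sqd (a • x + b • y) s = a * sqd x s + b * sqd y s - a * b * sqd x y := by
  have : a = 1 - b := by linarith
  subst this
  simp [sqd]; ring

lemma sqd_nonneg (p s : ℝ × ℝ) : 0 ≤ sqd p s := by unfold sqd; positivity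

lemma sqd_self (s : ℝ × ℝ) : sqd s s = 0 := by simp [sqd]

lemma sqd_pos {p s : ℝ × ℝ} (h : p ≠ s) : 0 < sqd p s := by
  rcases (sqd_nonneg p s).eq_or_lt with h' | h'
  · exfalso; apply h
    unfold sqd at h'
    have h1 : (p.1 - s.1) = 0 := by nlinarith [sq_nonneg (p.1 - s.1), sq_nonneg (p.2 - s.2)]
    have h2 : (p.2 - s.2) = 0 := by nlinarith [sq_nonneg (p.1 - s.1), sq_nonneg (p.2 - s.2)]
    ext <;> linarith
  · exact h'

/-- Closed Euclidean disc of squared radius `R`. -/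
def Bd (R : ℝ) (s : ℝ × ℝ) : Set (ℝ × ℝ) := {p | sqd p s ≤ R}
/-- Open Euclidean disc of squared radius `R`. -/
def Od (R : ℝ) (s : ℝ × ℝ) : Set (ℝ × ℝ) := {p | sqd p s < R}

lemma Bd_closed (R : ℝ) (s : ℝ × ℝ) : IsClosed (Bd R s) := isClosed_le (sqd_cont s) continuous_const
lemma Od_open (R : ℝ) (s : ℝ × ℝ) : IsOpen (Od R s) := isOpen_lt (sqd_cont s) continuous_const

lemma seg_sub_Bd {R : ℝ} {s p q : ℝ × ℝ} (hp : p ∈ Bd R s) (hq : q ∈ Bd R s) :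
    segment ℝ p q ⊆ Bd R s := by
  rintro z ⟨a, b, ha, hb, hab, rfl⟩
  have h1 : sqd p s ≤ R := hp
  have h2 : sqd q s ≤ R := hq
  change sqd _ s ≤ R
  rw [sqd_comb a b hab]
  have := mul_nonneg (mul_nonneg ha hb) (sqd_nonneg p q)
  have e : R = a * R + b * R := by rw [← add_mul, hab, one_mul]
  nlinarith [mul_le_mul_of_nonneg_left h1 ha, mul_le_mul_of_nonneg_left h2 hb]

lemma seg_boundary {R : ℝ} {s p q z : ℝ × ℝ} (hp : p ∈ Bd R s) (hq : q ∈ Bd R s)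
    (hz : z ∈ segment ℝ p q) (hz' : z ∉ Od R s) : z = p ∨ z = q := by
  obtain ⟨a, b, ha, hb, hab, rfl⟩ := hz
  have h1 : sqd p s ≤ R := hp
  have h2 : sqd q s ≤ R := hq
  have h3 : R ≤ sqd (a • p + b • q) s := not_lt.1 hz'
  rw [sqd_comb a b hab] at h3
  have e : R = a * R + b * R := by rw [← add_mul, hab, one_mul]
  have h4 : a * b * sqd p q ≤ 0 := by
    nlinarith [mul_le_mul_of_nonneg_left h1 ha, mul_le_mul_of_nonneg_left h2 hb]
  by_cases hpq : p = q
  · subst hpq; left; rw [← add_smul, hab, one_smul]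
  have h5 := sqd_pos hpq
  have h6 : a * b ≤ 0 := by
    by_contra h6
    push Not at h6
    nlinarith [mul_pos h6 h5]
  have h7 : a * b = 0 := le_antisymm h6 (mul_nonneg ha hb)
  rcases mul_eq_zero.1 h7 with rfl | rfl
  · right; have : b = 1 := by linarith
    simp [this]
  · left; have : a = 1 := by linarith
    simp [this]

/-- First entry point into a disc. -/
lemma first_entry {R : ℝ} {s p z : ℝ × ℝ} (hp : p ∉ Od R s) (hz : z ∈ Od R s) :
    ∃ x ∈ segment ℝ p z, x ∈ Bd R s ∧ Disjoint (segment ℝ p x) (Od R s) := by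
  let h : ℝ → ℝ := fun t => sqd (p + t • (z - p)) s
  have hc : Continuous h := (sqd_cont s).comp (by fun_prop)
  have h0 : R ≤ h 0 := by simpa [h] using not_lt.1 hp
  have h1 : h 1 < R := by
    have hz2 : sqd z s < R := hz
    simpa [h] using hz2
  have hcpt : IsCompact {t ∈ Set.Icc (0:ℝ) 1 | h t = R} :=
    isCompact_Icc.inter_right (isClosed_eq hc continuous_const)
  have hne : {t ∈ Set.Icc (0:ℝ) 1 | h t = R}.Nonempty := by
    obtain ⟨t, ht, e⟩ := intermediate_value_Icc' (zero_le_one) hc.continuousOn ⟨h1.le, h0⟩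
    exact ⟨t, ht, e⟩
  obtain ⟨t, ⟨ht, hte⟩, hleast⟩ := hcpt.exists_isLeast hne
  refine ⟨p + t • (z - p), ?_, ?_, ?_⟩
  · rw [segment_eq_image']; exact ⟨t, ht, rfl⟩
  · exact hte.le
  · rw [Set.disjoint_left]
    intro y hy hy'
    rw [segment_eq_image'] at hy
    obtain ⟨u, hu, rfl⟩ := hy
    have e : p + u • (p + t • (z - p) - p) = p + (u * t) • (z - p) := by
      rw [add_sub_cancel_left, smul_smul]
    have hy2 : h (u * t) < R := by
      change sqd (p + u • (p + t • (z - p) - p)) s < R at hy'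
      rw [e] at hy'; exact hy'
    have hut0 : 0 ≤ u * t := mul_nonneg hu.1 ht.1
    have hut : u * t ≤ t := by nlinarith [hu.2, ht.1]
    obtain ⟨t', ht', e'⟩ := intermediate_value_Icc' hut0 hc.continuousOn ⟨hy2.le, h0⟩
    have : t ≤ t' := hleast ⟨⟨ht'.1, ht'.2.trans (hut.trans ht.2)⟩, e'⟩
    have : t' = u * t := le_antisymm ht'.2 (hut.trans this)
    rw [this] at e'
    linarith

/-- Chains of a given length. -/
def Chn (R : ℝ × ℝ → ℝ × ℝ → Prop) (n : ℕ) (p q : ℝ × ℝ) : Prop :=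
  ∃ c : ℕ → ℝ × ℝ, c 0 = p ∧ c n = q ∧ ∀ i < n, R (c i) (c (i + 1))

lemma Chn.trans {R : ℝ × ℝ → ℝ × ℝ → Prop} {m n : ℕ} {p q r : ℝ × ℝ} (h1 : Chn R m p q)
    (h2 : Chn R n q r) : Chn R (m + n) p r := by
  obtain ⟨c, a1, a2, a3⟩ := h1
  obtain ⟨d, b1, b2, b3⟩ := h2
  refine ⟨fun i => if i ≤ m then c i else d (i - m), by simp [a1], ?_, ?_⟩
  · by_cases hn : n = 0
    · subst hn; simp [a2, ← b1, b2]
    · simp [hn, b2]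
  · intro i hi
    rcases lt_trichotomy i m with h | h | h
    · simp only [h.le, if_true, show i + 1 ≤ m from h]
      exact a3 i h
    · subst h
      have := b3 0 (by omega)
      simp only [le_refl, if_true, show ¬ (i + 1 ≤ i) by omega, if_false, a2, ← b1]
      simpa using this
    · simp only [show ¬ (i ≤ m) by omega, show ¬ (i + 1 ≤ m) by omega, if_false]
      have := b3 (i - m) (by omega)
      rwa [show i - m + 1 = i + 1 - m by omega] at this

lemma Chn.one {R : ℝ × ℝ → ℝ × ℝ → Prop} {p q : ℝ × ℝ} (h : R p q) : Chn R 1 p q :=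
  ⟨fun i => if i = 0 then p else q, by simp, by simp, by
    intro i hi
    have : i = 0 := by omega
    subst this; simpa using h⟩

lemma Chn.of_rtg {R : ℝ × ℝ → ℝ × ℝ → Prop} {p q : ℝ × ℝ} (h : Relation.ReflTransGen R p q) :
    ∃ n, Chn R n p q := by
  induction h with
  | refl => exact ⟨0, fun _ => p, rfl, rfl, by simp⟩
  | tail _ h ih =>
    obtain ⟨n, hn⟩ := ih
    exact ⟨n + 1, hn.trans (Chn.one h)⟩

lemma Chn.minimal {R : ℝ × ℝ → ℝ × ℝ → Prop} {p q : ℝ × ℝ} (h : ∃ n, Chn R n p q)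
    (hsub : ∀ p q z, R p q → z ∈ segment ℝ p q → R p z ∧ R z q) :
    ∃ (N : ℕ) (c : ℕ → ℝ × ℝ), c 0 = p ∧ c N = q ∧ (∀ i < N, R (c i) (c (i + 1))) ∧
      (∀ i j, i < j → j ≤ N → R (c i) (c j) → j = i + 1) ∧
      (∀ i j, i + 1 < j → j < N →
        Disjoint (segment ℝ (c i) (c (i + 1))) (segment ℝ (c j) (c (j + 1)))) := by
  classical
  obtain ⟨c, h0, hN, hR⟩ := Nat.find_spec h
  have hmin : ∀ k, Chn R k p q → Nat.find h ≤ k := fun k hk => Nat.find_min' h hk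
  generalize Nat.find h = N at *
  have pre : ∀ i ≤ N, Chn R i p (c i) := fun i hi => ⟨c, h0, rfl, fun k hk => hR k (by omega)⟩
  have suf : ∀ i ≤ N, Chn R (N - i) (c i) q := fun i hi =>
    ⟨fun k => c (i + k), rfl, by simp only [Nat.add_sub_cancel' hi, hN], fun k hk => hR (i + k) (by omega)⟩
  refine ⟨N, c, h0, hN, hR, ?_, ?_⟩
  · intro i j hij hj hr
    have := hmin _ (((pre i (by omega)).trans (Chn.one hr)).trans (suf j hj))
    omega
  · intro i j hij hj
    rw [Set.disjoint_left]
    intro z hz hz'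
    have a := (hsub _ _ z (hR i (by omega)) hz).1
    have b := (hsub _ _ z (hR j (by omega)) hz').2
    have := hmin _ ((((pre i (by omega)).trans (Chn.one a)).trans (Chn.one b)).trans (suf (j + 1) (by omega)))
    omega
end partE

section partF
/-- Segments which may be used in the polygonal approximation of an edge. -/
def Al (R : ℝ) (S γ U : Set (ℝ × ℝ)) (p q : ℝ × ℝ) : Prop :=
  (∃ s ∈ S, s ∈ γ ∧ segment ℝ p q ⊆ Bd R s) ∨
    (segment ℝ p q ⊆ U ∧ ∀ s ∈ S, Disjoint (segment ℝ p q) (Od R s))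

lemma Al.mono {R : ℝ} {S γ U : Set (ℝ × ℝ)} {p q p' q' : ℝ × ℝ} (h : Al R S γ U p q)
    (hs : segment ℝ p' q' ⊆ segment ℝ p q) : Al R S γ U p' q' := by
  rcases h with ⟨s, h1, h2, h3⟩ | ⟨h1, h2⟩
  · exact Or.inl ⟨s, h1, h2, hs.trans h3⟩
  · exact Or.inr ⟨hs.trans h1, fun s hS => (h2 s hS).mono_left hs⟩

lemma seg_sub_left {p q z : ℝ × ℝ} (hz : z ∈ segment ℝ p q) : segment ℝ p z ⊆ segment ℝ p q :=
  (convex_segment p q).segment_subset (left_mem_segment ℝ p q) hz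

lemma seg_sub_right {p q z : ℝ × ℝ} (hz : z ∈ segment ℝ p q) : segment ℝ z q ⊆ segment ℝ p q :=
  (convex_segment p q).segment_subset hz (right_mem_segment ℝ p q)

lemma Al.sub {R : ℝ} {S γ U : Set (ℝ × ℝ)} (p q z : ℝ × ℝ) (h : Al R S γ U p q)
    (hz : z ∈ segment ℝ p q) : Al R S γ U p z ∧ Al R S γ U z q :=
  ⟨h.mono (seg_sub_left hz), h.mono (seg_sub_right hz)⟩

lemma Al.symm' {R : ℝ} {S γ U : Set (ℝ × ℝ)} {p q : ℝ × ℝ} (h : Al R S γ U p q) :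
    Al R S γ U q p := h.mono (by rw [segment_symm])

lemma Al.rtg_symm {R : ℝ} {S γ U : Set (ℝ × ℝ)} {p q : ℝ × ℝ}
    (h : Relation.ReflTransGen (Al R S γ U) p q) : Relation.ReflTransGen (Al R S γ U) q p := by
  induction h with
  | refl => exact .refl
  | tail _ h ih => exact .head h.symm' ih

lemma Al.cut {R : ℝ} {S γ U : Set (ℝ × ℝ)} (hU : ∀ s ∈ S, s ∉ γ → Disjoint U (Bd R s))
    (F : Finset (ℝ × ℝ)) (hF : ∀ s ∈ F, s ∈ S) : ∀ p q, segment ℝ p q ⊆ U →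
    (∀ s ∈ S, s ∉ F → Disjoint (segment ℝ p q) (Od R s)) →
    Relation.ReflTransGen (Al R S γ U) p q := by
  classical
  induction F using Finset.induction_on with
  | empty =>
    intro p q h1 h2
    exact .single (Or.inr ⟨h1, fun s hs => h2 s hs (by simp)⟩)
  | insert s F hsF ih =>
    intro p q h1 h2
    have ih := ih (fun s hs => hF s (Finset.mem_insert_of_mem hs))
    have hsS : s ∈ S := hF s (Finset.mem_insert_self _ _)
    by_cases hd : Disjoint (segment ℝ p q) (Od R s)
    · refine ih p q h1 fun s' hs' hs'' => ?_
      by_cases e : s' = s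
      · subst e; exact hd
      · exact h2 s' hs' (by simp [e, hs''])
    obtain ⟨z, hz, hz'⟩ := Set.not_disjoint_iff.1 hd
    have hzB : z ∈ Bd R s := le_of_lt (show sqd z s < R from hz')
    have hsγ : s ∈ γ := by
      by_contra h
      exact Set.disjoint_left.1 (hU s hsS h) (h1 hz) hzB
    have half : ∀ a, a ∈ segment ℝ p q → Relation.ReflTransGen (Al R S γ U) a z := by
      intro a ha
      by_cases hao : a ∈ Od R s
      · exact .single (Or.inl ⟨s, hsS, hsγ,
          seg_sub_Bd (le_of_lt (show sqd a s < R from hao)) hzB⟩)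
      · obtain ⟨x, hx, hxB, hxd⟩ := first_entry hao hz'
        have sub1 : segment ℝ a z ⊆ segment ℝ p q := (convex_segment p q).segment_subset ha hz
        have sub2 : segment ℝ a x ⊆ segment ℝ p q := (seg_sub_left hx).trans sub1
        refine (ih a x (sub2.trans h1) ?_).tail (Or.inl ⟨s, hsS, hsγ, seg_sub_Bd hxB hzB⟩)
        intro s' hs' hs''
        by_cases e : s' = s
        · subst e; exact hxd
        · exact (h2 s' hs' (by simp [e, hs''])).mono_left sub2
    exact (half p (left_mem_segment ..)).trans (Al.rtg_symm (half q (right_mem_segment ..)))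

theorem Al.connect {R : ℝ} {S γ U : Set (ℝ × ℝ)} (hS : S.Finite)
    (hU : ∀ s ∈ S, s ∉ γ → Disjoint U (Bd R s)) (hUo : IsOpen U) (g : ℝ → ℝ × ℝ)
    (hg : ContinuousOn g (Set.Icc 0 1)) (hgU : g '' Set.Icc 0 1 ⊆ U) :
    Relation.ReflTransGen (Al R S γ U) (g 0) (g 1) := by
  refine (isPreconnected_Icc (a := (0:ℝ)) (b := 1)).induction₂
    (fun t t' => Relation.ReflTransGen (Al R S γ U) (g t) (g t')) ?_ ?_ ?_
    (by simp) (by simp)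
  · intro t ht
    obtain ⟨ε, hε, hb⟩ := Metric.isOpen_iff.1 hUo (g t) (hgU ⟨t, ht, rfl⟩)
    have : ∀ᶠ t' in nhdsWithin t (Set.Icc 0 1), g t' ∈ Metric.ball (g t) ε :=
      (hg t ht) (Metric.ball_mem_nhds _ hε)
    filter_upwards [this] with t' ht'
    refine Al.cut hU hS.toFinset (by simp) _ _ ?_ (by simp +contextual)
    exact ((convex_ball (g t) ε).segment_subset (Metric.mem_ball_self hε) ht').trans hb
  · intro x y z _ _ _ h1 h2; exact h1.trans h2
  · intro x y _ _ h; exact Al.rtg_symm h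

lemma sqd_bound {R r : ℝ} (hr : 0 < r) (hR : R = r ^ 2) {p s : ℝ × ℝ} (h : p ∈ Bd R s) :
    dist p s ≤ r := by
  have h' : (p.1 - s.1) ^ 2 + (p.2 - s.2) ^ 2 ≤ r ^ 2 := hR ▸ h
  rw [Prod.dist_eq, Real.dist_eq, Real.dist_eq]
  refine max_le (abs_le_of_sq_le_sq ?_ hr.le) (abs_le_of_sq_le_sq ?_ hr.le)
  · nlinarith [sq_nonneg (p.2 - s.2)]
  · nlinarith [sq_nonneg (p.1 - s.1)]

theorem chains {E : Type} [Finite E] (g : E → ℝ → ℝ × ℝ)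
    (hg : ∀ e, ContinuousOn (g e) (Set.Icc 0 1)) (S : Set (ℝ × ℝ)) (hS : S.Finite)
    (h0 : ∀ e, g e 0 ∈ S) (h1 : ∀ e, g e 1 ∈ S) (hne : ∀ e, g e 0 ≠ g e 1)
    (hinter : ∀ e f, e ≠ f → g e '' Set.Icc 0 1 ∩ g f '' Set.Icc 0 1 ⊆ S) :
    ∃ (N : E → ℕ) (c : E → ℕ → ℝ × ℝ) (T : E → ℕ → ℝ × ℝ → Prop),
      (∀ e, 0 < N e) ∧ (∀ e, c e 0 = g e 0) ∧ (∀ e, c e (N e) = g e 1) ∧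
      (∀ e i j, i + 1 < j → j < N e →
        Disjoint (segment ℝ (c e i) (c e (i + 1))) (segment ℝ (c e j) (c e (j + 1)))) ∧
      (∀ e f i j, e ≠ f → i < N e → j < N f →
        ¬ Disjoint (segment ℝ (c e i) (c e (i + 1))) (segment ℝ (c f j) (c f (j + 1))) →
        ∃ s ∈ S, s ∈ g e '' Set.Icc 0 1 ∧ s ∈ g f '' Set.Icc 0 1 ∧ T e i s ∧ T f j s) ∧
      (∀ e i j s, i < N e → j < N e → T e i s → T e j s → i = j) ∧
      (∀ e i, i < N e → T e i (g e 0) → i = 0) ∧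
      (∀ e i, i < N e → T e i (g e 1) → i + 1 = N e) := by
  classical
  let γ : E → Set (ℝ × ℝ) := fun e => g e '' Set.Icc 0 1
  have hγ : ∀ e, IsCompact (γ e) := fun e => isCompact_Icc.image_of_continuousOn (hg e)
  have := hS.to_subtype
  -- choice of the radius
  have hr : ∀ᶠ r in nhdsWithin (0:ℝ) (Set.Ioi 0),
      (∀ s s' : S, s ≠ s' → 2 * r < dist (s : ℝ × ℝ) s') ∧
      (∀ (s : S) (e : E), (s : ℝ × ℝ) ∉ γ e → Disjoint (γ e) (Metric.closedBall (s : ℝ × ℝ) r)) ∧ 0 < r := by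
    refine Filter.Eventually.and ?_ (Filter.Eventually.and ?_ self_mem_nhdsWithin)
    · simp only [Filter.eventually_all]
      intro s s' hss
      have hd : 0 < dist (s : ℝ × ℝ) s' := dist_pos.2 (fun h => hss (Subtype.ext h))
      have := Ioo_mem_nhdsGT (half_pos hd)
      filter_upwards [this] with r hr
      linarith [hr.2]
    · simp only [Filter.eventually_all]
      intro s e hse
      obtain ⟨ε, hε, hb⟩ := Metric.isOpen_iff.1 (hγ e).isClosed.isOpen_compl s hse
      filter_upwards [Ioo_mem_nhdsGT hε] with r hr
      rw [Set.disjoint_left]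
      intro x hx hx'
      exact hb (Metric.closedBall_subset_ball hr.2 hx') hx
  obtain ⟨r, hr1, hr2, hr0⟩ := hr.exists
  obtain ⟨R, hR⟩ : ∃ R, R = r ^ 2 := ⟨_, rfl⟩
  have hRpos : 0 < R := by rw [hR]; positivity
  have hBB : ∀ s ∈ S, ∀ s' ∈ S, ∀ z, z ∈ Bd R s → z ∈ Bd R s' → s = s' := by
    intro s hs s' hs' z hz hz'
    by_contra hss
    have := hr1 ⟨s, hs⟩ ⟨s', hs'⟩ (by simpa using hss)
    have a := sqd_bound hr0 hR hz
    have b := sqd_bound hr0 hR hz'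
    have := dist_triangle_left s s' z
    simp only at *
    linarith
  have hBγ : ∀ s ∈ S, ∀ e, s ∉ γ e → Disjoint (γ e) (Bd R s) := by
    intro s hs e hse
    exact (hr2 ⟨s, hs⟩ e hse).mono_right fun z hz => sqd_bound hr0 hR hz
  -- the neighbourhoods
  let O : Set (ℝ × ℝ) := ⋃ s ∈ S, Od R s
  have hO : IsOpen O := isOpen_biUnion fun s _ => Od_open R s
  have hSO : S ⊆ O := fun s hs => Set.mem_biUnion hs (show sqd s s < R by rw [sqd_self]; exact hRpos)
  have hsep : ∀ e f, e ≠ f → SeparatedNhds (γ e \ O) (γ f \ O) := by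
    intro e f hef
    refine SeparatedNhds.of_isCompact_isCompact ((hγ e).diff hO) ((hγ f).diff hO) ?_
    rw [Set.disjoint_left]
    rintro z ⟨hz1, hz2⟩ ⟨hz3, -⟩
    exact hz2 (hSO (hinter e f hef ⟨hz1, hz3⟩))
  have hW : ∀ e f, ∃ W1 W2 : Set (ℝ × ℝ), e ≠ f → IsOpen W1 ∧ IsOpen W2 ∧ γ e \ O ⊆ W1 ∧ γ f \ O ⊆ W2 ∧
      Disjoint W1 W2 := by
    intro e f
    by_cases hef : e = f
    · exact ⟨∅, ∅, fun h => absurd hef h⟩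
    · obtain ⟨W1, W2, h⟩ := hsep e f hef
      exact ⟨W1, W2, fun _ => h⟩
  choose W1 W2 hW using hW
  let U : E → Set (ℝ × ℝ) := fun e =>
    (⋂ f : {f // f ≠ e}, ((W1 e f ∩ W2 f e) ∪ O)) ∩ (⋂ s : {s : S // (s : ℝ × ℝ) ∉ γ e}, (Bd R (s : S))ᶜ)
  have hUo : ∀ e, IsOpen (U e) := by
    intro e
    refine IsOpen.inter (isOpen_iInter_of_finite ?_) (isOpen_iInter_of_finite ?_)
    · rintro ⟨f, hf⟩
      exact ((hW e f hf.symm).1.inter (hW f e hf).2.1).union hO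
    · rintro ⟨s, hs⟩
      exact (Bd_closed R s).isOpen_compl
  have hγU : ∀ e, γ e ⊆ U e := by
    intro e z hz
    refine ⟨Set.mem_iInter.2 ?_, Set.mem_iInter.2 ?_⟩
    · rintro ⟨f, hf⟩
      by_cases hzO : z ∈ O
      · exact Or.inr hzO
      · exact Or.inl ⟨(hW e f hf.symm).2.2.1 ⟨hz, hzO⟩, (hW f e hf).2.2.2.1 ⟨hz, hzO⟩⟩
    · rintro ⟨s, hs⟩ hzB
      exact Set.disjoint_left.1 (hBγ s s.2 e hs) hz hzB
  have hUU : ∀ e f, e ≠ f → ∀ z, z ∈ U e → z ∈ U f → z ∈ O := by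
    intro e f hef z hz hz'
    have a := Set.mem_iInter.1 hz.1 ⟨f, hef.symm⟩
    have b := Set.mem_iInter.1 hz'.1 ⟨e, hef⟩
    rcases a with a | a
    · rcases b with b | b
      · exact absurd b.2 (Set.disjoint_left.1 (hW e f hef).2.2.2.2 a.1)
      · exact b
    · exact a
  have hUB : ∀ e, ∀ s ∈ S, s ∉ γ e → Disjoint (U e) (Bd R s) := by
    intro e s hs hse
    rw [Set.disjoint_left]
    intro z hz hzB
    exact Set.mem_iInter.1 hz.2 ⟨⟨s, hs⟩, hse⟩ hzB
  -- minimal chains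
  have hch := fun e => Chn.minimal (Chn.of_rtg (Al.connect hS (hUB e) (hUo e) (g e) (hg e) (hγU e)))
    (Al.sub (R := R) (S := S) (γ := γ e) (U := U e))
  choose N c hc0 hcN hcA hm1 hm2 using hch
  have hNpos : ∀ e, 0 < N e := by
    intro e
    rcases Nat.eq_zero_or_pos (N e) with h | h
    · exfalso; apply hne e
      rw [← hc0, ← hcN, h]
    · exact h
  let T : E → ℕ → ℝ × ℝ → Prop := fun e i s =>
    s ∈ S ∧ s ∈ γ e ∧ segment ℝ (c e i) (c e (i + 1)) ⊆ Bd R s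
  have hcB : ∀ e i s, T e i s → c e i ∈ Bd R s ∧ c e (i + 1) ∈ Bd R s := fun e i s h =>
    ⟨h.2.2 (left_mem_segment ..), h.2.2 (right_mem_segment ..)⟩
  have hTu : ∀ e i j s, i < j → j < N e → T e i s → T e j s → False := by
    intro e i j s hij hj hi hj'
    have := hm1 e i (j + 1) (by omega) (by omega) (Or.inl ⟨s, hi.1, hi.2.1,
      seg_sub_Bd (hcB e i s hi).1 (hcB e j s hj').2⟩)
    omega
  have hnO : ∀ z, z ∈ O → ∃ s ∈ S, z ∈ Od R s := by
    intro z hz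
    simpa [O] using hz
  have hself : ∀ s, s ∈ Bd R s := fun s => by
    change sqd s s ≤ R
    rw [sqd_self]; exact hRpos.le
  -- an outer segment does not meet an inner segment of another edge
  have hOC : ∀ e f, e ≠ f → ∀ j < N f, ∀ s, T f j s → ∀ z, z ∈ segment ℝ (c f j) (c f (j + 1)) →
      z ∈ U e → z ∉ O → False := by
    intro e f hef j hj s hT z hz hzU hzO
    have hzO' : ∀ s ∈ S, z ∉ Od R s := fun s hs h => hzO (Set.mem_biUnion hs h)
    have hzS : z ∉ S := fun h => hzO (hSO h)
    -- the neighbouring segment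
    have nb : ∀ k < N f, k ≠ j → z ∈ segment ℝ (c f k) (c f (k + 1)) → False := by
      intro k hk hkj hzk
      rcases hcA f k hk with ⟨s', h1, h2, h3⟩ | ⟨h1, h2⟩
      · have : s' = s := hBB s' h1 s hT.1 z (h3 hzk) (hT.2.2 hz)
        subst this
        rcases lt_or_gt_of_ne hkj with h | h
        · exact hTu f k j s' h hj ⟨h1, h2, h3⟩ hT
        · exact hTu f j k s' h hk hT ⟨h1, h2, h3⟩
      · exact hzO (hUU e f hef z hzU (h1 hzk))
    rcases seg_boundary (hcB f j s hT).1 (hcB f j s hT).2 hz (hzO' s hT.1) with h | h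
    · rcases Nat.eq_zero_or_pos j with h' | h'
      · subst h'; rw [hc0] at h; exact hzS (h ▸ h0 f)
      · obtain ⟨k, rfl⟩ : ∃ k, j = k + 1 := ⟨j - 1, by omega⟩
        exact nb k (by omega) (by omega) (h ▸ right_mem_segment ..)
    · rcases Nat.lt_or_ge (j + 1) (N f) with h' | h'
      · exact nb (j + 1) h' (by omega) (h ▸ left_mem_segment ..)
      · have : j + 1 = N f := by omega
        rw [this, hcN] at h
        exact hzS (h ▸ h1 f)
  refine ⟨N, c, T, hNpos, hc0, hcN, hm2, ?_, ?_, ?_, ?_⟩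
  · intro e f i j hef hi hj hnd
    obtain ⟨z, hz1, hz2⟩ := Set.not_disjoint_iff.1 hnd
    rcases hcA e i hi with ⟨s, a1, a2, a3⟩ | ⟨a1, a2⟩
    · rcases hcA f j hj with ⟨s', b1, b2, b3⟩ | ⟨b1, b2⟩
      · have : s = s' := hBB s a1 s' b1 z (a3 hz1) (b3 hz2)
        subst this
        exact ⟨s, a1, a2, b2, ⟨a1, a2, a3⟩, ⟨b1, b2, b3⟩⟩
      · exfalso
        refine hOC f e hef.symm i hi s ⟨a1, a2, a3⟩ z hz1 (b1 hz2) fun h => ?_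
        obtain ⟨t, ht, ht'⟩ := hnO z h
        exact Set.disjoint_left.1 (b2 t ht) hz2 ht'
    · exfalso
      have hzO : z ∉ O := fun h => by
        obtain ⟨t, ht, ht'⟩ := hnO z h
        exact Set.disjoint_left.1 (a2 t ht) hz1 ht'
      rcases hcA f j hj with ⟨s', b1, b2, b3⟩ | ⟨b1, b2⟩
      · exact hOC e f hef j hj s' ⟨b1, b2, b3⟩ z hz2 (a1 hz1) hzO
      · exact hzO (hUU e f hef z (a1 hz1) (b1 hz2))
  · intro e i j s hi hj h1 h2
    rcases lt_trichotomy i j with h | h | h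
    · exact (hTu e i j s h hj h1 h2).elim
    · exact h
    · exact (hTu e j i s h hi h2 h1).elim
  · intro e i hi hT
    have := hm1 e 0 (i + 1) (by omega) (by omega) (Or.inl ⟨_, hT.1, hT.2.1,
      seg_sub_Bd (by rw [hc0]; exact hself _) (hcB e i _ hT).2⟩)
    omega
  · intro e i hi hT
    have := hm1 e i (N e) (by omega) (by omega) (Or.inl ⟨_, hT.1, hT.2.1,
      seg_sub_Bd (hcB e i _ hT).1 (by rw [hcN]; exact hself _)⟩)
    omega
end partF

section partG
lemma Cr.no_common {V E : Type} {G : SimpleGraph V} {src tgt : E → V} {D : Drawing G} (hD : D.IsGood)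
    (e f : E) (h : Cr D src tgt e f) (v : V) (h1 : v = src e ∨ v = tgt e) (h2 : v = src f ∨ v = tgt f) :
    False := by
  obtain ⟨p, hp⟩ := h
  exact hD.adj_no_cross _ _ ⟨v, by simpa using h1, by simpa using h2⟩ p hp

theorem toPL {V E : Type} [Finite V] [Finite E] {G : SimpleGraph V} {src tgt : E → V}
    (hp : Pres G src tgt) (D : Drawing G) (hD : D.IsGood) : Nonempty (PL src tgt (Cr D src tgt)) := by
  classical
  let S : Set (ℝ × ℝ) := Set.range D.pos ∪
    ⋃ q : E × E, {p | D.IsCrossing s(src q.1, tgt q.1) s(src q.2, tgt q.2) p}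
  have hSf : S.Finite := (Set.finite_range _).union
    (Set.finite_iUnion fun q => (hD.cross_once _ _).finite)
  have mem_ep : ∀ e p, p ∈ D.arc (src e) (tgt e) '' Set.Icc 0 1 →
      p ∈ D.edgePoints s(src e, tgt e) := fun e p h => ⟨_, _, rfl, hp.adj e, h⟩
  have hcr : ∀ e f, e ≠ f → ∀ p, p ∈ D.arc (src e) (tgt e) '' Set.Icc 0 1 →
      p ∈ D.arc (src f) (tgt f) '' Set.Icc 0 1 → p ∉ Set.range D.pos →
      D.IsCrossing s(src e, tgt e) s(src f, tgt f) p := by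
    intro e f hef p h1 h2 h3
    refine ⟨hp.adj e, hp.adj f, fun h => hef (hp.inj _ _ h), mem_ep e p h1, mem_ep f p h2, ?_, ?_⟩
    · rintro ⟨a, -, rfl⟩; exact h3 ⟨a, rfl⟩
    · rintro ⟨a, -, rfl⟩; exact h3 ⟨a, rfl⟩
  have hv : ∀ e v, D.pos v ∈ D.arc (src e) (tgt e) '' Set.Icc 0 1 → v = src e ∨ v = tgt e := by
    intro e v h
    by_contra hcon
    push Not at hcon
    exact D.arc_avoid (hp.adj e) v hcon.1 hcon.2 h
  obtain ⟨N, c, T, hN, hc0, hc1, hself, hdiff, hTu, hT0, hT1⟩ := chains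
    (fun e : E => D.arc (src e) (tgt e)) (fun e => D.arc_cont (hp.adj e)) S hSf
    (fun e => by simp only [D.arc_zero (hp.adj e)]; exact Or.inl ⟨_, rfl⟩)
    (fun e => by simp only [D.arc_one (hp.adj e)]; exact Or.inl ⟨_, rfl⟩)
    (fun e => by
      simp only [D.arc_zero (hp.adj e), D.arc_one (hp.adj e)]
      exact fun h => (hp.adj e).ne (D.pos_inj h))
    (fun e f hef p hpp => by
      by_cases h : p ∈ Set.range D.pos
      · exact Or.inl h
      · exact Or.inr (Set.mem_iUnion.2 ⟨(e, f), hcr e f hef p hpp.1 hpp.2 h⟩))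
  simp only [fun e => D.arc_zero (hp.adj e), fun e => D.arc_one (hp.adj e)] at hc0 hc1 hT0 hT1
  let P : V ⊕ E × ℕ → ℝ × ℝ := fun l => Sum.elim D.pos (fun q => c q.1 q.2) l
  have hP : ∀ e i, i ≤ N e → P (lab src tgt N e i) = c e i := by
    intro e i hi
    unfold lab
    split_ifs with h1 h2
    · subst h1; simp [P, hc0]
    · have : i = N e := by omega
      subst this; simp [P, hc1]
    · simp [P]
  -- free intersecting segments meet at a common crossing
  have key : ∀ e f i j, i < N e → j < N f →
    SegFree (lab src tgt N e i) (lab src tgt N e (i + 1))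
      (lab src tgt N f j) (lab src tgt N f (j + 1)) →
    ¬ Disjoint (segment ℝ (P (lab src tgt N e i)) (P (lab src tgt N e (i + 1))))
      (segment ℝ (P (lab src tgt N f j)) (P (lab src tgt N f (j + 1)))) →
      ∃ p, D.IsCrossing s(src e, tgt e) s(src f, tgt f) p ∧ T e i p ∧ T f j p := by
    intro e f i j hi hj hfree hnd
    rw [hP e i hi.le, hP e (i + 1) hi, hP f j hj.le, hP f (j + 1) hj] at hnd
    by_cases hef : e = f
    · subst hef
      exfalso
      rcases lt_trichotomy i j with h | h | h
      · by_cases h' : j = i + 1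
        · subst h'; exact hfree.2.2.1 rfl
        · exact hnd (hself e i j (by omega) hj)
      · subst h; exact hfree.1 rfl
      · by_cases h' : i = j + 1
        · subst h'; exact hfree.2.1 rfl
        · exact hnd (hself e j i (by omega) hi).symm
    · obtain ⟨s, hs, hse, hsf, hTe, hTf⟩ := hdiff e f i j hef hi hj hnd
      refine ⟨s, hcr e f hef s hse hsf ?_, hTe, hTf⟩
      rintro ⟨v, rfl⟩
      have vl : ∀ e i, i < N e → T e i (D.pos v) → D.pos v ∈ D.arc (src e) (tgt e) '' Set.Icc 0 1 →
          lab src tgt N e i = Sum.inl v ∨ lab src tgt N e (i + 1) = Sum.inl v := by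
        intro e i hi hT hm
        rcases hv e v hm with rfl | rfl
        · left; rw [hT0 e i hi hT, lab_zero]
        · right; rw [hT1 e i hi hT, lab_N N e (hN e)]
      rcases vl e i hi hTe hse with h | h <;> rcases vl f j hj hTf hsf with h' | h'
      · exact hfree.1 (h.trans h'.symm)
      · exact hfree.2.1 (h.trans h'.symm)
      · exact hfree.2.2.1 (h.trans h'.symm)
      · exact hfree.2.2.2 (h.trans h'.symm)
  refine ⟨⟨N, hN, P, ?_, ?_⟩⟩
  · intro e f i j hi hj hf hd
    obtain ⟨p, h, -⟩ := key e f i j hi hj hf hd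
    exact ⟨p, h⟩
  · intro e f i j i' j' hi hj hi' hj' hf hf' hd hd'
    obtain ⟨p, h, a, b⟩ := key e f i j hi hj hf hd
    obtain ⟨p', h', a', b'⟩ := key e f i' j' hi' hj' hf' hd'
    have := hD.cross_once _ _ h h'
    subst this
    exact ⟨hTu e i i' p hi hi' a a', hTu f j j' p hj hj' b b'⟩
end partG

section partH
open Filter Topology

lemma sep_lin (σ : ℝ) (v x : ℝ × ℝ) {p q r s : ℝ × ℝ}
    (hp : σ * crs v (p - x) ≤ 0) (hq : σ * crs v (q - x) ≤ 0)
    (hr : 0 < σ * crs v (r - x)) (hs : 0 < σ * crs v (s - x)) :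
    Disjoint (segment ℝ p q) (segment ℝ r s) := by
  simp only [crs, Prod.fst_sub, Prod.snd_sub] at *
  refine seg_disj_of_lin (-(σ * v.2)) (σ * v.1) (-(σ * v.2) * x.1 + σ * v.1 * x.2) ?_ ?_ ?_ ?_ <;>
    linarith

lemma sep_weak (σ : ℝ) (v x : ℝ × ℝ) {p q r s : ℝ × ℝ}
    (hp : crs v (p - x) = 0) (hq : σ * crs v (q - x) < 0)
    (hr : crs v (r - x) = 0) (hs : 0 < σ * crs v (s - x)) (hne : p ≠ r) :
    Disjoint (segment ℝ p q) (segment ℝ r s) := by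
  simp only [crs, Prod.fst_sub, Prod.snd_sub] at *
  refine seg_disj_of_weak (-(σ * v.2)) (σ * v.1) (-(σ * v.2) * x.1 + σ * v.1 * x.2) ?_ ?_ ?_ ?_ hne
  · linear_combination σ * hp
  · linarith
  · linear_combination σ * hr
  · linarith

lemma crs_cont (v : ℝ × ℝ) : Continuous (crs v) := by unfold crs; fun_prop

lemma crs_add (v p q : ℝ × ℝ) : crs v (p + q) = crs v p + crs v q := by simp [crs]; ring
lemma crs_sub (v p q : ℝ × ℝ) : crs v (p - q) = crs v p - crs v q := by simp [crs]; ring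
lemma crs_smul (v : ℝ × ℝ) (t : ℝ) (p : ℝ × ℝ) : crs v (t • p) = t * crs v p := by simp [crs]; ring
lemma crs_self (v : ℝ × ℝ) : crs v v = 0 := by simp [crs]; ring
lemma crs_swap (v w : ℝ × ℝ) : crs v w = - crs w v := by simp [crs]; ring
lemma crs_zero (v : ℝ × ℝ) : crs v 0 = 0 := by simp [crs]
lemma crs_neg (v w : ℝ × ℝ) : crs v (-w) = - crs v w := by simp [crs]; ring

lemma ev_pos {l : Filter ℝ} (σ : ℝ) (v x : ℝ × ℝ) {p : ℝ → ℝ × ℝ} {p0 : ℝ × ℝ} (hp : Tendsto p l (𝓝 p0))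
    (h : 0 < σ * crs v (p0 - x)) : ∀ᶠ t in l, 0 < σ * crs v (p t - x) := by
  have hc : Continuous (fun p : ℝ × ℝ => σ * crs v (p - x)) :=
    continuous_const.mul ((crs_cont v).comp (by fun_prop))
  exact ((hc.tendsto p0).comp hp).eventually_const_lt h

lemma ev_neg {l : Filter ℝ} (σ : ℝ) (v x : ℝ × ℝ) {p : ℝ → ℝ × ℝ} {p0 : ℝ × ℝ} (hp : Tendsto p l (𝓝 p0))
    (h : σ * crs v (p0 - x) < 0) : ∀ᶠ t in l, σ * crs v (p t - x) < 0 := by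
  have hc : Continuous (fun p : ℝ × ℝ => σ * crs v (p - x)) :=
    continuous_const.mul ((crs_cont v).comp (by fun_prop))
  exact ((hc.tendsto p0).comp hp).eventually_lt_const h

lemma tend_pt (c w : ℝ × ℝ) (k : ℝ) : Tendsto (fun t : ℝ => c + (k * t) • w) (𝓝[>] 0) (𝓝 c) := by
  have : Continuous (fun t : ℝ => c + (k * t) • w) := by fun_prop
  have := this.tendsto 0
  simp only [mul_zero, zero_smul, add_zero] at this
  exact this.mono_left nhdsWithin_le_nhds

lemma pos_ev : ∀ᶠ t in 𝓝[>] (0:ℝ), 0 < t := self_mem_nhdsWithin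

/-- The chains `y₁ a` and `y₂ a` run on different sides of the chain `x a`. -/
lemma sides_same {c : ℕ → ℝ × ℝ} {W : ℕ → ℝ × ℝ} {σ : ℝ} {k : ℕ}
    (h1 : 0 < σ * crs (c (k + 1) - c k) (W k)) (h2 : 0 < σ * crs (c (k + 1) - c k) (W (k + 1))) :
    ∀ᶠ t in 𝓝[>] (0:ℝ), Disjoint (segment ℝ (c k + t • W k) (c (k + 1) + t • W (k + 1)))
      (segment ℝ (c k + (-t) • W k) (c (k + 1) + (-t) • W (k + 1))) := by
  filter_upwards [pos_ev] with t ht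
  refine (sep_lin σ (c (k + 1) - c k) (c k) ?_ ?_ ?_ ?_).symm
  · rw [add_sub_cancel_left, crs_smul]; nlinarith
  · rw [add_sub_right_comm, crs_add, crs_self, crs_smul]; nlinarith
  · rw [add_sub_cancel_left, crs_smul]; nlinarith [mul_pos ht h1]
  · rw [add_sub_right_comm, crs_add, crs_self, crs_smul]; nlinarith [mul_pos ht h2]

lemma sides_next {c : ℕ → ℝ × ℝ} {W : ℕ → ℝ × ℝ} {σ : ℝ} {k : ℕ}
    (hκ : crs (c (k + 1) - c k) (c (k + 2) - c (k + 1)) ≠ 0) (hσ : σ ≠ 0)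
    (h1 : 0 < σ * crs (c (k + 1) - c k) (W k)) (h2 : 0 < σ * crs (c (k + 1) - c k) (W (k + 1)))
    (h3 : 0 < σ * crs (c (k + 2) - c (k + 1)) (W (k + 1)))
    (h4 : 0 ≤ σ * crs (c (k + 2) - c (k + 1)) (W (k + 2))) :
    ∀ᶠ t in 𝓝[>] (0:ℝ), Disjoint (segment ℝ (c k + t • W k) (c (k + 1) + t • W (k + 1)))
      (segment ℝ (c (k + 1) + (-t) • W (k + 1)) (c (k + 2) + (-t) • W (k + 2))) := by
  have t1 := tend_pt (c k) (W k) 1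
  have t2 := tend_pt (c (k + 2)) (W (k + 2)) (-1)
  simp only [one_mul, neg_mul] at t1 t2
  rcases lt_or_gt_of_ne (mul_ne_zero hσ hκ) with h | h
  · have e2 := ev_neg σ (c (k + 1) - c k) (c (k + 1)) t2 h
    filter_upwards [pos_ev, e2] with t ht e2
    refine (sep_lin σ (c (k + 1) - c k) (c (k + 1)) ?_ e2.le ?_ ?_).symm
    · rw [add_sub_cancel_left, crs_smul]; nlinarith
    · have : c k + t • W k - c (k + 1) = t • W k - (c (k + 1) - c k) := by abel
      rw [this, crs_sub, crs_self, crs_smul]; nlinarith [mul_pos ht h1]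
    · rw [add_sub_cancel_left, crs_smul]; nlinarith [mul_pos ht h2]
  · have e1 := ev_pos σ (c (k + 2) - c (k + 1)) (c (k + 1)) t1 (by
      rw [show c k - c (k + 1) = -(c (k + 1) - c k) by abel, crs_neg, crs_swap, neg_neg]; exact h)
    filter_upwards [pos_ev, e1] with t ht e1
    refine (sep_lin σ (c (k + 2) - c (k + 1)) (c (k + 1)) ?_ ?_ e1 ?_).symm
    · rw [add_sub_cancel_left, crs_smul]; nlinarith
    · rw [add_sub_right_comm, crs_add, crs_self, crs_smul]; nlinarith
    · rw [add_sub_cancel_left, crs_smul]; nlinarith [mul_pos ht h3]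

lemma sides {c : ℕ → ℝ × ℝ} {W : ℕ → ℝ × ℝ} {σ : ℝ} {N : ℕ} (hσ : σ ≠ 0)
    (hκ : ∀ k, k + 1 < N → crs (c (k + 1) - c k) (c (k + 2) - c (k + 1)) ≠ 0)
    (h1 : ∀ k < N, 0 < σ * crs (c (k + 1) - c k) (W k))
    (h2 : ∀ k, k + 1 < N → 0 < σ * crs (c (k + 1) - c k) (W (k + 1))) (h3 : W N = 0)
    {k l : ℕ} (hk : k < N) (hl : l < N) (hkl : k ≤ l + 1) (hlk : l ≤ k + 1)
    (hlast : ¬ (k + 1 = N ∧ l + 1 = N)) :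
    ∀ᶠ t in 𝓝[>] (0:ℝ), Disjoint (segment ℝ (c k + t • W k) (c (k + 1) + t • W (k + 1)))
      (segment ℝ (c l + (-t) • W l) (c (l + 1) + (-t) • W (l + 1))) := by
  have h4 : ∀ k, k < N → 0 ≤ σ * crs (c (k + 1) - c k) (W (k + 1)) := by
    intro k hk
    rcases Nat.lt_or_ge (k + 1) N with h | h
    · exact (h2 k h).le
    · have : k + 1 = N := by omega
      rw [this, h3, crs_zero, mul_zero]
  obtain rfl | rfl | rfl : l = k ∨ l = k + 1 ∨ k = l + 1 := by omega
  · exact sides_same (h1 _ hk) (h2 _ (by omega))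
  · exact sides_next (hκ _ hl) hσ (h1 _ hk) (h2 _ hl) (h1 _ hl) (h4 _ hl)
  · have := sides_next (c := c) (W := fun k => - W k) (σ := -σ) (hκ l hk) (by simpa using hσ)
      (by simpa [crs_neg] using h1 l hl) (by simpa [crs_neg] using h2 l hk)
      (by simpa [crs_neg] using h1 (l + 1) hk) (by simpa [crs_neg] using h4 (l + 1) hk)
    filter_upwards [this] with t ht
    simpa using ht.symm

/-- A segment from a point near `x` against a segment from `x`. -/
lemma near_xb {x u da db : ℝ × ℝ} {p : ℝ → ℝ × ℝ} (hp : Tendsto p (𝓝[>] 0) (𝓝 (x + da)))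
    (ha : crs u da ≠ 0) (hb : crs u db ≠ 0) (hab : crs db da ≠ 0)
    (hn : ¬ (0 < crs u da * crs u db ∧ 0 < crs u da * crs db da)) :
    ∀ᶠ t in 𝓝[>] (0:ℝ), Disjoint (segment ℝ (x + t • u) (p t)) (segment ℝ x (x + db)) := by
  have hu : u ≠ 0 := by rintro rfl; simp [crs] at ha
  rcases lt_or_gt_of_ne (mul_ne_zero ha hb) with h | h
  · have e := ev_neg (crs u db) u x hp (by rw [add_sub_cancel_left]; linarith)
    filter_upwards [pos_ev, e] with t ht e
    refine sep_weak (crs u db) u x ?_ e ?_ ?_ ?_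
    · rw [add_sub_cancel_left, crs_smul, crs_self, mul_zero]
    · rw [sub_self, crs_zero]
    · rw [add_sub_cancel_left]; exact mul_self_pos.2 hb
    · simp [hu, ht.ne']
  · have h' : crs u da * crs db da < 0 := by
      rcases lt_or_gt_of_ne (mul_ne_zero ha hab) with h' | h'
      · exact h'
      · exact absurd ⟨h, h'⟩ hn
    have e := ev_pos (-crs u da) db x hp (by rw [add_sub_cancel_left]; linarith)
    filter_upwards [pos_ev, e] with t ht e
    refine (sep_lin (-crs u da) db x ?_ ?_ ?_ e).symm
    · rw [sub_self, crs_zero, mul_zero]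
    · rw [add_sub_cancel_left, crs_self, mul_zero]
    · rw [add_sub_cancel_left, crs_smul, crs_swap db u]; nlinarith [mul_pos ht h]

/-- Segments starting at the two points near `x`. -/
lemma near_yy {x u da db : ℝ × ℝ} {p q : ℝ → ℝ × ℝ} (hp : Tendsto p (𝓝[>] 0) (𝓝 (x + da)))
    (hq : Tendsto q (𝓝[>] 0) (𝓝 (x + db)))
    (ha : crs u da ≠ 0) (hb : crs u db ≠ 0) (hab : crs db da ≠ 0)
    (hn : ¬ (0 < crs u da * crs u db ∧ 0 < crs u da * crs db da)) :
    ∀ᶠ t in 𝓝[>] (0:ℝ), Disjoint (segment ℝ (x + t • u) (p t)) (segment ℝ (x + (-t) • u) (q t)) := by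
  have hu : u ≠ 0 := by rintro rfl; simp [crs] at ha
  rcases lt_or_gt_of_ne (mul_ne_zero ha hb) with h | h
  · have e := ev_neg (crs u db) u x hp (by rw [add_sub_cancel_left]; linarith)
    have e' := ev_pos (crs u db) u x hq (by rw [add_sub_cancel_left]; exact mul_self_pos.2 hb)
    filter_upwards [pos_ev, e, e'] with t ht e e'
    refine sep_weak (crs u db) u x ?_ e ?_ e' ?_
    · rw [add_sub_cancel_left, crs_smul, crs_self, mul_zero]
    · rw [add_sub_cancel_left, crs_smul, crs_self, mul_zero]
    · intro h
      have h2 := add_left_cancel h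
      have := smul_left_injective ℝ hu h2
      linarith
  · have h' : crs u da * crs db da < 0 := by
      rcases lt_or_gt_of_ne (mul_ne_zero ha hab) with h' | h'
      · exact h'
      · exact absurd ⟨h, h'⟩ hn
    have k1 : crs (da + db) da = crs db da := by simp [crs]; ring
    have k2 : crs (da + db) db = - crs db da := by simp [crs]; ring
    have k3 : crs (da + db) u = - (crs u da + crs u db) := by simp [crs]; ring
    have e := ev_neg (crs u da) (da + db) x hp (by rw [add_sub_cancel_left, k1]; exact h')
    have e' := ev_pos (crs u da) (da + db) x hq (by rw [add_sub_cancel_left, k2]; linarith)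
    have sq := mul_self_pos.2 ha
    filter_upwards [pos_ev, e, e'] with t ht e e'
    refine sep_lin (crs u da) (da + db) x ?_ e.le ?_ e'
    · rw [add_sub_cancel_left, crs_smul, k3]; nlinarith [mul_pos ht sq, mul_pos ht h]
    · rw [add_sub_cancel_left, crs_smul, k3]; nlinarith [mul_pos ht sq, mul_pos ht h]

lemma near_xy {x u z : ℝ × ℝ} {t s : ℝ} (ht : 0 < t * s) (hz : crs u (z - x) ≠ 0) :
    Disjoint (segment ℝ x (x + t • u)) (segment ℝ (x + (-s) • u) z) := by
  have hu : u ≠ 0 := by rintro rfl; simp [crs] at hz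
  rw [segment_eq_image', segment_eq_image', Set.disjoint_left]
  rintro _ ⟨τ, hτ, rfl⟩ ⟨μ, hμ, h⟩
  simp only at h
  have h1 := congrArg (fun p => crs u (p - x)) h
  have e1 : x + (-s) • u + μ • (z - (x + (-s) • u)) - x = (-s + μ * s) • u + μ • (z - x) := by
    module
  have e2 : x + τ • (x + t • u - x) - x = (τ * t) • u := by module
  simp only [e1, e2, crs_add, crs_smul, crs_self, mul_zero, zero_add] at h1
  have hμ0 : μ = 0 := by simpa [hz] using h1
  subst hμ0
  have h2 : (-s) • u = (τ * t) • u := by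
    have : x + (-s) • u - x = x + τ • (x + t • u - x) - x := by rw [← h]; simp
    rw [e2] at this; simpa using this
  have := smul_left_injective ℝ hu h2
  have h0 : s ≠ 0 := by rintro rfl; simp at ht
  have h3 : -s * s = τ * (t * s) := by rw [show -s = τ * t from this]; ring
  nlinarith [mul_self_pos.2 h0, mul_nonneg hτ.1 ht.le]
end partH

section partI
/-- Restriction of a polygonal drawing to a subgraph. -/
def PL.comap {V E V0 E0 : Type} {src tgt : E → V} {C : E → E → Prop} {src0 tgt0 : E0 → V0}
    (S : PL src tgt C) (φ : V0 → V) (ι : E0 → E) (hι : Function.Injective ι)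
    (hφ : Function.Injective φ)
    (h1 : ∀ e, src (ι e) = φ (src0 e)) (h2 : ∀ e, tgt (ι e) = φ (tgt0 e)) :
    PL src0 tgt0 (fun e f => C (ι e) (ι f)) := by
  have hl : ∀ e i, Sum.map φ (Prod.map ι id) (lab src0 tgt0 (fun e => S.N (ι e)) e i) =
      lab src tgt S.N (ι e) i := by
    intro e i
    unfold lab
    split_ifs <;> simp [h1, h2]
  have hinj : Function.Injective (Sum.map φ (Prod.map ι (id : ℕ → ℕ))) :=
    Sum.map_injective.2 ⟨hφ, hι.prodMap Function.injective_id⟩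
  have hf : ∀ e f i j, SegFree (lab src0 tgt0 (fun e => S.N (ι e)) e i)
      (lab src0 tgt0 (fun e => S.N (ι e)) e (i + 1)) (lab src0 tgt0 (fun e => S.N (ι e)) f j)
      (lab src0 tgt0 (fun e => S.N (ι e)) f (j + 1)) →
      SegFree (lab src tgt S.N (ι e) i) (lab src tgt S.N (ι e) (i + 1))
      (lab src tgt S.N (ι f) j) (lab src tgt S.N (ι f) (j + 1)) := by
    rintro e f i j ⟨a, b, c, d⟩
    simp only [← hl]
    exact ⟨hinj.ne a, hinj.ne b, hinj.ne c, hinj.ne d⟩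
  exact
  { N := fun e => S.N (ι e)
    hN := fun e => S.hN (ι e)
    P := fun l => S.P (Sum.map φ (Prod.map ι id) l)
    cross_imp := by
      intro e f i j hi hj h
      simp only [hl]
      exact S.cross_imp (ι e) (ι f) i j hi hj (hf _ _ _ _ h)
    uniq := by
      intro e f i j i' j' hi hj hi' hj' h h'
      simp only [hl]
      exact S.uniq (ι e) (ι f) i j i' j' hi hj hi' hj' (hf _ _ _ _ h) (hf _ _ _ _ h') }

lemma Zbound_fin (hZC : ∀ a b : ℕ, 0 < a → 0 < b → crossingNumber (bipK a b) = Z a b)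
    {V E : Type} {src tgt : E → V} {C : E → E → Prop} (S : PL src tgt C)
    (hC : ∀ e f, C e f → ∀ v, (v = src e ∨ v = tgt e) → (v = src f ∨ v = tgt f) → False)
    {a b : ℕ} (ha : 0 < a) (hb : 0 < b) (φ : Fin a ⊕ Fin b → V) (hφ : Function.Injective φ)
    (ι : Fin a × Fin b → E)
    (h : ∀ p, (src (ι p) = φ (Sum.inl p.1) ∧ tgt (ι p) = φ (Sum.inr p.2)) ∨
      (src (ι p) = φ (Sum.inr p.2) ∧ tgt (ι p) = φ (Sum.inl p.1))) :
    2 * Z a b ≤ ∑ e, ∑ f, ind (C (ι e) (ι f)) := by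
  classical
  let src0 : Fin a × Fin b → Fin a ⊕ Fin b := fun p =>
    if src (ι p) = φ (Sum.inl p.1) then Sum.inl p.1 else Sum.inr p.2
  let tgt0 : Fin a × Fin b → Fin a ⊕ Fin b := fun p =>
    if src (ι p) = φ (Sum.inl p.1) then Sum.inr p.2 else Sum.inl p.1
  have h1 : ∀ e, src (ι e) = φ (src0 e) := by
    intro e
    simp only [src0]
    split_ifs with h0
    · exact h0
    · rcases h e with h | h
      · exact absurd h.1 h0
      · exact h.1
  have h2 : ∀ e, tgt (ι e) = φ (tgt0 e) := by
    intro e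
    simp only [tgt0]
    split_ifs with h0
    · rcases h e with h | h
      · exact h.2
      · have := hφ (h0.symm.trans h.1); simp at this
    · rcases h e with h | h
      · exact absurd h.1 h0
      · exact h.2
  have hs : ∀ e, s(src0 e, tgt0 e) = s(Sum.inl e.1, Sum.inr e.2) := by
    intro e
    simp only [src0, tgt0]
    split_ifs
    · rfl
    · exact Sym2.eq_swap
  have hι : Function.Injective ι := by
    intro e f hef
    have : s(φ (src0 e), φ (tgt0 e)) = s(φ (src0 f), φ (tgt0 f)) := by
      rw [← h1, ← h1, ← h2, ← h2, hef]
    have : Sym2.map φ s(src0 e, tgt0 e) = Sym2.map φ s(src0 f, tgt0 f) := this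
    have := Sym2.map.injective hφ this
    rw [hs, hs] at this
    obtain ⟨e1, e2⟩ := e
    obtain ⟨f1, f2⟩ := f
    simpa using this
  have hp : Pres (bipK a b) src0 tgt0 := by
    refine ⟨?_, ?_, ?_⟩
    · intro e
      rw [← SimpleGraph.mem_edgeSet, hs]
      simp
    · rintro (u | u) (v | v) huv
      · simp at huv
      · exact ⟨(u, v), hs _⟩
      · exact ⟨(v, u), (hs _).trans Sym2.eq_swap⟩
      · simp at huv
    · intro e f hef
      rw [hs, hs] at hef
      obtain ⟨e1, e2⟩ := e
      obtain ⟨f1, f2⟩ := f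
      simpa using hef
  obtain ⟨D, hD, hle⟩ := PL.toDrawing hp (S.comap φ ι hι hφ h1 h2) (by
    intro e f hc v hv hv'
    refine hC _ _ hc (φ v) ?_ ?_
    · rw [h1, h2]; exact hv.imp (congrArg φ) (congrArg φ)
    · rw [h1, h2]; exact hv'.imp (congrArg φ) (congrArg φ))
  refine le_trans ?_ hle
  rw [← hZC a b ha hb]
  have : crossingNumber (bipK a b) ≤ D.crNum := Nat.sInf_le ⟨D, hD, rfl⟩
  omega

lemma Zbound (hZC : ∀ a b : ℕ, 0 < a → 0 < b → crossingNumber (bipK a b) = Z a b)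
    {V E : Type} {src tgt : E → V} {C : E → E → Prop} (S : PL src tgt C)
    (hC : ∀ e f, C e f → ∀ v, (v = src e ∨ v = tgt e) → (v = src f ∨ v = tgt f) → False)
    {A B : Type} [Fintype A] [Fintype B] [Nonempty A] [Nonempty B]
    (φ : A ⊕ B → V) (hφ : Function.Injective φ) (ι : A × B → E)
    (h : ∀ p, (src (ι p) = φ (Sum.inl p.1) ∧ tgt (ι p) = φ (Sum.inr p.2)) ∨
      (src (ι p) = φ (Sum.inr p.2) ∧ tgt (ι p) = φ (Sum.inl p.1))) :
    2 * Z (Fintype.card A) (Fintype.card B) ≤ ∑ e, ∑ f, ind (C (ι e) (ι f)) := by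
  classical
  let eA := Fintype.equivFin A
  let eB := Fintype.equivFin B
  have := Zbound_fin hZC S hC (a := Fintype.card A) (b := Fintype.card B) Fintype.card_pos
    Fintype.card_pos (φ ∘ (Equiv.sumCongr eA eB).symm) (hφ.comp (Equiv.injective _))
    (ι ∘ (Equiv.prodCongr eA eB).symm) (by rintro ⟨i, j⟩; exact h (eA.symm i, eB.symm j))
  refine this.trans (le_of_eq ?_)
  refine Fintype.sum_equiv (Equiv.prodCongr eA eB).symm _ _ (fun e => ?_)
  exact Fintype.sum_equiv (Equiv.prodCongr eA eB).symm _ _ (fun f => rfl)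
end partI

section partJ
open Filter Topology

section doubling

/-- Vertices of `K_{1,A,B}`. -/
inductive V3 (A B : Type) : Type
  | x : V3 A B
  | a : A → V3 A B
  | b : B → V3 A B

/-- Edges of `K_{1,A,B}`. -/
inductive E3 (A B : Type) : Type
  | ab : A → B → E3 A B
  | xa : A → E3 A B
  | xb : B → E3 A B

/-- Vertices of the doubled graph. -/
inductive V4 (A B : Type) : Type
  | x : V4 A B
  | a : A → V4 A B
  | b : B → V4 A B
  | y : Bool → V4 A B

/-- Edges of the doubled graph. -/
inductive E4 (A B : Type) : Type
  | ab : A → B → E4 A B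
  | xb : B → E4 A B
  | ya : Bool → A → E4 A B
  | xy : Bool → E4 A B

variable {A B : Type}

instance [Finite A] [Finite B] : Finite (V3 A B) :=
  Finite.of_surjective (fun p : Unit ⊕ A ⊕ B => match p with
    | Sum.inl _ => V3.x
    | Sum.inr (Sum.inl i) => V3.a i
    | Sum.inr (Sum.inr j) => V3.b j) (by
      rintro (_ | i | j)
      · exact ⟨Sum.inl (), rfl⟩
      · exact ⟨Sum.inr (Sum.inl i), rfl⟩
      · exact ⟨Sum.inr (Sum.inr j), rfl⟩)

instance [Finite A] [Finite B] : Finite (E3 A B) :=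
  Finite.of_surjective (fun p : (A × B) ⊕ A ⊕ B => match p with
    | Sum.inl p => E3.ab p.1 p.2
    | Sum.inr (Sum.inl i) => E3.xa i
    | Sum.inr (Sum.inr j) => E3.xb j) (by
      rintro (⟨i, j⟩ | i | j)
      · exact ⟨Sum.inl (i, j), rfl⟩
      · exact ⟨Sum.inr (Sum.inl i), rfl⟩
      · exact ⟨Sum.inr (Sum.inr j), rfl⟩)

instance [Finite A] [Finite B] : Finite (E4 A B) :=
  Finite.of_surjective (fun p : (A × B) ⊕ B ⊕ (Bool × A) ⊕ Bool => match p with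
    | Sum.inl p => E4.ab p.1 p.2
    | Sum.inr (Sum.inl j) => E4.xb j
    | Sum.inr (Sum.inr (Sum.inl q)) => E4.ya q.1 q.2
    | Sum.inr (Sum.inr (Sum.inr s)) => E4.xy s) (by
      rintro (⟨i, j⟩ | j | ⟨s, i⟩ | s)
      · exact ⟨Sum.inl (i, j), rfl⟩
      · exact ⟨Sum.inr (Sum.inl j), rfl⟩
      · exact ⟨Sum.inr (Sum.inr (Sum.inl (s, i))), rfl⟩
      · exact ⟨Sum.inr (Sum.inr (Sum.inr s)), rfl⟩)

/-- Sources. -/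
def src3 : E3 A B → V3 A B
  | .ab i _ => .a i
  | .xa _ => .x
  | .xb _ => .x

/-- Targets. -/
def tgt3 : E3 A B → V3 A B
  | .ab _ j => .b j
  | .xa i => .a i
  | .xb j => .b j

/-- Sources. -/
def src4 : E4 A B → V4 A B
  | .ab i _ => .a i
  | .xb _ => .x
  | .ya s _ => .y s
  | .xy _ => .x

/-- Targets. -/
def tgt4 : E4 A B → V4 A B
  | .ab _ j => .b j
  | .xb j => .b j
  | .ya _ i => .a i
  | .xy s => .y s

/-- The underlying original edge. -/
def pr : E4 A B → Option (E3 A B)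
  | .ab i j => some (.ab i j)
  | .xb j => some (.xb j)
  | .ya _ i => some (.xa i)
  | .xy _ => none

/-- Sign. -/
noncomputable def sg (s : Bool) : ℝ := if s then 1 else -1

lemma sg_ne (s : Bool) : sg s ≠ 0 := by cases s <;> simp [sg]
lemma sg_sq (s : Bool) : sg s * sg s = 1 := by cases s <;> simp [sg]
lemma sg_not (s : Bool) : sg (!s) = - sg s := by cases s <;> simp [sg]

variable {C : E3 A B → E3 A B → Prop} (S : PL (src3 (A := A) (B := B)) tgt3 C) (u : ℝ × ℝ)

/-- Position of `x`. -/
noncomputable def PL.X : ℝ × ℝ := S.P (Sum.inl V3.x)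

/-- Chains. -/
noncomputable def PL.c3 (e : E3 A B) (k : ℕ) : ℝ × ℝ := S.P (lab src3 tgt3 S.N e k)

/-- Initial direction of the edge from `x`. -/
noncomputable def PL.d : A ⊕ B → ℝ × ℝ
  | Sum.inl i => S.c3 (.xa i) 1 - S.X
  | Sum.inr j => S.c3 (.xb j) 1 - S.X

/-- Displacement. -/
noncomputable def PL.W (i : A) (k : ℕ) : ℝ × ℝ :=
  if k = 0 then u else if S.N (.xa i) ≤ k then 0 else
    (crs (S.c3 (.xa i) 1 - S.c3 (.xa i) 0) u *
      crs (S.c3 (.xa i) k - S.c3 (.xa i) (k - 1)) (S.c3 (.xa i) (k + 1) - S.c3 (.xa i) k)) •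
    ((S.c3 (.xa i) (k + 1) - S.c3 (.xa i) k) - (S.c3 (.xa i) k - S.c3 (.xa i) (k - 1)))

/-- Number of segments. -/
def PL.N4 : E4 A B → ℕ
  | .ab i j => S.N (.ab i j)
  | .xb j => S.N (.xb j)
  | .ya _ i => S.N (.xa i)
  | .xy _ => 1

/-- Positions. -/
noncomputable def PL.P4 (t : ℝ) : V4 A B ⊕ E4 A B × ℕ → ℝ × ℝ
  | Sum.inl .x => S.X
  | Sum.inl (.a i) => S.P (Sum.inl (.a i))
  | Sum.inl (.b j) => S.P (Sum.inl (.b j))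
  | Sum.inl (.y s) => S.X + (sg s * t) • u
  | Sum.inr (.ab i j, k) => S.P (Sum.inr (.ab i j, k))
  | Sum.inr (.xb j, k) => S.P (Sum.inr (.xb j, k))
  | Sum.inr (.ya s i, k) => S.P (Sum.inr (.xa i, k)) + (sg s * t) • S.W u i k
  | Sum.inr (.xy _, _) => S.X

/-- Chains. -/
noncomputable def PL.c4 (t : ℝ) (e : E4 A B) (k : ℕ) : ℝ × ℝ := S.P4 u t (lab src4 tgt4 S.N4 e k)

lemma PL.c4_tendsto (e : E4 A B) (k : ℕ) :
    Tendsto (fun t => S.c4 u t e k) (𝓝[>] 0) (𝓝 (S.c4 u 0 e k)) := by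
  unfold PL.c4
  generalize lab src4 tgt4 S.N4 e k = l
  have : Continuous (fun t => S.P4 u t l) := by
    rcases l with (_ | _ | _ | _) | ⟨_ | _ | _ | _, _⟩ <;> simp only [PL.P4] <;> fun_prop
  exact (this.tendsto 0).mono_left nhdsWithin_le_nhds

lemma PL.c4_ab (t : ℝ) (i : A) (j : B) (k : ℕ) : S.c4 u t (.ab i j) k = S.c3 (.ab i j) k := by
  by_cases h1 : k = 0 <;> by_cases h2 : S.N (.ab i j) ≤ k <;>
    simp [PL.c4, PL.c3, lab, PL.N4, src4, tgt4, src3, tgt3, PL.P4, h1, h2]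

lemma PL.c4_xb (t : ℝ) (j : B) (k : ℕ) : S.c4 u t (.xb j) k = S.c3 (.xb j) k := by
  by_cases h1 : k = 0 <;> by_cases h2 : S.N (.xb j) ≤ k <;>
    simp [PL.c4, PL.c3, lab, PL.N4, src4, tgt4, src3, tgt3, PL.P4, PL.X, h1, h2]

lemma PL.c4_ya (t : ℝ) (s : Bool) (i : A) (k : ℕ) :
    S.c4 u t (.ya s i) k = S.c3 (.xa i) k + (sg s * t) • S.W u i k := by
  by_cases h1 : k = 0
  · simp [PL.c4, PL.c3, lab, src4, src3, PL.P4, PL.X, PL.W, h1]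
  by_cases h2 : S.N (.xa i) ≤ k
  · simp [PL.c4, PL.c3, lab, PL.N4, tgt4, tgt3, PL.P4, PL.W, h1, h2]
  · have e1 : lab src4 tgt4 S.N4 (.ya s i) k = Sum.inr (.ya s i, k) := by
      simp [lab, PL.N4, h1, h2]
    have e2 : lab src3 tgt3 S.N (.xa i) k = Sum.inr (.xa i, k) := by
      simp [lab, h1, h2]
    rw [PL.c4, e1, PL.P4, PL.c3, e2]

lemma PL.c4_xy0 (t : ℝ) (s : Bool) : S.c4 u t (.xy s) 0 = S.X := by
  simp [PL.c4, lab, src4, PL.P4]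

lemma PL.c4_xy1 (t : ℝ) (s : Bool) : S.c4 u t (.xy s) 1 = S.X + (sg s * t) • u := by
  simp [PL.c4, lab, tgt4, PL.P4, PL.N4]

lemma PL.c4_zero {e : E4 A B} {e3 : E3 A B} (h : pr e = some e3) (k : ℕ) :
    S.c4 u 0 e k = S.c3 e3 k := by
  cases e <;> simp only [pr, Option.some.injEq, reduceCtorEq] at h <;> subst h
  · exact S.c4_ab u _ _ _ _
  · exact S.c4_xb u _ _ _
  · rw [S.c4_ya]; simp

/-- Free segments of the original drawing. -/
def PL.F3 (e f : E3 A B) (k l : ℕ) : Prop :=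
  SegFree (lab src3 tgt3 S.N e k) (lab src3 tgt3 S.N e (k + 1))
      (lab src3 tgt3 S.N f l) (lab src3 tgt3 S.N f (l + 1))

/-- Free segments of the doubled drawing. -/
def PL.F4 (e f : E4 A B) (k l : ℕ) : Prop :=
  SegFree (lab src4 tgt4 S.N4 e k) (lab src4 tgt4 S.N4 e (k + 1))
      (lab src4 tgt4 S.N4 f l) (lab src4 tgt4 S.N4 f (l + 1))

/-- Disjoint segments of the original drawing. -/
def PL.D3 (e f : E3 A B) (k l : ℕ) : Prop :=
  Disjoint (segment ℝ (S.c3 e k) (S.c3 e (k + 1))) (segment ℝ (S.c3 f l) (S.c3 f (l + 1)))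

/-- Disjoint segments of the doubled drawing. -/
def PL.D4 (t : ℝ) (e f : E4 A B) (k l : ℕ) : Prop :=
  Disjoint (segment ℝ (S.c4 u t e k) (S.c4 u t e (k + 1)))
    (segment ℝ (S.c4 u t f l) (S.c4 u t f (l + 1)))

lemma PL.F3.symm {S : PL (src3 (A := A) (B := B)) tgt3 C} {e f : E3 A B} {k l : ℕ}
    (h : S.F3 e f k l) : S.F3 f e l k :=
  ⟨h.1.symm, h.2.2.1.symm, h.2.1.symm, h.2.2.2.symm⟩

lemma PL.F4.symm {S : PL (src3 (A := A) (B := B)) tgt3 C} {e f : E4 A B} {k l : ℕ}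
    (h : S.F4 e f k l) : S.F4 f e l k :=
  ⟨h.1.symm, h.2.2.1.symm, h.2.1.symm, h.2.2.2.symm⟩

/-- The condition for a crossing near `x`. -/
def PL.nr (s : Bool) (v w : A ⊕ B) : Prop :=
  0 < crs u (S.d v) * crs u (S.d w) ∧ 0 < sg s * (crs u (S.d v) * crs (S.d w) (S.d v))

/-- Pairs crossing near `x`. -/
def PL.Near : E4 A B → E4 A B → Prop
  | .ya s i, .xb j => S.nr u s (Sum.inl i) (Sum.inr j)
  | .xb j, .ya s i => S.nr u s (Sum.inl i) (Sum.inr j)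
  | .ya s i, .ya s' i' => s ≠ s' ∧ S.nr u s (Sum.inl i) (Sum.inl i')
  | _, _ => False

lemma PL.Near.symm {S : PL (src3 (A := A) (B := B)) tgt3 C} {u : ℝ × ℝ} {e f : E4 A B}
    (h : S.Near u e f) : S.Near u f e := by
  cases e <;> cases f <;> simp only [PL.Near] at h ⊢ <;> try exact h
  rename_i s i s' i'
  obtain ⟨h1, h2, h3⟩ := h
  refine ⟨h1.symm, by rw [mul_comm]; exact h2, ?_⟩
  have : s' = !s := by cases s <;> cases s' <;> simp_all
  subst this
  rw [sg_not, crs_swap (S.d (Sum.inl i))]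
  have := mul_pos h2 h3
  have e : ∀ a b c g : ℝ, a * b * (g * (a * c)) = a * a * (- g * (b * - c)) := by intros; ring
  rw [e] at this
  exact pos_of_mul_pos_right this (mul_self_nonneg _)

/-- Conclusion when two free segments of the doubled drawing meet. -/
def PL.Cc (e f : E4 A B) (k l : ℕ) : Prop :=
  (∃ e3 f3, pr e = some e3 ∧ pr f = some f3 ∧ S.F3 e3 f3 k l ∧ ¬ S.D3 e3 f3 k l) ∨
    (k = 0 ∧ l = 0 ∧ S.Near u e f)

/-- Main property. -/
def PL.Q (e f : E4 A B) (k l : ℕ) : Prop :=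
  ∀ᶠ t in 𝓝[>] (0:ℝ), S.F4 e f k l → ¬ S.D4 u t e f k l → S.Cc u e f k l

lemma PL.Q.symm {S : PL (src3 (A := A) (B := B)) tgt3 C} {u : ℝ × ℝ} {e f : E4 A B} {k l : ℕ}
    (h : S.Q u e f k l) : S.Q u f e l k := by
  refine h.mono (fun t h h1 h2 => ?_)
  rcases h h1.symm (fun h3 => h2 (Disjoint.symm h3)) with ⟨e3, f3, a, b, c, d⟩ | ⟨a, b, c⟩
  · exact Or.inl ⟨f3, e3, b, a, c.symm, fun h => d (Disjoint.symm h)⟩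
  · exact Or.inr ⟨b, a, c.symm⟩

lemma PL.Q_of_disj {e f : E4 A B} {k l : ℕ}
    (h : ∀ᶠ t in 𝓝[>] (0:ℝ), S.D4 u t e f k l) : S.Q u e f k l :=
  h.mono (fun _ h _ h2 => absurd h h2)

lemma PL.Q_of_disj0 {e f : E4 A B} {k l : ℕ} (h : S.D4 u 0 e f k l) : S.Q u e f k l :=
  S.Q_of_disj u (seg_disj_eventually (S.c4_tendsto u e k) (S.c4_tendsto u e (k + 1))
    (S.c4_tendsto u f l) (S.c4_tendsto u f (l + 1)) h)

lemma PL.Q_of_free {e f : E4 A B} {k l : ℕ} {e3 f3 : E3 A B} (he : pr e = some e3)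
    (hf : pr f = some f3) (h : S.F3 e3 f3 k l) : S.Q u e f k l := by
  by_cases hD : S.D3 e3 f3 k l
  · apply S.Q_of_disj0
    unfold PL.D4
    simp only [S.c4_zero u he, S.c4_zero u hf]
    exact hD
  · exact Eventually.of_forall fun t _ _ => Or.inl ⟨e3, f3, he, hf, h, hD⟩

/-- Pairs of edges for which no labels have been identified. -/
def GoodP : E4 A B → E4 A B → Prop
  | .ab _ _, .ab _ _ => True
  | .ab _ _, .xb _ => True
  | .ab _ _, .ya _ _ => True
  | .xb _, .xb _ => True
  | .ya s _, .ya s' _ => s = s'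
  | _, _ => False

lemma PL.good_lab {e f : E4 A B} (h : GoodP e f) {e3 f3 : E3 A B} (he : pr e = some e3)
    (hf : pr f = some f3) {k l : ℕ} (hl : lab src3 tgt3 S.N e3 k = lab src3 tgt3 S.N f3 l) :
    lab src4 tgt4 S.N4 e k = lab src4 tgt4 S.N4 f l := by
  by_cases k1 : k = 0 <;> by_cases k2 : S.N e3 ≤ k <;> by_cases l1 : l = 0 <;>
    by_cases l2 : S.N f3 ≤ l <;>
  cases e <;> cases f <;> simp only [GoodP] at h <;>
    simp only [pr, Option.some.injEq, reduceCtorEq] at he hf <;> subst he <;> subst hf <;>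
    simp [lab, src3, tgt3, src4, tgt4, PL.N4, k1, k2, l1, l2] at hl ⊢ <;> simp_all

lemma PL.Q_of_good {e f : E4 A B} (h : GoodP e f) {e3 f3 : E3 A B} (he : pr e = some e3)
    (hf : pr f = some f3) (k l : ℕ) : S.Q u e f k l := by
  by_cases h3 : S.F3 e3 f3 k l
  · exact S.Q_of_free u he hf h3
  · refine Eventually.of_forall fun t h4 _ => absurd ?_ h3
    exact ⟨fun h' => h4.1 (S.good_lab h he hf h'), fun h' => h4.2.1 (S.good_lab h he hf h'),
      fun h' => h4.2.2.1 (S.good_lab h he hf h'), fun h' => h4.2.2.2 (S.good_lab h he hf h')⟩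

end doubling
end partJ

section partK
open Filter Topology

section doubling2

variable {A B : Type} {C : E3 A B → E3 A B → Prop} (S : PL (src3 (A := A) (B := B)) tgt3 C)
  (u : ℝ × ℝ)

lemma crs_smul_left (v : ℝ × ℝ) (t : ℝ) (p : ℝ × ℝ) : crs (t • v) p = t * crs v p := by
  simp [crs]; ring

/-- The edge from `x` to `v`. -/
def xe : A ⊕ B → E3 A B
  | Sum.inl i => .xa i
  | Sum.inr j => .xb j

lemma PL.c3_xe_zero (v : A ⊕ B) : S.c3 (xe v) 0 = S.X := by
  cases v <;> simp [PL.c3, lab, xe, src3, PL.X]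

lemma PL.d_eq (v : A ⊕ B) : S.d v = S.c3 (xe v) 1 - S.X := by
  cases v <;> rfl

lemma PL.c3_xe_one (v : A ⊕ B) : S.c3 (xe v) 1 = S.X + S.d v := by
  rw [S.d_eq]; abel

lemma src3_ne_tgt3 (e : E3 A B) : src3 e ≠ tgt3 e := by cases e <;> simp [src3, tgt3]

lemma PL.lab_xe (v w : A ⊕ B) (hvw : v ≠ w) {k l : ℕ}
    (h : lab src3 tgt3 S.N (xe v) k = lab src3 tgt3 S.N (xe w) l) : k = 0 ∧ l = 0 := by
  by_cases k1 : k = 0 <;> by_cases k2 : S.N (xe v) ≤ k <;> by_cases l1 : l = 0 <;>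
    by_cases l2 : S.N (xe w) ≤ l <;> cases v <;> cases w <;>
    simp only [xe] at k2 l2 h <;>
    simp [lab, src3, tgt3, k1, k2, l1, l2] at h ⊢ <;> simp_all

lemma PL.lab_x {e : E3 A B} {k : ℕ} (h : Sum.inl V3.x = lab src3 tgt3 S.N e k) : k = 0 := by
  by_contra k1
  by_cases k2 : S.N e ≤ k <;> cases e <;> simp [lab, src3, tgt3, k1, k2] at h

lemma ori_crs (p q r : ℝ × ℝ) : ori p q r = crs (q - p) (r - p) := by simp [ori, crs]
lemma ori_crs' (p q r : ℝ × ℝ) : ori p q r = crs (q - p) (r - q) := by simp [ori, crs]; ring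

variable (hG : GenPos (used (V := V3 A B) S.N) S.P)

lemma x_used : Sum.inl V3.x ∈ used (V := V3 A B) S.N := by intro p hp; simp at hp

lemma PL.d_indep (hG : GenPos (used (V := V3 A B) S.N) S.P) {v w : A ⊕ B} (h : v ≠ w) :
    crs (S.d v) (S.d w) ≠ 0 := by
  have := hG.tri (Sum.inl V3.x) (x_used S) (lab src3 tgt3 S.N (xe v) 1) (lab_used _ _ _ _ _)
    (lab src3 tgt3 S.N (xe w) 1) (lab_used _ _ _ _ _) (fun h => by simpa using S.lab_x h)
    (fun h => by simpa using S.lab_x h) (fun h' => by simpa using S.lab_xe v w h h')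
  rw [ori_crs] at this
  rw [S.d_eq, S.d_eq]
  exact this

lemma PL.d_ne (hG : GenPos (used (V := V3 A B) S.N) S.P) (v : A ⊕ B) : S.d v ≠ 0 := by
  have := hG.inj (lab src3 tgt3 S.N (xe v) 1) (lab_used _ _ _ _ _) (Sum.inl V3.x) (x_used S)
    (fun h => by simpa using S.lab_x h.symm)
  rw [S.d_eq]
  exact sub_ne_zero.2 this

lemma PL.kappa (hG : GenPos (used (V := V3 A B) S.N) S.P) (e : E3 A B) {k : ℕ} (hk : k + 1 < S.N e) :
    crs (S.c3 e (k + 1) - S.c3 e k) (S.c3 e (k + 2) - S.c3 e (k + 1)) ≠ 0 := by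
  have hne : ∀ i j, i ≤ S.N e → j ≤ S.N e → i ≠ j →
      lab src3 tgt3 S.N e i ≠ lab src3 tgt3 S.N e j :=
    fun i j hi hj hij h => hij (lab_inj S.N e (src3_ne_tgt3 e) hi hj h)
  have := hG.tri (lab src3 tgt3 S.N e k) (lab_used _ _ _ _ _) (lab src3 tgt3 S.N e (k + 1))
    (lab_used _ _ _ _ _) (lab src3 tgt3 S.N e (k + 2)) (lab_used _ _ _ _ _)
    (hne _ _ (by omega) (by omega) (by omega)) (hne _ _ (by omega) (by omega) (by omega))
    (hne _ _ (by omega) (by omega) (by omega))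
  rw [ori_crs'] at this
  exact this

lemma PL.Q_xb_ya (hG : GenPos (used (V := V3 A B) S.N) S.P) (hu : ∀ v, crs u (S.d v) ≠ 0)
    (j : B) (s : Bool) (i : A) (k l : ℕ) : S.Q u (.ya s i) (.xb j) k l := by
  by_cases h3 : S.F3 (.xa i) (.xb j) k l
  · exact S.Q_of_free u rfl rfl h3
  have hne : (Sum.inl i : A ⊕ B) ≠ Sum.inr j := by simp
  have hkl : k = 0 ∧ l = 0 := by
    by_contra hcon
    apply h3
    refine ⟨fun h => hcon (S.lab_xe (Sum.inl i) (Sum.inr j) hne h), fun h => ?_, fun h => ?_, fun h => ?_⟩ <;>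
    · have := S.lab_xe (Sum.inl i) (Sum.inr j) hne h
      omega
  obtain ⟨rfl, rfl⟩ := hkl
  by_cases hn : S.Near u (.ya s i) (.xb j)
  · exact Eventually.of_forall fun t _ _ => Or.inr ⟨rfl, rfl, hn⟩
  apply S.Q_of_disj
  have key := near_xb (x := S.X) (u := sg s • u) (da := S.d (Sum.inl i)) (db := S.d (Sum.inr j))
    (p := fun t => S.c4 u t (.ya s i) 1) (by
      rw [← S.c3_xe_one]
      have := S.c4_tendsto u (.ya s i) 1
      rwa [S.c4_zero u rfl] at this) (by rw [crs_smul_left]; exact mul_ne_zero (sg_ne s) (hu _))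
    (by rw [crs_smul_left]; exact mul_ne_zero (sg_ne s) (hu _)) (S.d_indep hG hne.symm) (by
      rintro ⟨h1, h2⟩
      apply hn
      rw [crs_smul_left, crs_smul_left] at h1
      rw [crs_smul_left] at h2
      refine ⟨?_, by rw [← mul_assoc]; exact h2⟩
      rw [mul_mul_mul_comm, sg_sq, one_mul] at h1
      exact h1)
  refine key.mono (fun t h => ?_)
  unfold PL.D4
  rw [S.c4_xb, S.c4_xb, S.c4_ya]
  have e1 : S.c3 (.xb j) 0 = S.X := S.c3_xe_zero (Sum.inr j)
  have e2 : S.c3 (.xb j) 1 = S.X + S.d (Sum.inr j) := S.c3_xe_one (Sum.inr j)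
  have e3 : S.c3 (.xa i) 0 = S.X := S.c3_xe_zero (Sum.inl i)
  have e4 : S.W u i 0 = u := by simp [PL.W]
  rw [e1, e2, e3, e4, mul_comm, mul_smul]
  exact h

lemma PL.Q_ya_ya (hG : GenPos (used (V := V3 A B) S.N) S.P) (hu : ∀ v, crs u (S.d v) ≠ 0)
    (s : Bool) (i i' : A) (hii : i ≠ i') (k l : ℕ) : S.Q u (.ya s i) (.ya (!s) i') k l := by
  by_cases h3 : S.F3 (.xa i) (.xa i') k l
  · exact S.Q_of_free u rfl rfl h3
  have hne : (Sum.inl i : A ⊕ B) ≠ Sum.inl i' := by simpa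
  have hkl : k = 0 ∧ l = 0 := by
    by_contra hcon
    apply h3
    refine ⟨fun h => hcon (S.lab_xe (Sum.inl i) (Sum.inl i') hne h), fun h => ?_, fun h => ?_, fun h => ?_⟩ <;>
    · have := S.lab_xe (Sum.inl i) (Sum.inl i') hne h
      omega
  obtain ⟨rfl, rfl⟩ := hkl
  by_cases hn : S.Near u (.ya s i) (.ya (!s) i')
  · exact Eventually.of_forall fun t _ _ => Or.inr ⟨rfl, rfl, hn⟩
  apply S.Q_of_disj
  have ht : ∀ s i, Tendsto (fun t => S.c4 u t (.ya s i) 1) (𝓝[>] 0) (𝓝 (S.X + S.d (Sum.inl i))) := by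
    intro s i
    rw [← S.c3_xe_one]
    have := S.c4_tendsto u (.ya s i) 1
    rwa [S.c4_zero u rfl] at this
  have key := near_yy (x := S.X) (u := sg s • u) (da := S.d (Sum.inl i)) (db := S.d (Sum.inl i'))
    (p := fun t => S.c4 u t (.ya s i) 1) (q := fun t => S.c4 u t (.ya (!s) i') 1) (ht _ _) (ht _ _)
    (by rw [crs_smul_left]; exact mul_ne_zero (sg_ne s) (hu _))
    (by rw [crs_smul_left]; exact mul_ne_zero (sg_ne s) (hu _)) (S.d_indep hG hne.symm) (by
      rintro ⟨h1, h2⟩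
      apply hn
      rw [crs_smul_left, crs_smul_left] at h1
      rw [crs_smul_left] at h2
      refine ⟨by simp, ?_, by rw [← mul_assoc]; exact h2⟩
      rw [mul_mul_mul_comm, sg_sq, one_mul] at h1
      exact h1)
  refine key.mono (fun t h => ?_)
  unfold PL.D4
  have e3 : ∀ i, S.c3 (.xa i) 0 = S.X := fun i => S.c3_xe_zero (Sum.inl i)
  have e4 : ∀ i, S.W u i 0 = u := by simp [PL.W]
  have e5 : ∀ s i, S.c4 u t (.ya s i) 0 = S.X + t • (sg s • u) := by
    intro s i
    rw [S.c4_ya, e3, e4, mul_comm, mul_smul]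
  rw [e5, e5, sg_not]
  convert h using 2
  simp

lemma PL.Q_ya_same (hG : GenPos (used (V := V3 A B) S.N) S.P) (hu : ∀ v, crs u (S.d v) ≠ 0)
    (i : A) {k l : ℕ} (hk : k < S.N (.xa i)) (hl : l < S.N (.xa i)) :
    S.Q u (.ya true i) (.ya false i) k l := by
  by_cases h3 : S.F3 (.xa i) (.xa i) k l
  · exact S.Q_of_free u rfl rfl h3
  by_cases h4 : S.F4 (.ya true i) (.ya false i) k l
  swap
  · exact Eventually.of_forall fun t h _ => absurd h h4
  apply S.Q_of_disj
  have hlab : ∀ a b, a ≤ S.N (.xa i) → b ≤ S.N (.xa i) → a ≠ b →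
      lab src3 tgt3 S.N (.xa i) a ≠ lab src3 tgt3 S.N (.xa i) b :=
    fun a b ha hb hab h => hab (lab_inj S.N _ (src3_ne_tgt3 _) ha hb h)
  have hkl : k ≤ l + 1 ∧ l ≤ k + 1 := by
    by_contra hcon
    apply h3
    refine ⟨hlab _ _ ?_ ?_ ?_, hlab _ _ ?_ ?_ ?_, hlab _ _ ?_ ?_ ?_, hlab _ _ ?_ ?_ ?_⟩ <;> omega
  have hlast : ¬ (k + 1 = S.N (.xa i) ∧ l + 1 = S.N (.xa i)) := by
    rintro ⟨h1, h2⟩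
    refine h4.2.2.2 ?_
    have a := lab_N (src := src4) (tgt := tgt4) S.N4 (.ya true i) (S.hN (.xa i))
    have b := lab_N (src := src4) (tgt := tgt4) S.N4 (.ya false i) (S.hN (.xa i))
    rw [h1, h2]
    exact a.trans b.symm
  set σ := crs (S.c3 (.xa i) 1 - S.c3 (.xa i) 0) u with hσ
  have e3 : S.c3 (.xa i) 0 = S.X := S.c3_xe_zero (Sum.inl i)
  have hσ0 : σ ≠ 0 := by
    rw [hσ, e3, crs_swap]
    exact neg_ne_zero.2 (hu (Sum.inl i))
  have key := sides (c := S.c3 (.xa i)) (W := S.W u i) (σ := σ) (N := S.N (.xa i)) hσ0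
    (fun k hk => S.kappa hG _ hk) ?_ ?_ ?_ hk hl hkl.1 hkl.2 hlast
  · refine key.mono (fun t h => ?_)
    unfold PL.D4
    simp only [S.c4_ya, sg]
    simpa using h
  · intro k hk
    rcases k with _ | k
    · simp only [PL.W, if_true]
      exact mul_self_pos.2 hσ0
    · have hκ := S.kappa hG _ hk
      simp only [PL.W, Nat.succ_ne_zero, if_false, if_neg (not_le.2 hk), Nat.add_sub_cancel]
      rw [crs_smul, crs_sub _ (_ - _) (_ - _), crs_self, crs_swap (S.c3 (.xa i) (k + 1 + 1) - S.c3 (.xa i) (k + 1))]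
      have e : ∀ a b : ℝ, a * (a * b * (0 - -b)) = (a * b) * (a * b) := by intros; ring
      rw [← hσ, e]
      exact mul_self_pos.2 (mul_ne_zero hσ0 hκ)
  · intro k hk
    have hκ := S.kappa hG _ hk
    simp only [PL.W, Nat.succ_ne_zero, if_false, if_neg (not_le.2 hk), Nat.add_sub_cancel]
    rw [crs_smul, crs_sub _ (_ - _) (_ - _), crs_self]
    have e : ∀ a b : ℝ, a * (a * b * (b - 0)) = (a * b) * (a * b) := by intros; ring
    rw [← hσ, e]
    exact mul_self_pos.2 (mul_ne_zero hσ0 hκ)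
  · have := (S.hN (.xa i)).ne'
    simp [PL.W, this]

lemma PL.Q_xy_off (hG : GenPos (used (V := V3 A B) S.N) S.P) (s : Bool) {f : E4 A B} {f3 : E3 A B}
    (hf : pr f = some f3) {l : ℕ} (hl : l < S.N f3)
    (hx : Sum.inl V3.x ≠ lab src3 tgt3 S.N f3 l) : S.Q u (.xy s) f 0 l := by
  apply S.Q_of_disj0
  unfold PL.D4
  rw [S.c4_xy0, S.c4_xy1, S.c4_zero u hf, S.c4_zero u hf, mul_zero, zero_smul, add_zero,
    segment_same, Set.disjoint_singleton_left]
  intro h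
  rcases hG.vertex_on (x_used S) (lab_used src3 tgt3 S.N f3 l) (lab_used src3 tgt3 S.N f3 (l + 1)) (by
    intro h
    have := lab_inj S.N _ (src3_ne_tgt3 _) (by omega) (by omega) h
    omega) h with h | h
  · exact hx h
  · simpa using S.lab_x h

lemma PL.Q_xy_ya (hG : GenPos (used (V := V3 A B) S.N) S.P) (hu : ∀ v, crs u (S.d v) ≠ 0)
    (s s' : Bool) (i : A) {l : ℕ} (hl : l < S.N (.xa i)) : S.Q u (.xy s) (.ya s' i) 0 l := by
  rcases Nat.eq_zero_or_pos l with rfl | hpos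
  · by_cases hs : s' = s
    · subst hs
      refine Eventually.of_forall fun t h _ => absurd ?_ h.2.2.1
      simp [lab, PL.N4, tgt4, src4]
    · have hs : s' = !s := by cases s <;> cases s' <;> simp_all
      subst hs
      apply S.Q_of_disj
      have ht : Tendsto (fun t => S.c4 u t (.ya (!s) i) 1) (𝓝[>] 0) (𝓝 (S.X + S.d (Sum.inl i))) := by
        rw [← S.c3_xe_one]
        have := S.c4_tendsto u (.ya (!s) i) 1
        rwa [S.c4_zero u rfl] at this
      have ht' : Tendsto (fun t => crs u (S.c4 u t (.ya (!s) i) 1 - S.X)) (𝓝[>] 0)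
          (𝓝 (crs u (S.X + S.d (Sum.inl i) - S.X))) :=
        ((crs_cont u).tendsto _).comp (ht.sub_const _)
      rw [add_sub_cancel_left] at ht'
      have ev := ht'.eventually_ne (hu (Sum.inl i))
      filter_upwards [ev, pos_ev] with t h1 h2
      unfold PL.D4
      have e3 : S.c3 (.xa i) 0 = S.X := S.c3_xe_zero (Sum.inl i)
      have e4 : S.W u i 0 = u := by simp [PL.W]
      rw [S.c4_xy0, S.c4_xy1, S.c4_ya u t (!s) i 0, e3, e4, sg_not, neg_mul]
      refine near_xy ?_ h1
      exact mul_self_pos.2 (mul_ne_zero (sg_ne s) h2.ne')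
  · exact S.Q_xy_off u hG s rfl hl (fun h => hpos.ne' (S.lab_x h))

lemma PL.Q_all (hG : GenPos (used (V := V3 A B) S.N) S.P) (hu : ∀ v, crs u (S.d v) ≠ 0)
    (e f : E4 A B) {k l : ℕ} (hk : k < S.N4 e) (hl : l < S.N4 f) : S.Q u e f k l := by
  have xy_ab : ∀ s i j l, l < S.N (.ab i j) → S.Q u (.xy s) (.ab i j) 0 l := fun s i j l hl =>
    S.Q_xy_off u hG s rfl hl (fun h => by have := S.lab_x h; subst this; simp [lab, src3] at h)
  have xy_xb : ∀ s j l, l < S.N (.xb j) → S.Q u (.xy s) (.xb j) 0 l := by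
    intro s j l hl
    by_cases h0 : l = 0
    · subst h0
      refine Eventually.of_forall fun t h _ => absurd ?_ h.1
      simp [lab, src4]
    · exact S.Q_xy_off u hG s rfl hl (fun h => h0 (S.lab_x h))
  rcases e with ⟨i, j⟩ | j | ⟨s, i⟩ | s <;> rcases f with ⟨i', j'⟩ | j' | ⟨s', i'⟩ | s'
  · exact S.Q_of_good u (by exact trivial) rfl rfl _ _
  · exact S.Q_of_good u (by exact trivial) rfl rfl _ _
  · exact S.Q_of_good u (by exact trivial) rfl rfl _ _
  · have : l = 0 := by simp [PL.N4] at hl; exact hl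
    subst this
    exact (xy_ab _ _ _ _ hk).symm
  · exact (S.Q_of_good u (e := .ab i' j') (f := .xb j) trivial rfl rfl _ _).symm
  · exact S.Q_of_good u (by exact trivial) rfl rfl _ _
  · exact (S.Q_xb_ya u hG hu _ _ _ _ _).symm
  · have : l = 0 := by simp [PL.N4] at hl; exact hl
    subst this
    exact (xy_xb _ _ _ hk).symm
  · exact (S.Q_of_good u (e := .ab i' j') (f := .ya s i) trivial rfl rfl _ _).symm
  · exact S.Q_xb_ya u hG hu _ _ _ _ _
  · by_cases hs : s = s'
    · exact S.Q_of_good u (by exact hs) rfl rfl _ _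
    by_cases hi : i = i'
    · subst hi
      cases s <;> cases s' <;> simp at hs
      · exact (S.Q_ya_same u hG hu i hl hk).symm
      · exact S.Q_ya_same u hG hu i hk hl
    · have hs : s' = !s := by cases s <;> cases s' <;> simp_all
      subst hs
      exact S.Q_ya_ya u hG hu s i i' hi _ _
  · have : l = 0 := by simp [PL.N4] at hl; exact hl
    subst this
    exact (S.Q_xy_ya u hG hu _ _ _ hk).symm
  · have : k = 0 := by simp [PL.N4] at hk; exact hk
    subst this
    exact xy_ab _ _ _ _ hl
  · have : k = 0 := by simp [PL.N4] at hk; exact hk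
    subst this
    exact xy_xb _ _ _ hl
  · have : k = 0 := by simp [PL.N4] at hk; exact hk
    subst this
    exact S.Q_xy_ya u hG hu _ _ _ hl
  · have : k = 0 := by simp [PL.N4] at hk; exact hk
    subst this
    have : l = 0 := by simp [PL.N4] at hl; exact hl
    subst this
    refine Eventually.of_forall fun t h _ => absurd ?_ h.1
    simp [lab, src4]

/-- Crossings of the doubled drawing. -/
def PL.C4 (C : E3 A B → E3 A B → Prop) (S : PL (src3 (A := A) (B := B)) tgt3 C) (u : ℝ × ℝ)
    (e f : E4 A B) : Prop :=
  (∃ e3 f3, pr e = some e3 ∧ pr f = some f3 ∧ C e3 f3) ∨ S.Near u e f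

lemma PL.near_pr {S : PL (src3 (A := A) (B := B)) tgt3 C} {u : ℝ × ℝ} {e f : E4 A B}
    (h : S.Near u e f) {e3 f3 : E3 A B} (he : pr e = some e3) (hf : pr f = some f3) :
    src3 e3 = V3.x ∧ src3 f3 = V3.x := by
  cases e <;> cases f <;> simp only [PL.Near] at h <;>
    simp only [pr, Option.some.injEq] at he hf <;> subst he <;> subst hf <;> simp [src3]

lemma PL.near_self {S : PL (src3 (A := A) (B := B)) tgt3 C} {u : ℝ × ℝ} {s s' : Bool} {i : A}
    (h : S.Near u (.ya s i) (.ya s' i)) : False := by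
  obtain ⟨_, _, h3⟩ := h
  rw [crs_self] at h3
  simp at h3

theorem PL.double [Finite A] [Finite B] (hG : GenPos (used (V := V3 A B) S.N) S.P)
    (hC : ∀ e f, C e f → ∀ v, (v = src3 e ∨ v = tgt3 e) → (v = src3 f ∨ v = tgt3 f) → False)
    (hu : ∀ v, crs u (S.d v) ≠ 0) :
    Nonempty (PL (src4 (A := A) (B := B)) tgt4 (PL.C4 C S u)) := by
  have hall : ∀ᶠ t in 𝓝[>] (0:ℝ), ∀ e f : E4 A B, ∀ k : Fin (S.N4 e), ∀ l : Fin (S.N4 f),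
      S.F4 e f k l → ¬ S.D4 u t e f k l → S.Cc u e f k l := by
    rw [eventually_all]; intro e
    rw [eventually_all]; intro f
    rw [eventually_all]; intro k
    rw [eventually_all]; intro l
    exact S.Q_all u hG hu e f k.2 l.2
  obtain ⟨t, ht⟩ := hall.exists
  have imp : ∀ e f k l, k < S.N4 e → l < S.N4 f → S.F4 e f k l → ¬ S.D4 u t e f k l →
      S.Cc u e f k l := fun e f k l hk hl => ht e f ⟨k, hk⟩ ⟨l, hl⟩
  have hN : ∀ e e3, pr e = some e3 → S.N4 e = S.N e3 := by
    intro e e3 h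
    cases e <;> simp only [pr, Option.some.injEq, reduceCtorEq] at h <;> subst h <;> rfl
  refine ⟨{ N := S.N4, hN := ?_, P := S.P4 u t, cross_imp := ?_, uniq := ?_ }⟩
  · intro e
    cases e <;> simp only [PL.N4] <;> first | exact S.hN _ | norm_num
  · intro e f k l hk hl hF hD
    rcases imp e f k l hk hl hF hD with ⟨e3, f3, h1, h2, h3, h4⟩ | ⟨_, _, h⟩
    · refine Or.inl ⟨e3, f3, h1, h2, S.cross_imp e3 f3 k l ?_ ?_ h3 h4⟩
      · rw [← hN e e3 h1]; exact hk
      · rw [← hN f f3 h2]; exact hl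
    · exact Or.inr h
  · intro e f k l k' l' hk hl hk' hl' hF hF' hD hD'
    have mix : ∀ e3 f3, pr e = some e3 → pr f = some f3 → S.Near u e f → ∀ k l, k < S.N4 e →
        l < S.N4 f → S.F3 e3 f3 k l → ¬ S.D3 e3 f3 k l → False := by
      intro e3 f3 h1 h2 h k l hk hl h3 h4
      have := S.cross_imp e3 f3 k l (by rw [← hN e e3 h1]; exact hk)
        (by rw [← hN f f3 h2]; exact hl) h3 h4
      obtain ⟨hx, hy⟩ := PL.near_pr h h1 h2
      exact hC _ _ this V3.x (Or.inl hx.symm) (Or.inl hy.symm)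
    rcases imp e f k l hk hl hF hD with ⟨e3, f3, h1, h2, h3, h4⟩ | ⟨a, b, h⟩ <;>
    rcases imp e f k' l' hk' hl' hF' hD' with ⟨e3', f3', h1', h2', h3', h4'⟩ | ⟨a', b', h'⟩
    · obtain rfl : e3 = e3' := by rw [h1] at h1'; exact Option.some.inj h1'
      obtain rfl : f3 = f3' := by rw [h2] at h2'; exact Option.some.inj h2'
      rw [hN e e3 h1] at hk hk'
      rw [hN f f3 h2] at hl hl'
      exact S.uniq e3 f3 k l k' l' hk hl hk' hl' h3 h3' h4 h4'
    · exact (mix e3 f3 h1 h2 h' k l hk hl h3 h4).elim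
    · exact (mix e3' f3' h1' h2' h k' l' hk' hl' h3' h4').elim
    · omega

lemma PL.C4_no_common
    (hC : ∀ e f, C e f → ∀ v, (v = src3 e ∨ v = tgt3 e) → (v = src3 f ∨ v = tgt3 f) → False)
    (e f : E4 A B) (h : PL.C4 C S u e f) (v : V4 A B) (h1 : v = src4 e ∨ v = tgt4 e)
    (h2 : v = src4 f ∨ v = tgt4 f) : False := by
  rcases h with ⟨e3, f3, he, hf, h⟩ | h
  · let g : V4 A B → V3 A B := fun v => match v with
      | .x => .x
      | .a i => .a i
      | .b j => .b j
      | .y _ => .x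
    have hg : ∀ e e3, pr e = some e3 → g (src4 e) = src3 e3 ∧ g (tgt4 e) = tgt3 e3 := by
      intro e e3 h
      cases e <;> simp only [pr, Option.some.injEq, reduceCtorEq] at h <;> subst h <;>
        simp [g, src4, tgt4, src3, tgt3]
    refine hC _ _ h (g v) ?_ ?_
    · rw [← (hg _ _ he).1, ← (hg _ _ he).2]
      exact h1.imp (congrArg g) (congrArg g)
    · rw [← (hg _ _ hf).1, ← (hg _ _ hf).2]
      exact h2.imp (congrArg g) (congrArg g)
  · cases e <;> cases f <;> simp only [src4, tgt4] at h1 h2 <;> try exact h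
    · rcases h1 with rfl | rfl <;> simp at h2
    · rcases h1 with rfl | rfl <;> simp at h2
    · rename_i s i s' i'
      rcases h1 with rfl | rfl
      · simp at h2
        exact h.1 h2
      · simp at h2
        subst h2
        exact PL.near_self h

end doubling2
end partK

section partM
open Filter Topology

lemma halving_step {ι : Type} [Finite ι] (c r : ι → ℝ) (hr : Function.Injective r)
    (T : Finset ι) (h0 : 2 * (T.filter (fun v => 0 < c v)).card ≤ T.card) (hc : ∀ v, c v ≠ 0) (n : ℕ) :
    ∀ s : ℝ, (∀ v, r v ≠ s) → (T.filter (fun v => s < r v)).card = n →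
      2 * (T.filter (fun v => 0 < c v * (r v - s))).card ≤ T.card →
      ∃ s, (∀ v, r v ≠ s) ∧ 2 * (T.filter (fun v => 0 < c v * (r v - s))).card ≤ T.card + 1 ∧
        T.card ≤ 2 * (T.filter (fun v => 0 < c v * (r v - s))).card + 1 := by
  classical
  induction n with
  | zero =>
    intro s hs hn h
    refine ⟨s, hs, by omega, ?_⟩
    rw [Finset.card_eq_zero, Finset.filter_eq_empty_iff] at hn
    have e : T.filter (fun v => 0 < c v * (r v - s)) = T.filter (fun v => ¬ 0 < c v) := by
      apply Finset.filter_congr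
      intro v hv
      have h1 : r v - s < 0 := by
        have := hn hv
        have := hs v
        grind
      rw [not_lt]
      constructor
      · intro h; nlinarith
      · intro h
        have : c v < 0 := lt_of_le_of_ne h (hc v)
        exact mul_pos_of_neg_of_neg this h1
    have := Finset.card_filter_add_card_filter_not (s := T) (fun v => 0 < c v)
    rw [e]
    omega
  | succ n ih =>
    intro s hs hn h
    by_cases hlow : T.card ≤ 2 * (T.filter (fun v => 0 < c v * (r v - s))).card + 1
    · exact ⟨s, hs, by omega, hlow⟩
    have hne : (T.filter (fun v => s < r v)).Nonempty := by
      rw [← Finset.card_pos]; omega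
    obtain ⟨v0, hv0, hmin⟩ := Finset.exists_min_image _ r hne
    rw [Finset.mem_filter] at hv0
    have hev : ∀ᶠ s' in 𝓝[>] (r v0), ∀ w, r w ≠ s' ∧ (r v0 < r w → s' < r w) := by
      rw [eventually_all]
      intro w
      rcases lt_or_ge (r v0) (r w) with hw | hw
      · have : ∀ᶠ s' in 𝓝[>] (r v0), s' < r w := (eventually_lt_nhds hw).filter_mono nhdsWithin_le_nhds
        exact this.mono (fun s' h => ⟨h.ne', fun _ => h⟩)
      · have : ∀ᶠ s' in 𝓝[>] (r v0), r v0 < s' := self_mem_nhdsWithin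
        exact this.mono (fun s' h => ⟨(hw.trans_lt h).ne, fun h' => absurd h' (not_lt.2 hw)⟩)
    have hev2 : ∀ᶠ s' in 𝓝[>] (r v0), r v0 < s' := self_mem_nhdsWithin
    obtain ⟨s', h1, h2⟩ := (hev.and hev2).exists
    have key : ∀ v ∈ T, v ≠ v0 → (s' < r v ↔ s < r v) := by
      intro v hv hne
      constructor
      · intro h; linarith [hv0.2]
      · intro h
        have := hmin v (Finset.mem_filter.2 ⟨hv, h⟩)
        exact (h1 v).2 (lt_of_le_of_ne this (fun h => hne (hr h).symm))
    have e1 : T.filter (fun v => s' < r v) = (T.filter (fun v => s < r v)).erase v0 := by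
      ext v
      simp only [Finset.mem_filter, Finset.mem_erase]
      by_cases hv : v = v0
      · subst hv; simp; intro _; exact h2.le
      · constructor
        · rintro ⟨a, b⟩; exact ⟨hv, a, (key v a hv).1 b⟩
        · rintro ⟨_, a, b⟩; exact ⟨a, (key v a hv).2 b⟩
    have e2 : T.filter (fun v => 0 < c v * (r v - s')) ⊆
        insert v0 (T.filter (fun v => 0 < c v * (r v - s))) := by
      intro v hv
      simp only [Finset.mem_filter, Finset.mem_insert] at hv ⊢
      by_cases hv' : v = v0
      · exact Or.inl hv'
      · refine Or.inr ⟨hv.1, ?_⟩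
        have k := key v hv.1 hv'
        have a := (h1 v).1
        have b := hs v
        have hp := hv.2
        rcases lt_or_gt_of_ne a with a | a <;> rcases lt_or_gt_of_ne b with b | b
        · have : c v < 0 := by
            by_contra hc'
            nlinarith
          exact mul_pos_of_neg_of_neg this (by linarith)
        · exact absurd (k.2 b) (not_lt.2 a.le)
        · exact absurd (k.1 a) (not_lt.2 b.le)
        · have : 0 < c v := by
            by_contra hc'
            nlinarith
          exact mul_pos this (by linarith)
    have hc2 := Finset.card_le_card e2
    have hc3 := Finset.card_insert_le v0 (T.filter (fun v => 0 < c v * (r v - s)))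
    refine ih s' (fun v => (h1 v).1) ?_ (by omega)
    rw [e1, Finset.card_erase_of_mem (Finset.mem_filter.2 hv0), hn]
    rfl

lemma halving_real {ι : Type} [Finite ι] (c r : ι → ℝ) (hr : Function.Injective r)
    (T : Finset ι) (hc : ∀ v, c v ≠ 0) :
    ∃ s, (∀ v, r v ≠ s) ∧ 2 * (T.filter (fun v => 0 < c v * (r v - s))).card ≤ T.card + 1 ∧
        T.card ≤ 2 * (T.filter (fun v => 0 < c v * (r v - s))).card + 1 := by
  classical
  have main : ∀ c : ι → ℝ, (∀ v, c v ≠ 0) → 2 * (T.filter (fun v => 0 < c v)).card ≤ T.card →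
      ∃ s, (∀ v, r v ≠ s) ∧ 2 * (T.filter (fun v => 0 < c v * (r v - s))).card ≤ T.card + 1 ∧
        T.card ≤ 2 * (T.filter (fun v => 0 < c v * (r v - s))).card + 1 := by
    intro c hc h0
    obtain ⟨s, hs⟩ : ∃ s, ∀ v, s < r v := by
      obtain ⟨M, hM⟩ := (Set.finite_range r).bddBelow
      exact ⟨M - 1, fun v => by have := hM ⟨v, rfl⟩; linarith⟩
    refine halving_step c r hr T h0 hc _ s (fun v => (hs v).ne') rfl ?_
    have e : T.filter (fun v => 0 < c v * (r v - s)) = T.filter (fun v => 0 < c v) := by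
      apply Finset.filter_congr
      intro v _
      exact mul_pos_iff_of_pos_right (sub_pos.2 (hs v))
    rw [e]; exact h0
  by_cases h0 : 2 * (T.filter (fun v => 0 < c v)).card ≤ T.card
  · exact main c hc h0
  · have e : ∀ c' : ι → ℝ, (∀ v, c' v ≠ 0) → T.filter (fun v => 0 < -c' v) = T.filter (fun v => ¬ 0 < c' v) := by
      intro c' hc'
      apply Finset.filter_congr
      intro v _
      have := hc' v
      grind
    have k := Finset.card_filter_add_card_filter_not (s := T) (fun v => 0 < c v)
    obtain ⟨s, h1, h2, h3⟩ := main (fun v => - c v) (fun v => neg_ne_zero.2 (hc v)) (by rw [e c hc]; omega)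
    have k' := Finset.card_filter_add_card_filter_not (s := T) (fun v => 0 < c v * (r v - s))
    simp only [neg_mul] at h2 h3
    rw [e (fun v => c v * (r v - s)) (fun v => mul_ne_zero (hc v) (sub_ne_zero.2 (h1 v)))] at h2 h3
    exact ⟨s, h1, by omega, by omega⟩

/-- A line halving a finite set of directions. -/
lemma halving {ι : Type} [Finite ι] (d : ι → ℝ × ℝ) (h0 : ∀ v, d v ≠ 0)
    (h1 : ∀ v w, v ≠ w → crs (d v) (d w) ≠ 0) (T : Finset ι) :
    ∃ u, (∀ v, crs u (d v) ≠ 0) ∧ 2 * (T.filter (fun v => 0 < crs u (d v))).card ≤ T.card + 1 ∧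
      T.card ≤ 2 * (T.filter (fun v => 0 < crs u (d v))).card + 1 := by
  obtain ⟨τ, hτ⟩ := (Set.finite_range (fun v => (d v).2 / (d v).1)).exists_notMem
  have hc : ∀ v, crs (1, τ) (d v) ≠ 0 := by
    intro v h
    simp only [crs, one_mul] at h
    by_cases hd : (d v).1 = 0
    · rw [hd, mul_zero, sub_zero] at h
      exact h0 v (Prod.ext hd h)
    · exact hτ ⟨v, by simp only; rw [div_eq_iff hd]; linarith⟩
  obtain ⟨s, h2, h3, h4⟩ := halving_real (fun v => crs (1, τ) (d v))
    (fun v => crs (0, 1) (d v) / crs (1, τ) (d v)) (by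
      intro v w h
      by_contra hne
      simp only at h
      rw [div_eq_div_iff (hc v) (hc w)] at h
      apply h1 v w hne
      simp only [crs] at h ⊢
      linarith) T hc
  have key : ∀ v, crs (1, τ) (d v) * (crs (0, 1) (d v) / crs (1, τ) (d v) - s) =
      crs ((0, 1) - s • (1, τ)) (d v) := by
    intro v
    rw [mul_sub, mul_div_cancel₀ _ (hc v)]
    simp [crs]; ring
  simp only [key] at h3 h4
  refine ⟨_, ?_, h3, h4⟩
  intro v
  rw [← key]
  exact mul_ne_zero (hc v) (sub_ne_zero.2 (h2 v))
end partM

section partN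
section counting

variable {A B : Type} [Fintype A] [Fintype B] {C : E3 A B → E3 A B → Prop}

lemma ind_false {p : Prop} (h : ¬ p) : ind p = 0 := by simp [ind, h]
lemma ind_congr {p q : Prop} (h : p ↔ q) : ind p = ind q := by rw [propext h]
lemma ind_le_one (p : Prop) : ind p ≤ 1 := by unfold ind; split_ifs <;> simp
lemma ind_le {p q : Prop} (h : p → q) : ind p ≤ ind q := by
  unfold ind; split_ifs <;> simp_all

/-- Sum over the edges between `A` and `B`. -/
def sAB (F : E4 A B → ℕ) : ℕ := ∑ q : A × B, F (.ab q.1 q.2)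
/-- Sum over the edges between `x` and `B`. -/
def sX (F : E4 A B → ℕ) : ℕ := ∑ j : B, F (.xb j)
/-- Sum over the edges between `y` and `A`. -/
def sY (s : Bool) (F : E4 A B → ℕ) : ℕ := ∑ i : A, F (.ya s i)

lemma K_xy (S : PL (src3 (A := A) (B := B)) tgt3 C) (u : ℝ × ℝ) (s : Bool) (f : E4 A B) :
    ind (PL.C4 C S u (.xy s) f) = 0 := by
  apply ind_false
  rintro (⟨e3, f3, h, _⟩ | h)
  · simp [pr] at h
  · exact h

lemma K_symm (hsym : ∀ e f, C e f → C f e) (S : PL (src3 (A := A) (B := B)) tgt3 C) (u : ℝ × ℝ)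
    (e f : E4 A B) : ind (PL.C4 C S u e f) = ind (PL.C4 C S u f e) := by
  have : ∀ e f, PL.C4 C S u e f → PL.C4 C S u f e := by
    rintro e f (⟨e3, f3, h1, h2, h3⟩ | h)
    · exact Or.inl ⟨f3, e3, h2, h1, hsym _ _ h3⟩
    · exact Or.inr h.symm
  exact ind_congr ⟨this e f, this f e⟩

lemma K_orig (S : PL (src3 (A := A) (B := B)) tgt3 C) (u : ℝ × ℝ) {e f : E4 A B} {e3 f3 : E3 A B}
    (he : pr e = some e3) (hf : pr f = some f3) (hn : ¬ S.Near u e f) :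
    ind (PL.C4 C S u e f) = ind (C e3 f3) := by
  apply ind_congr
  constructor
  · rintro (⟨e3', f3', h1, h2, h3⟩ | h)
    · rw [he] at h1; rw [hf] at h2
      cases h1; cases h2; exact h3
    · exact absurd h hn
  · intro h; exact Or.inl ⟨e3, f3, he, hf, h⟩

lemma K_near (S : PL (src3 (A := A) (B := B)) tgt3 C) (u : ℝ × ℝ) {e f : E4 A B} {e3 f3 : E3 A B}
    (he : pr e = some e3) (hf : pr f = some f3) (hn : ¬ C e3 f3) :
    ind (PL.C4 C S u e f) = ind (S.Near u e f) := by
  apply ind_congr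
  constructor
  · rintro (⟨e3', f3', h1, h2, h3⟩ | h)
    · rw [he] at h1; rw [hf] at h2
      cases h1; cases h2; exact absurd h3 hn
    · exact h
  · intro h; exact Or.inr h

/-- Twice the number of crossings among `A B`-edges. -/
noncomputable def caa (C : E3 A B → E3 A B → Prop) : ℕ :=
  ∑ q : A × B, ∑ q' : A × B, ind (C (.ab q.1 q.2) (.ab q'.1 q'.2))
/-- Crossings of `x B`-edges. -/
noncomputable def cbb (C : E3 A B → E3 A B → Prop) : ℕ :=
  ∑ j : B, ∑ q : A × B, ind (C (.xb j) (.ab q.1 q.2))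
/-- Crossings of `x A`-edges. -/
noncomputable def cgg (C : E3 A B → E3 A B → Prop) : ℕ :=
  ∑ i : A, ∑ q : A × B, ind (C (.xa i) (.ab q.1 q.2))
/-- Near crossings. -/
noncomputable def PL.nb (S : PL (src3 (A := A) (B := B)) tgt3 C) (u : ℝ × ℝ) (s : Bool) : ℕ :=
  ∑ i : A, ∑ j : B, ind (S.nr u s (Sum.inl i) (Sum.inr j))
/-- Near crossings. -/
noncomputable def PL.na (S : PL (src3 (A := A) (B := B)) tgt3 C) (u : ℝ × ℝ) : ℕ :=
  ∑ i : A, ∑ i' : A, ind (S.nr u true (Sum.inl i) (Sum.inl i'))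

/-- The edge of the doubled graph between two vertices. -/
def ed : Option A × (B ⊕ Bool) → E4 A B
  | (some i, Sum.inl j) => .ab i j
  | (some i, Sum.inr s) => .ya s i
  | (none, Sum.inl j) => .xb j
  | (none, Sum.inr s) => .xy s

/-- The vertices of the doubled graph. -/
def vt : Option A ⊕ (B ⊕ Bool) → V4 A B
  | Sum.inl none => .x
  | Sum.inl (some i) => .a i
  | Sum.inr (Sum.inl j) => .b j
  | Sum.inr (Sum.inr s) => .y s

lemma vt_inj : Function.Injective (vt (A := A) (B := B)) := by
  rintro ((_ | _) | _ | _) ((_ | _) | _ | _) h <;> simp [vt] at h <;> simp [h]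

lemma Zbound4 (hZC : ∀ a b : ℕ, 0 < a → 0 < b → crossingNumber (bipK a b) = Z a b)
    {C4 : E4 A B → E4 A B → Prop} (S : PL (src4 (A := A) (B := B)) tgt4 C4)
    (hC : ∀ e f, C4 e f → ∀ v, (v = src4 e ∨ v = tgt4 e) → (v = src4 f ∨ v = tgt4 f) → False)
    {A' B' : Type} [Fintype A'] [Fintype B'] [Nonempty A'] [Nonempty B']
    (f : A' → Option A) (hf : Function.Injective f) (g : B' → B ⊕ Bool) (hg : Function.Injective g) :
    2 * Z (Fintype.card A') (Fintype.card B') ≤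
      ∑ p : A' × B', ∑ q : A' × B', ind (C4 (ed (f p.1, g p.2)) (ed (f q.1, g q.2))) := by
  refine Zbound hZC S hC (vt ∘ Sum.map f g) (vt_inj.comp (Sum.map_injective.2 ⟨hf, hg⟩))
    (fun p => ed (f p.1, g p.2)) ?_
  rintro ⟨a, b⟩
  simp only [Function.comp, Sum.map_inl, Sum.map_inr]
  rcases f a with _ | i <;> rcases g b with j | s <;> simp [ed, vt, src4, tgt4]

section
variable (F : E4 A B → ℕ) (hF : ∀ s, F (.xy s) = 0)

lemma sum_full (F : E4 A B → ℕ) (hF : ∀ s, F (.xy s) = 0) : ∑ p : Option A × (B ⊕ Bool), F (ed (id p.1, id p.2)) =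
    sAB F + sX F + sY true F + sY false F := by
  simp only [Fintype.sum_prod_type, Fintype.sum_option, Fintype.sum_sum_type, Fintype.sum_bool, id,
    ed, hF, sAB, sX, sY, Finset.sum_add_distrib]
  ring

lemma sum_delx (F : E4 A B → ℕ) : ∑ p : A × (B ⊕ Bool), F (ed (some p.1, id p.2)) =
    sAB F + sY true F + sY false F := by
  simp only [Fintype.sum_prod_type, Fintype.sum_sum_type, Fintype.sum_bool, id,
    ed, sAB, sY, Finset.sum_add_distrib]
  ring

/-- Embedding. -/
def gy (s : Bool) : B ⊕ Unit → B ⊕ Bool := Sum.map id (fun _ => s)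

lemma sum_one (s : Bool) (F : E4 A B → ℕ) (hF : ∀ s, F (.xy s) = 0) :
    ∑ p : Option A × (B ⊕ Unit), F (ed (id p.1, gy s p.2)) = sAB F + sX F + sY s F := by
  simp only [Fintype.sum_prod_type, Fintype.sum_option, Fintype.sum_sum_type, id, gy, Sum.map_inl,
    Sum.map_inr, ed, hF, sAB, sX, sY, Finset.sum_add_distrib, Finset.univ_unique, Finset.sum_singleton]
  ring

lemma sum_none (F : E4 A B → ℕ) :
    ∑ p : Option A × B, F (ed (id p.1, Sum.inl p.2)) = sAB F + sX F := by
  simp only [Fintype.sum_prod_type, Fintype.sum_option, id, ed, sAB, sX]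
  ring
end

lemma sAB_add (F G : E4 A B → ℕ) : sAB (fun e => F e + G e) = sAB F + sAB G := Finset.sum_add_distrib
lemma sX_add (F G : E4 A B → ℕ) : sX (fun e => F e + G e) = sX F + sX G := Finset.sum_add_distrib
lemma sY_add (s : Bool) (F G : E4 A B → ℕ) : sY s (fun e => F e + G e) = sY s F + sY s G :=
  Finset.sum_add_distrib

lemma blocks (hsym : ∀ e f, C e f → C f e)
    (hC : ∀ e f, C e f → ∀ v, (v = src3 e ∨ v = tgt3 e) → (v = src3 f ∨ v = tgt3 f) → False)
    (S : PL (src3 (A := A) (B := B)) tgt3 C) (u : ℝ × ℝ) :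
    let K := fun e f => ind (PL.C4 C S u e f)
    sAB (fun e => sAB (K e)) = caa C ∧ sAB (fun e => sX (K e)) = cbb C ∧
    sX (fun e => sAB (K e)) = cbb C ∧ (∀ s, sAB (fun e => sY s (K e)) = cgg C) ∧
    (∀ s, sY s (fun e => sAB (K e)) = cgg C) ∧ sX (fun e => sX (K e)) = 0 ∧
    (∀ s, sX (fun e => sY s (K e)) = S.nb u s) ∧ (∀ s, sY s (fun e => sX (K e)) = S.nb u s) ∧
    (∀ s, sY s (fun e => sY s (K e)) = 0) ∧ sY true (fun e => sY false (K e)) = S.na u ∧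
    sY false (fun e => sY true (K e)) = S.na u := by
  intro K
  have hx : ∀ v w : A ⊕ B, ¬ C (xe v) (xe w) := by
    intro v w h
    exact hC _ _ h V3.x (Or.inl (by cases v <;> rfl)) (Or.inl (by cases w <;> rfl))
  have h3 : sX (fun e => sAB (K e)) = cbb C :=
    Finset.sum_congr rfl fun j _ => Finset.sum_congr rfl fun q _ =>
      K_orig S u rfl rfl (fun h => h)
  have h5 : ∀ s, sY s (fun e => sAB (K e)) = cgg C := fun s =>
    Finset.sum_congr rfl fun i _ => Finset.sum_congr rfl fun q _ =>
      K_orig S u rfl rfl (fun h => h)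
  have h8 : ∀ s, sY s (fun e => sX (K e)) = S.nb u s := fun s =>
    Finset.sum_congr rfl fun i _ => Finset.sum_congr rfl fun j _ =>
      K_near S u (e := .ya s i) (f := .xb j) rfl rfl (hx (Sum.inl i) (Sum.inr j))
  have hn : sY true (fun e => sY false (K e)) = S.na u :=
    Finset.sum_congr rfl fun i _ => Finset.sum_congr rfl fun j _ => by
      refine (K_near S u (e := .ya true i) (f := .ya false j) rfl rfl (hx (Sum.inl i) (Sum.inl j))).trans ?_
      exact ind_congr ⟨fun h => h.2, fun h => ⟨by simp, h⟩⟩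
  refine ⟨?_, ?_, h3, ?_, h5, ?_, ?_, h8, ?_, hn, ?_⟩
  · exact Finset.sum_congr rfl fun j _ => Finset.sum_congr rfl fun q _ =>
      K_orig S u rfl rfl (fun h => h)
  · rw [← h3]
    exact (Finset.sum_congr rfl fun _ _ => Finset.sum_congr rfl fun _ _ => K_symm hsym S u _ _).trans
      Finset.sum_comm
  · intro s
    rw [← h5 s]
    exact (Finset.sum_congr rfl fun _ _ => Finset.sum_congr rfl fun _ _ => K_symm hsym S u _ _).trans
      Finset.sum_comm
  · refine Finset.sum_eq_zero fun i _ => Finset.sum_eq_zero fun j _ => ?_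
    refine (K_near S u (e := .xb i) (f := .xb j) rfl rfl (hx (Sum.inr i) (Sum.inr j))).trans ?_
    exact ind_false (fun h => h)
  · intro s
    rw [← h8 s]
    exact (Finset.sum_congr rfl fun _ _ => Finset.sum_congr rfl fun _ _ => K_symm hsym S u _ _).trans
      Finset.sum_comm
  · intro s
    refine Finset.sum_eq_zero fun i _ => Finset.sum_eq_zero fun j _ => ?_
    refine (K_near S u (e := .ya s i) (f := .ya s j) rfl rfl (hx (Sum.inl i) (Sum.inl j))).trans ?_
    exact ind_false (fun h => h.1 rfl)
  · rw [← hn]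
    exact (Finset.sum_congr rfl fun _ _ => Finset.sum_congr rfl fun _ _ => K_symm hsym S u _ _).trans
      Finset.sum_comm

theorem Zineqs (hZC : ∀ a b : ℕ, 0 < a → 0 < b → crossingNumber (bipK a b) = Z a b)
    [Nonempty A] [Nonempty B] (hsym : ∀ e f, C e f → C f e)
    (hC : ∀ e f, C e f → ∀ v, (v = src3 e ∨ v = tgt3 e) → (v = src3 f ∨ v = tgt3 f) → False)
    (S : PL (src3 (A := A) (B := B)) tgt3 C) (hG : GenPos (used (V := V3 A B) S.N) S.P)
    (u : ℝ × ℝ) (hu : ∀ v, crs u (S.d v) ≠ 0) :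
    2 * Z (Fintype.card A + 1) (Fintype.card B + 2) ≤
      caa C + 2 * cbb C + 4 * cgg C + 2 * S.nb u true + 2 * S.nb u false + 2 * S.na u ∧
    2 * Z (Fintype.card A) (Fintype.card B + 2) ≤ caa C + 4 * cgg C + 2 * S.na u ∧
    (∀ s, 2 * Z (Fintype.card A + 1) (Fintype.card B + 1) ≤
      caa C + 2 * cbb C + 2 * cgg C + 2 * S.nb u s) ∧
    2 * Z (Fintype.card A + 1) (Fintype.card B) ≤ caa C + 2 * cbb C := by
  obtain ⟨S4⟩ := S.double u hG hC hu
  have hC4 := PL.C4_no_common S u hC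
  obtain ⟨b1, b2, b3, b4, b5, b6, b7, b8, b9, b10, b11⟩ := blocks hsym hC S u
  beta_reduce at b1 b2 b3 b4 b5 b6 b7 b8 b9 b10 b11
  have k0 : ∀ e s, ind (PL.C4 C S u e (.xy s)) = 0 := by
    intro e s; rw [K_symm hsym]; exact K_xy S u s e
  refine ⟨?_, ?_, ?_, ?_⟩
  · have h := Zbound4 hZC S4 hC4 (A' := Option A) (B' := B ⊕ Bool) id Function.injective_id id
      Function.injective_id
    rw [Fintype.card_option, Fintype.card_sum, Fintype.card_bool] at h
    refine h.trans (le_of_eq ?_)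
    simp only [fun e => sum_full (fun f => ind (PL.C4 C S u e f)) (k0 e)]
    rw [sum_full (fun e => sAB (fun f => ind (PL.C4 C S u e f)) + sX (fun f => ind (PL.C4 C S u e f)) +
      sY true (fun f => ind (PL.C4 C S u e f)) + sY false (fun f => ind (PL.C4 C S u e f)))]
    · simp only [sAB_add, sX_add, sY_add, b1, b2, b3, b4, b5, b6, b7, b8, b9, b10, b11]
      ring
    · intro s
      simp [sAB, sX, sY, K_xy]
  · have h := Zbound4 hZC S4 hC4 (A' := A) (B' := B ⊕ Bool) some (Option.some_injective _) id
      Function.injective_id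
    rw [Fintype.card_sum, Fintype.card_bool] at h
    refine h.trans (le_of_eq ?_)
    simp only [fun e => sum_delx (fun f => ind (PL.C4 C S u e f))]
    rw [sum_delx (fun e => sAB (fun f => ind (PL.C4 C S u e f)) +
      sY true (fun f => ind (PL.C4 C S u e f)) + sY false (fun f => ind (PL.C4 C S u e f)))]
    simp only [sAB_add, sX_add, sY_add, b1, b2, b3, b4, b5, b6, b7, b8, b9, b10, b11]
    ring
  · intro s
    have h := Zbound4 hZC S4 hC4 (A' := Option A) (B' := B ⊕ Unit) id Function.injective_id (gy s)
      (Sum.map_injective.2 ⟨Function.injective_id, fun _ _ _ => rfl⟩)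
    rw [Fintype.card_option, Fintype.card_sum, Fintype.card_unit] at h
    refine h.trans (le_of_eq ?_)
    simp only [fun e => sum_one s (fun f => ind (PL.C4 C S u e f)) (k0 e)]
    rw [sum_one s (fun e => sAB (fun f => ind (PL.C4 C S u e f)) + sX (fun f => ind (PL.C4 C S u e f)) +
      sY s (fun f => ind (PL.C4 C S u e f)))]
    · simp only [sAB_add, sX_add, sY_add, b1, b2, b3, b4, b5, b6, b7, b8, b9, b10, b11]
      ring
    · intro s
      simp [sAB, sX, sY, K_xy]
  · have h := Zbound4 hZC S4 hC4 (A' := Option A) (B' := B) id Function.injective_id Sum.inl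
      Sum.inl_injective
    rw [Fintype.card_option] at h
    refine h.trans (le_of_eq ?_)
    simp only [fun e => sum_none (fun f => ind (PL.C4 C S u e f))]
    rw [sum_none (fun e => sAB (fun f => ind (PL.C4 C S u e f)) + sX (fun f => ind (PL.C4 C S u e f)))]
    simp only [sAB_add, sX_add, sY_add, b1, b2, b3, b4, b5, b6, b7, b8, b9, b10, b11]
    ring

end counting
end partN

section partO
section outcomes

lemma sum_ind_pos {ι : Type} [Fintype ι] (x : ι → ℝ) :
    ∑ i, ind (0 < x i) = (Finset.univ.filter (fun i => 0 < x i)).card := by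
  classical
  rw [Finset.card_filter]
  exact Finset.sum_congr rfl fun i _ => by unfold ind; congr

lemma sum_ind_npos {ι : Type} [Fintype ι] (x : ι → ℝ) :
    ∑ i, ind (¬ 0 < x i) = Fintype.card ι - (Finset.univ.filter (fun i => 0 < x i)).card := by
  have : ∑ i, ind (¬ 0 < x i) + ∑ i, ind (0 < x i) = Fintype.card ι := by
    rw [← Finset.sum_add_distrib, Fintype.card_eq_sum_ones]
    refine Finset.sum_congr rfl fun i _ => ?_
    unfold ind
    by_cases h : 0 < x i <;> simp [h]
  rw [sum_ind_pos] at this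
  omega

lemma ind_mul_pos {x y : ℝ} (hx : x ≠ 0) (hy : y ≠ 0) :
    ind (0 < x * y) = ind (0 < x) * ind (0 < y) + ind (¬ 0 < x) * ind (¬ 0 < y) := by
  unfold ind
  rcases hx.lt_or_gt with h | h <;> rcases hy.lt_or_gt with h' | h'
  · simp [h.not_gt, h'.not_gt, mul_pos_of_neg_of_neg h h']
  · simp [h.not_gt, h', (mul_neg_of_neg_of_pos h h').not_gt]
  · simp [h, h'.not_gt, (mul_neg_of_pos_of_neg h h').not_gt]
  · simp [h, h', mul_pos h h']

lemma sum_same_side {ι κ : Type} [Fintype ι] [Fintype κ] (x : ι → ℝ) (y : κ → ℝ) (hx : ∀ i, x i ≠ 0)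
    (hy : ∀ j, y j ≠ 0) : ∑ i, ∑ j, ind (0 < x i * y j) =
      (Finset.univ.filter (fun i => 0 < x i)).card * (Finset.univ.filter (fun j => 0 < y j)).card +
      (Fintype.card ι - (Finset.univ.filter (fun i => 0 < x i)).card) *
        (Fintype.card κ - (Finset.univ.filter (fun j => 0 < y j)).card) := by
  simp only [ind_mul_pos (hx _) (hy _), Finset.sum_add_distrib, ← Finset.mul_sum, ← Finset.sum_mul]
  rw [sum_ind_pos, sum_ind_pos, sum_ind_npos, sum_ind_npos]

variable {A B : Type} [Fintype A] [Fintype B] {C : E3 A B → E3 A B → Prop}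

lemma PL.nb_le (S : PL (src3 (A := A) (B := B)) tgt3 C) (u : ℝ × ℝ) (hu : ∀ v, crs u (S.d v) ≠ 0) :
    S.nb u true + S.nb u false ≤
      (Finset.univ.filter (fun i : A => 0 < crs u (S.d (Sum.inl i)))).card *
        (Finset.univ.filter (fun j : B => 0 < crs u (S.d (Sum.inr j)))).card +
      (Fintype.card A - (Finset.univ.filter (fun i : A => 0 < crs u (S.d (Sum.inl i)))).card) *
        (Fintype.card B - (Finset.univ.filter (fun j : B => 0 < crs u (S.d (Sum.inr j)))).card) := by
  rw [← sum_same_side _ _ (fun i => hu _) (fun j => hu _)]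
  unfold PL.nb
  rw [← Finset.sum_add_distrib]
  refine Finset.sum_le_sum fun i _ => ?_
  rw [← Finset.sum_add_distrib]
  refine Finset.sum_le_sum fun j _ => ?_
  by_cases h : S.nr u true (Sum.inl i) (Sum.inr j)
  · rw [ind_false (p := S.nr u false _ _), add_zero]
    · exact ind_le fun h => h.1
    · intro h'
      have h1 := h.2
      have h2 := h'.2
      simp only [sg, if_true, one_mul, Bool.false_eq_true, if_false, neg_mul] at h1 h2
      linarith
  · rw [ind_false h, zero_add]
    exact ind_le fun h => h.1

lemma PL.na_le (S : PL (src3 (A := A) (B := B)) tgt3 C) (u : ℝ × ℝ) (hu : ∀ v, crs u (S.d v) ≠ 0) :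
    2 * S.na u + Fintype.card A ≤
      (Finset.univ.filter (fun i : A => 0 < crs u (S.d (Sum.inl i)))).card *
        (Finset.univ.filter (fun i : A => 0 < crs u (S.d (Sum.inl i)))).card +
      (Fintype.card A - (Finset.univ.filter (fun i : A => 0 < crs u (S.d (Sum.inl i)))).card) *
        (Fintype.card A - (Finset.univ.filter (fun i : A => 0 < crs u (S.d (Sum.inl i)))).card) := by
  classical
  rw [← sum_same_side _ _ (fun i => hu _) (fun j => hu _)]
  have e1 : Fintype.card A = ∑ i : A, ∑ i' : A, ind (i = i') := by
    simp [ind]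
  have e2 : S.na u = ∑ i : A, ∑ i' : A, ind (S.nr u true (Sum.inl i') (Sum.inl i)) := by
    unfold PL.na; exact Finset.sum_comm
  have e3 : 2 * S.na u = (∑ i : A, ∑ i' : A, ind (S.nr u true (Sum.inl i) (Sum.inl i'))) +
      ∑ i : A, ∑ i' : A, ind (S.nr u true (Sum.inl i') (Sum.inl i)) := by
    rw [← e2]; unfold PL.na; ring
  rw [e1, e3, ← Finset.sum_add_distrib, ← Finset.sum_add_distrib]
  refine Finset.sum_le_sum fun i _ => ?_
  rw [← Finset.sum_add_distrib, ← Finset.sum_add_distrib]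
  refine Finset.sum_le_sum fun j _ => ?_
  by_cases hij : i = j
  · subst hij
    have hn : ¬ S.nr u true (Sum.inl i) (Sum.inl i) := by
      rintro ⟨_, h⟩
      rw [crs_self] at h
      simp at h
    rw [ind_false hn]
    have : 0 < crs u (S.d (Sum.inl i)) * crs u (S.d (Sum.inl i)) := mul_self_pos.2 (hu _)
    simp [ind, this]
  · rw [ind_false hij, add_zero]
    by_cases h : S.nr u true (Sum.inl i) (Sum.inl j)
    · rw [ind_false (p := S.nr u true (Sum.inl j) (Sum.inl i)), add_zero]
      · exact ind_le fun h => h.1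
      · intro h'
        have h1 := h.2
        have h2 := h'.2
        have h3 := h.1
        simp only [sg, if_true, one_mul] at h1 h2
        rw [crs_swap (S.d (Sum.inl i))] at h2
        have := mul_pos h1 h2
        nlinarith [mul_pos h3 (mul_self_pos.2 (show crs (S.d (Sum.inl j)) (S.d (Sum.inl i)) ≠ 0 by
          intro h0; rw [h0] at h1; simp at h1))]
    · rw [ind_false h, zero_add]
      refine ind_le fun h => ?_
      rw [mul_comm]; exact h.1

lemma filter_inl (x : A ⊕ B → ℝ) :
    ((Finset.univ.map Function.Embedding.inl).filter (fun v => 0 < x v)).card =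
      (Finset.univ.filter (fun i : A => 0 < x (Sum.inl i))).card := by
  rw [Finset.filter_map, Finset.card_map]; rfl

lemma filter_inr (x : A ⊕ B → ℝ) :
    ((Finset.univ.map Function.Embedding.inr).filter (fun v => 0 < x v)).card =
      (Finset.univ.filter (fun i : B => 0 < x (Sum.inr i))).card := by
  rw [Finset.filter_map, Finset.card_map]; rfl

theorem outcomes (hZC : ∀ a b : ℕ, 0 < a → 0 < b → crossingNumber (bipK a b) = Z a b)
    [Nonempty A] [Nonempty B] (hsym : ∀ e f, C e f → C f e)
    (hC : ∀ e f, C e f → ∀ v, (v = src3 e ∨ v = tgt3 e) → (v = src3 f ∨ v = tgt3 f) → False)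
    (S0 : PL (src3 (A := A) (B := B)) tgt3 C) :
    (∀ k, Fintype.card A = 2 * k →
      2 * Z (Fintype.card A + 1) (Fintype.card B + 2) + 2 * k ≤
        caa C + 2 * cbb C + 4 * cgg C + 2 * k * Fintype.card B + 2 * (k * k) ∧
      2 * Z (Fintype.card A + 1) (Fintype.card B) ≤ caa C + 2 * cbb C) ∧
    (∀ k, Fintype.card A = 2 * k + 1 →
      2 * Z (Fintype.card A) (Fintype.card B + 2) ≤ caa C + 4 * cgg C + 2 * (k * k)) ∧
    (∀ l, Fintype.card B = 2 * l →
      4 * Z (Fintype.card A + 1) (Fintype.card B + 1) ≤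
        2 * (caa C + 2 * cbb C + 2 * cgg C) + 2 * (Fintype.card A * l)) := by
  obtain ⟨S, hG⟩ := S0.generic
  have h0 := S.d_ne hG
  have h1 : ∀ v w, v ≠ w → crs (S.d v) (S.d w) ≠ 0 := fun v w h => S.d_indep hG h
  obtain ⟨u, hu, ha1, ha2⟩ := halving S.d h0 h1 (Finset.univ.map Function.Embedding.inl)
  obtain ⟨w, hw, hb1, hb2⟩ := halving S.d h0 h1 (Finset.univ.map Function.Embedding.inr)
  rw [filter_inl (fun v => crs u (S.d v)), Finset.card_map, Finset.card_univ] at ha1 ha2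
  rw [filter_inr (fun v => crs w (S.d v)), Finset.card_map, Finset.card_univ] at hb1 hb2
  obtain ⟨z1, z2, -, z4⟩ := Zineqs hZC hsym hC S hG u hu
  obtain ⟨-, -, z3, -⟩ := Zineqs hZC hsym hC S hG w hw
  have nbu := S.nb_le u hu
  have nau := S.na_le u hu
  have nbw := S.nb_le w hw
  have hsle : (Finset.univ.filter (fun j : B => 0 < crs u (S.d (Sum.inr j)))).card ≤ Fintype.card B :=
    Finset.card_le_univ _
  have hple : (Finset.univ.filter (fun i : A => 0 < crs w (S.d (Sum.inl i)))).card ≤ Fintype.card A :=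
    Finset.card_le_univ _
  generalize (Finset.univ.filter (fun i : A => 0 < crs u (S.d (Sum.inl i)))).card = p at *
  generalize (Finset.univ.filter (fun i : B => 0 < crs u (S.d (Sum.inr i)))).card = s at *
  generalize (Finset.univ.filter (fun i : A => 0 < crs w (S.d (Sum.inl i)))).card = p' at *
  generalize (Finset.univ.filter (fun i : B => 0 < crs w (S.d (Sum.inr i)))).card = s' at *
  generalize Fintype.card A = m at *
  generalize Fintype.card B = n at *
  refine ⟨?_, ?_, ?_⟩
  · intro k hk
    obtain rfl : p = k := by omega
    obtain ⟨t, rfl⟩ := Nat.exists_eq_add_of_le hsle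
    have e : m - p = p := by omega
    rw [e] at nbu nau
    have e' : s + t - s = t := by omega
    rw [e'] at nbu
    refine ⟨?_, z4⟩
    nlinarith
  · intro k hk
    have : p = k ∧ m - p = k + 1 ∨ p = k + 1 ∧ m - p = k := by omega
    have : 2 * S.na u ≤ 2 * (k * k) := by
      rcases this with ⟨e1, e2⟩ | ⟨e1, e2⟩ <;> rw [e2, e1, hk] at nau <;> nlinarith
    omega
  · intro l hl
    obtain rfl : s' = l := by omega
    obtain ⟨t, rfl⟩ := Nat.exists_eq_add_of_le hple
    have e : n - s' = s' := by omega
    rw [e] at nbw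
    have e' : p' + t - p' = t := by omega
    rw [e'] at nbw
    have a := z3 true
    have b := z3 false
    nlinarith

end outcomes
end partO

section partP
section lower

/-- Decomposition of the edges. -/
def e3Equiv (A B : Type) : (A × B) ⊕ (A ⊕ B) ≃ E3 A B where
  toFun
    | Sum.inl q => .ab q.1 q.2
    | Sum.inr (Sum.inl i) => .xa i
    | Sum.inr (Sum.inr j) => .xb j
  invFun
    | .ab i j => Sum.inl (i, j)
    | .xa i => Sum.inr (Sum.inl i)
    | .xb j => Sum.inr (Sum.inr j)
  left_inv := by rintro (⟨_, _⟩ | _ | _) <;> rfl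
  right_inv := by rintro (⟨_, _⟩ | _ | _) <;> rfl

variable {A B : Type} [Fintype A] [Fintype B]

noncomputable instance : Fintype (E3 A B) := Fintype.ofEquiv _ (e3Equiv A B)

lemma sum_E3 (F : E3 A B → ℕ) :
    ∑ e, F e = ∑ q : A × B, F (.ab q.1 q.2) + (∑ i, F (.xa i) + ∑ j, F (.xb j)) := by
  rw [← (e3Equiv A B).sum_comp, Fintype.sum_sum_type, Fintype.sum_sum_type]
  rfl

lemma total_E3 {C : E3 A B → E3 A B → Prop} (hsym : ∀ e f, C e f → C f e)
    (hC : ∀ e f, C e f → ∀ v, (v = src3 e ∨ v = tgt3 e) → (v = src3 f ∨ v = tgt3 f) → False) :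
    ∑ e, ∑ f, ind (C e f) = caa C + 2 * cbb C + 2 * cgg C := by
  have hs : ∀ e f, ind (C e f) = ind (C f e) := fun e f => ind_congr ⟨hsym e f, hsym f e⟩
  have h1 : ∀ i i' : A, ind (C (.xa i) (.xa i')) = 0 := fun i i' =>
    ind_false fun h => hC _ _ h .x (Or.inl rfl) (Or.inl rfl)
  have h2 : ∀ (i : A) (j : B), ind (C (.xa i) (.xb j)) = 0 := fun i i' =>
    ind_false fun h => hC _ _ h .x (Or.inl rfl) (Or.inl rfl)
  have h3 : ∀ (i : A) (j : B), ind (C (.xb j) (.xa i)) = 0 := fun i i' =>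
    ind_false fun h => hC _ _ h .x (Or.inl rfl) (Or.inl rfl)
  have h4 : ∀ i i' : B, ind (C (.xb i) (.xb i')) = 0 := fun i i' =>
    ind_false fun h => hC _ _ h .x (Or.inl rfl) (Or.inl rfl)
  have e1 : ∑ q : A × B, ∑ i : A, ind (C (.ab q.1 q.2) (.xa i)) = cgg C := by
    unfold cgg
    rw [Finset.sum_comm]
    exact Finset.sum_congr rfl fun _ _ => Finset.sum_congr rfl fun _ _ => hs _ _
  have e2 : ∑ q : A × B, ∑ i : B, ind (C (.ab q.1 q.2) (.xb i)) = cbb C := by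
    unfold cbb
    rw [Finset.sum_comm]
    exact Finset.sum_congr rfl fun _ _ => Finset.sum_congr rfl fun _ _ => hs _ _
  simp only [sum_E3, h1, h2, h3, h4, Finset.sum_const_zero, add_zero, Finset.sum_add_distrib]
  rw [e1, e2]
  unfold caa cbb cgg
  ring

theorem low3 {V : Type} [Finite V] {G : SimpleGraph V} (φ : V3 A B → V)
    (hφ : Function.Injective φ) (hp : Pres G (φ ∘ src3 (A := A) (B := B)) (φ ∘ tgt3)) (D : Drawing G)
    (hD : D.IsGood) :
    Nonempty (PL (src3 (A := A) (B := B)) tgt3 (Cr D (φ ∘ src3) (φ ∘ tgt3))) ∧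
    (∀ e f : E3 A B, Cr D (φ ∘ src3) (φ ∘ tgt3) e f → Cr D (φ ∘ src3) (φ ∘ tgt3) f e) ∧
    (∀ e f : E3 A B, Cr D (φ ∘ src3) (φ ∘ tgt3) e f → ∀ v, (v = src3 e ∨ v = tgt3 e) →
      (v = src3 f ∨ v = tgt3 f) → False) := by
  refine ⟨?_, fun e f h => h.symm', ?_⟩
  · obtain ⟨S⟩ := toPL hp D hD
    exact ⟨S.comap φ id Function.injective_id hφ (fun _ => rfl) (fun _ => rfl)⟩
  · intro e f h v h1 h2
    refine Cr.no_common hD e f h (φ v) ?_ ?_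
    · rcases h1 with rfl | rfl <;> simp
    · rcases h2 with rfl | rfl <;> simp

/-- Swap. -/
def swV : V3 B A → V3 A B
  | .x => .x
  | .a j => .b j
  | .b i => .a i

/-- Swap. -/
def swE : E3 B A → E3 A B
  | .ab j i => .ab i j
  | .xa j => .xb j
  | .xb i => .xa i

lemma sw_sym {V : Type} (φ : V3 A B → V) (e : E3 B A) :
    s(φ (swV (src3 e)), φ (swV (tgt3 e))) = s(φ (src3 (swE e)), φ (tgt3 (swE e))) := by
  cases e
  · exact Sym2.eq_swap
  · rfl
  · rfl

lemma swV_inj : Function.Injective (swV (A := A) (B := B)) := by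
  rintro (_ | _ | _) (_ | _ | _) h <;> simp [swV] at h <;> simp [h]

lemma swE_inj : Function.Injective (swE (A := A) (B := B)) := by
  rintro (_ | _ | _) (_ | _ | _) h <;> simp [swE] at h <;> simp [h]

lemma swE_surj : Function.Surjective (swE (A := A) (B := B)) := by
  rintro (⟨i, j⟩ | i | j)
  · exact ⟨.ab j i, rfl⟩
  · exact ⟨.xb i, rfl⟩
  · exact ⟨.xa j, rfl⟩

lemma pres_sw {V : Type} {G : SimpleGraph V} (φ : V3 A B → V)
    (hp : Pres G (φ ∘ src3 (A := A) (B := B)) (φ ∘ tgt3)) :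
    Pres G ((φ ∘ swV) ∘ src3 (A := B) (B := A)) ((φ ∘ swV) ∘ tgt3) := by
  refine ⟨fun e => ?_, fun u v h => ?_, fun e f h => ?_⟩
  · have h1 := hp.adj (swE e)
    have h2 := sw_sym φ e
    rw [← SimpleGraph.mem_edgeSet] at h1 ⊢
    exact h2 ▸ h1
  · obtain ⟨e, he⟩ := hp.surj u v h
    obtain ⟨e, rfl⟩ := swE_surj e
    exact ⟨e, (sw_sym φ e).trans he⟩
  · exact swE_inj (hp.inj _ _ ((sw_sym φ e).symm.trans (h.trans (sw_sym φ f))))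

lemma Cr_sw {V : Type} {G : SimpleGraph V} (φ : V3 A B → V) (D : Drawing G) (e f : E3 B A) :
    Cr D ((φ ∘ swV) ∘ src3) ((φ ∘ swV) ∘ tgt3) e f ↔
      Cr D (φ ∘ src3) (φ ∘ tgt3) (swE e) (swE f) := by
  unfold Cr
  simp only [Function.comp_apply]
  rw [sw_sym φ e, sw_sym φ f]

lemma caa_sw {V : Type} {G : SimpleGraph V} (φ : V3 A B → V) (D : Drawing G) :
    caa (Cr D ((φ ∘ swV) ∘ src3 (A := B) (B := A)) ((φ ∘ swV) ∘ tgt3)) =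
      caa (Cr D (φ ∘ src3) (φ ∘ tgt3)) ∧
    cbb (Cr D ((φ ∘ swV) ∘ src3 (A := B) (B := A)) ((φ ∘ swV) ∘ tgt3)) =
      cgg (Cr D (φ ∘ src3) (φ ∘ tgt3)) ∧
    cgg (Cr D ((φ ∘ swV) ∘ src3 (A := B) (B := A)) ((φ ∘ swV) ∘ tgt3)) =
      cbb (Cr D (φ ∘ src3) (φ ∘ tgt3)) := by
  refine ⟨?_, ?_, ?_⟩
  · unfold caa
    refine Fintype.sum_equiv (Equiv.prodComm B A) _ _ fun q => ?_
    refine Fintype.sum_equiv (Equiv.prodComm B A) _ _ fun q' => ?_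
    exact ind_congr (Cr_sw φ D _ _)
  · unfold cbb cgg
    refine Finset.sum_congr rfl fun i _ => ?_
    refine Fintype.sum_equiv (Equiv.prodComm B A) _ _ fun q' => ?_
    exact ind_congr (Cr_sw φ D _ _)
  · unfold cbb cgg
    refine Finset.sum_congr rfl fun i _ => ?_
    refine Fintype.sum_equiv (Equiv.prodComm B A) _ _ fun q' => ?_
    exact ind_congr (Cr_sw φ D _ _)

lemma Z_oo (k l : ℕ) : Z (2 * k + 1) (2 * l + 1) = k * k * l * l := by
  unfold Z
  rw [show (2 * k + 1) / 2 = k by omega, show (2 * k + 1 - 1) / 2 = k by omega,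
    show (2 * l + 1) / 2 = l by omega, show (2 * l + 1 - 1) / 2 = l by omega]
lemma Z_oe (k l : ℕ) : Z (2 * k + 1) (2 * l + 2) = k * k * (l + 1) * l := by
  unfold Z
  rw [show (2 * k + 1) / 2 = k by omega, show (2 * k + 1 - 1) / 2 = k by omega,
    show (2 * l + 2) / 2 = l + 1 by omega, show (2 * l + 2 - 1) / 2 = l by omega]
lemma Z_eo (k l : ℕ) : Z (2 * k + 2) (2 * l + 1) = (k + 1) * k * l * l := by
  unfold Z
  rw [show (2 * k + 2) / 2 = k + 1 by omega, show (2 * k + 2 - 1) / 2 = k by omega,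
    show (2 * l + 1) / 2 = l by omega, show (2 * l + 1 - 1) / 2 = l by omega]
lemma Z_ee (k l : ℕ) : Z (2 * k + 2) (2 * l + 2) = (k + 1) * k * (l + 1) * l := by
  unfold Z
  rw [show (2 * k + 2) / 2 = k + 1 by omega, show (2 * k + 2 - 1) / 2 = k by omega,
    show (2 * l + 2) / 2 = l + 1 by omega, show (2 * l + 2 - 1) / 2 = l by omega]

theorem lower_bound (hZC : ∀ a b : ℕ, 0 < a → 0 < b → crossingNumber (bipK a b) = Z a b)
    {V : Type} [Finite V] {G : SimpleGraph V} [Nonempty A] [Nonempty B] (φ : V3 A B → V)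
    (hφ : Function.Injective φ) (hp : Pres G (φ ∘ src3 (A := A) (B := B)) (φ ∘ tgt3)) (D : Drawing G)
    (hD : D.IsGood) :
    Z (Fintype.card A + 1) (Fintype.card B + 1) ≤
      D.crNum + Fintype.card A / 2 * (Fintype.card B / 2) := by
  obtain ⟨⟨S⟩, hs, hC⟩ := low3 φ hφ hp D hD
  obtain ⟨⟨S'⟩, hs', hC'⟩ := low3 (φ ∘ swV) (hφ.comp swV_inj) (pres_sw φ hp) D hD
  have hc := crNum_count hp D hD
  rw [total_E3 hs hC] at hc
  obtain ⟨a1, a2, a3⟩ := outcomes hZC hs hC S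
  obtain ⟨b1, b2, b3⟩ := outcomes hZC hs' hC' S'
  obtain ⟨q1, q2, q3⟩ := caa_sw φ D
  rw [q1, q2, q3] at b1 b3
  rw [q1, q3] at b2
  clear hZC S S' q1 q2 q3 hs hs' hC hC'
  generalize caa (Cr D (φ ∘ src3) (φ ∘ tgt3)) = x at *
  generalize cbb (Cr D (φ ∘ src3) (φ ∘ tgt3)) = y at *
  generalize cgg (Cr D (φ ∘ src3) (φ ∘ tgt3)) = z at *
  generalize D.crNum = cr at *
  generalize Fintype.card A = m at *
  generalize Fintype.card B = n at *
  obtain ⟨k, rfl | rfl⟩ := Nat.even_or_odd' m <;> obtain ⟨l, rfl | rfl⟩ := Nat.even_or_odd' n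
  · have h := a3 l rfl
    rw [Z_oo] at h ⊢
    rw [show 2 * k / 2 = k by omega, show 2 * l / 2 = l by omega]
    nlinarith
  · obtain ⟨h1, h2⟩ := a1 k rfl
    rw [show 2 * l + 1 + 2 = 2 * (l + 1) + 1 by ring, Z_oo] at h1
    rw [Z_oo] at h2
    rw [show 2 * l + 1 + 1 = 2 * l + 2 by ring, Z_oe]
    rw [show 2 * k / 2 = k by omega, show (2 * l + 1) / 2 = l by omega]
    nlinarith
  · obtain ⟨h1, h2⟩ := b1 l rfl
    rw [show 2 * k + 1 + 2 = 2 * (k + 1) + 1 by ring, Z_oo] at h1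
    rw [Z_oo] at h2
    rw [show 2 * k + 1 + 1 = 2 * k + 2 by ring, Z_eo]
    rw [show 2 * l / 2 = l by omega, show (2 * k + 1) / 2 = k by omega]
    nlinarith
  · have h1 := a2 k rfl
    have h2 := b2 l rfl
    rw [show 2 * l + 1 + 2 = 2 * (l + 1) + 1 by ring, Z_oo] at h1
    rw [show 2 * k + 1 + 2 = 2 * (k + 1) + 1 by ring, Z_oo] at h2
    rw [show 2 * l + 1 + 1 = 2 * l + 2 by ring, show 2 * k + 1 + 1 = 2 * k + 2 by ring, Z_ee]
    rw [show (2 * l + 1) / 2 = l by omega, show (2 * k + 1) / 2 = k by omega]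
    nlinarith

end lower
end partP

section partQ
section upper

lemma geo_ab_y {p q p' q' : ℝ} (hp : p ≠ p') (h : q < 0 ∧ 0 < q' ∨ q' < 0 ∧ 0 < q) :
    Disjoint (segment ℝ (p, 0) (0, q)) (segment ℝ (p', 0) (0, q')) := by
  rcases h with ⟨h1, h2⟩ | ⟨h1, h2⟩
  · exact seg_disj_of_weak 0 1 0 (by simp) (by simpa) (by simp) (by simpa) (by simpa using hp)
  · exact (seg_disj_of_weak 0 1 0 (by simp) (by simpa) (by simp) (by simpa)
      (by simpa using hp.symm)).symm

lemma geo_ab_x {p q p' q' : ℝ} (hq : q ≠ q') (h : p < 0 ∧ 0 < p' ∨ p' < 0 ∧ 0 < p) :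
    Disjoint (segment ℝ (p, 0) (0, q)) (segment ℝ (p', 0) (0, q')) := by
  rw [segment_symm ℝ (p, 0), segment_symm ℝ (p', 0)]
  rcases h with ⟨h1, h2⟩ | ⟨h1, h2⟩
  · exact seg_disj_of_weak 1 0 0 (by simp) (by simpa) (by simp) (by simpa) (by simpa using hq)
  · exact (seg_disj_of_weak 1 0 0 (by simp) (by simpa) (by simp) (by simpa)
      (by simpa using hq.symm)).symm

lemma geo_ab_n {p q p' q' : ℝ} (hp : p' ≠ 0) (hq : q' ≠ 0) (h : p / p' < 1) (h' : q / q' < 1) :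
    Disjoint (segment ℝ (p, 0) (0, q)) (segment ℝ (p', 0) (0, q')) := by
  refine (seg_disj_of_lin (-(1 / p')) (-(1 / q')) (-1) ?_ ?_ ?_ ?_).symm
  · simp [hp]
  · simp [hq]
  · have : -(1 / p') * p = -(p / p') := by ring
    simp only [this]; linarith
  · have : -(1 / q') * q = -(q / q') := by ring
    simp only [this]; linarith

lemma inv_le_one_of_abs {p : ℝ} (h : 1 ≤ |p|) : 1 / p ≤ 1 := by
  have h1 : |1 / p| ≤ 1 := by
    rw [abs_div, abs_one]
    exact div_le_one_of_le₀ h (abs_nonneg _)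
  exact (le_abs_self _).trans h1

lemma ne_of_abs {p : ℝ} (h : 1 ≤ |p|) : p ≠ 0 := by
  rintro rfl; simp at h; linarith

lemma geo_xa_neg {p p' q' : ℝ} (hp : p ≠ p') (h : q' < 0) :
    Disjoint (segment ℝ (1/4, 1/4) (p, 0)) (segment ℝ (p', 0) (0, q')) := by
  rw [segment_symm ℝ (1/4, 1/4)]
  exact (seg_disj_of_weak 0 1 0 (by simp) (by simpa) (by simp) (by simp) (by simpa using hp.symm)).symm

lemma geo_xb_neg {q p' q' : ℝ} (hq : q ≠ q') (h : p' < 0) :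
    Disjoint (segment ℝ (1/4, 1/4) (0, q)) (segment ℝ (p', 0) (0, q')) := by
  rw [segment_symm ℝ (1/4, 1/4), segment_symm ℝ (p', 0)]
  exact (seg_disj_of_weak 1 0 0 (by simp) (by simpa) (by simp) (by simp) (by simpa using hq.symm)).symm

lemma geo_xa_n {p p' q' : ℝ} (hp : 1 ≤ |p'|) (hq : 1 ≤ |q'|) (h : p / p' < 1) :
    Disjoint (segment ℝ (1/4, 1/4) (p, 0)) (segment ℝ (p', 0) (0, q')) := by
  refine (seg_disj_of_lin (-(1 / p')) (-(1 / q')) (-1) ?_ ?_ ?_ ?_).symm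
  · simp [ne_of_abs hp]
  · simp [ne_of_abs hq]
  · have h1 := inv_le_one_of_abs hp
    have h2 := inv_le_one_of_abs hq
    simp only
    linarith
  · have : -(1 / p') * p = -(p / p') := by ring
    simp only [this]; linarith

lemma geo_xb_n {q p' q' : ℝ} (hp : 1 ≤ |p'|) (hq : 1 ≤ |q'|) (h : q / q' < 1) :
    Disjoint (segment ℝ (1/4, 1/4) (0, q)) (segment ℝ (p', 0) (0, q')) := by
  refine (seg_disj_of_lin (-(1 / p')) (-(1 / q')) (-1) ?_ ?_ ?_ ?_).symm
  · simp [ne_of_abs hp]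
  · simp [ne_of_abs hq]
  · have h1 := inv_le_one_of_abs hp
    have h2 := inv_le_one_of_abs hq
    simp only
    linarith
  · have : -(1 / q') * q = -(q / q') := by ring
    simp only [this]; linarith

/-- Signed coordinate of the `i`-th point on an axis. -/
noncomputable def wt (i : ℕ) : ℝ := if i % 2 = 1 then (i + 1 : ℝ) else -(i + 1 : ℝ)

lemma wt_abs (i : ℕ) : |wt i| = i + 1 := by
  unfold wt
  have : (0:ℝ) ≤ i + 1 := by positivity
  split_ifs
  · exact abs_of_nonneg this
  · rw [abs_neg]; exact abs_of_nonneg this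

lemma wt_one_le (i : ℕ) : 1 ≤ |wt i| := by rw [wt_abs]; simp

lemma wt_ne {i j : ℕ} (h : i ≠ j) : wt i ≠ wt j := by
  intro h'
  have := congrArg abs h'
  rw [wt_abs, wt_abs] at this
  apply h
  exact_mod_cast add_right_cancel this

lemma wt_pos {i : ℕ} (h : i % 2 = 1) : 0 < wt i := by
  unfold wt; rw [if_pos h]; positivity

lemma wt_neg {i : ℕ} (h : ¬ i % 2 = 1) : wt i < 0 := by
  unfold wt; rw [if_neg h, neg_lt_zero]; positivity

lemma wt_div {i j : ℕ} (h : i < j ∨ i % 2 ≠ j % 2) : wt i / wt j < 1 := by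
  by_cases h2 : i < j
  · have h1 : |wt i / wt j| < 1 := by
      rw [abs_div, wt_abs, wt_abs, div_lt_one (by positivity)]
      have : (i:ℝ) < j := by exact_mod_cast h2
      linarith
    exact (le_abs_self _).trans_lt h1
  · have h3 : i % 2 ≠ j % 2 := h.resolve_left h2
    refine lt_of_lt_of_le ?_ zero_le_one
    by_cases hi : i % 2 = 1
    · exact div_neg_of_pos_of_neg (wt_pos hi) (wt_neg (by omega))
    · exact div_neg_of_neg_of_pos (wt_neg hi) (wt_pos (by omega))

/-- `i` is before `j`, on the same half axis. -/
def bef (i j : ℕ) : Prop := i < j ∧ i % 2 = j % 2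

variable {m n : ℕ}

/-- The pairs of crossing edges in the standard drawing. -/
def CU : E3 (Fin m) (Fin n) → E3 (Fin m) (Fin n) → Prop
  | .ab i j, .ab i' j' => bef i i' ∧ bef j' j ∨ bef i' i ∧ bef j j'
  | .xa i, .ab i' j' => bef i' i ∧ (j' : ℕ) % 2 = 1
  | .ab i' j', .xa i => bef i' i ∧ (j' : ℕ) % 2 = 1
  | .xb j, .ab i' j' => bef j' j ∧ (i' : ℕ) % 2 = 1
  | .ab i' j', .xb j => bef j' j ∧ (i' : ℕ) % 2 = 1
  | _, _ => False

lemma CU_symm (e f : E3 (Fin m) (Fin n)) (h : CU e f) : CU f e := by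
  cases e <;> cases f <;> simp only [CU] at h ⊢ <;> first | exact h | exact h.symm | tauto

lemma bef_ne {i j : ℕ} (h : bef i j) : i ≠ j := h.1.ne

lemma CU_no_common (e f : E3 (Fin m) (Fin n)) (h : CU e f) (v : V3 (Fin m) (Fin n))
    (h1 : v = src3 e ∨ v = tgt3 e) (h2 : v = src3 f ∨ v = tgt3 f) : False := by
  cases e <;> cases f <;> simp only [CU, bef] at h <;> simp only [src3, tgt3] at h1 h2 <;>
    rcases h1 with rfl | rfl <;> rcases h2 with h2 | h2 <;> cases h2 <;> omega

/-- Positions in the standard drawing. -/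
noncomputable def posU : V3 (Fin m) (Fin n) → ℝ × ℝ
  | .x => (1/4, 1/4)
  | .a i => (wt i, 0)
  | .b j => (0, wt j)

lemma posU_cross (e f : E3 (Fin m) (Fin n)) (hf : SegFree (src3 e) (tgt3 e) (src3 f) (tgt3 f))
    (h : ¬ Disjoint (segment ℝ (posU (src3 e)) (posU (tgt3 e)))
      (segment ℝ (posU (src3 f)) (posU (tgt3 f)))) : CU e f := by
  have kab : ∀ (i i' : Fin m) (j j' : Fin n), (i : ℕ) ≠ i' → (j : ℕ) ≠ j' →
      ¬ Disjoint (segment ℝ (wt i, 0) (0, wt j)) (segment ℝ (wt i', 0) (0, wt j')) →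
      CU (.ab i j) (.ab i' j') := by
    intro i i' j j' hi hj h
    simp only [CU, bef]
    by_contra hc
    apply h
    by_cases h1 : (j : ℕ) % 2 = (j' : ℕ) % 2
    · by_cases h2 : (i : ℕ) % 2 = (i' : ℕ) % 2
      · rcases lt_or_gt_of_ne hi with h3 | h3
        · exact geo_ab_n (ne_of_abs (wt_one_le _)) (ne_of_abs (wt_one_le _)) (wt_div (Or.inl h3))
            (wt_div (Or.inl (by omega)))
        · exact (geo_ab_n (ne_of_abs (wt_one_le _)) (ne_of_abs (wt_one_le _)) (wt_div (Or.inl h3))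
            (wt_div (Or.inl (by omega)))).symm
      · refine geo_ab_x (wt_ne hj) ?_
        by_cases h3 : (i : ℕ) % 2 = 1
        · exact Or.inr ⟨wt_neg (by omega), wt_pos h3⟩
        · exact Or.inl ⟨wt_neg h3, wt_pos (by omega)⟩
    · refine geo_ab_y (wt_ne hi) ?_
      by_cases h3 : (j : ℕ) % 2 = 1
      · exact Or.inr ⟨wt_neg (by omega), wt_pos h3⟩
      · exact Or.inl ⟨wt_neg h3, wt_pos (by omega)⟩
  have kxa : ∀ (i i' : Fin m) (j' : Fin n), (i : ℕ) ≠ i' →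
      ¬ Disjoint (segment ℝ (1/4, 1/4) (wt i, 0)) (segment ℝ (wt i', 0) (0, wt j')) →
      CU (.xa i) (.ab i' j') := by
    intro i i' j' hi h
    simp only [CU, bef]
    by_contra hc
    apply h
    by_cases h1 : (j' : ℕ) % 2 = 1
    · exact geo_xa_n (wt_one_le _) (wt_one_le _) (wt_div (by omega))
    · exact geo_xa_neg (wt_ne hi) (wt_neg h1)
  have kxb : ∀ (j j' : Fin n) (i' : Fin m), (j : ℕ) ≠ j' →
      ¬ Disjoint (segment ℝ (1/4, 1/4) (0, wt j)) (segment ℝ (wt i', 0) (0, wt j')) →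
      CU (.xb j) (.ab i' j') := by
    intro j j' i' hi h
    simp only [CU, bef]
    by_contra hc
    apply h
    by_cases h1 : (i' : ℕ) % 2 = 1
    · exact geo_xb_n (wt_one_le _) (wt_one_le _) (wt_div (by omega))
    · exact geo_xb_neg (wt_ne hi) (wt_neg h1)
  obtain ⟨f1, f2, f3, f4⟩ := hf
  rcases e with ⟨i, j⟩ | i | j <;> rcases f with ⟨i', j'⟩ | i' | j' <;>
    simp only [src3, tgt3, posU] at h f1 f2 f3 f4
  · exact kab _ _ _ _ (fun h => f1 (congrArg _ (Fin.ext h))) (fun h => f4 (congrArg _ (Fin.ext h))) h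
  · exact CU_symm _ _ (kxa _ _ _ (fun h => f2 (congrArg _ (Fin.ext h.symm))) (fun h' => h h'.symm))
  · exact CU_symm _ _ (kxb _ _ _ (fun h => f4 (congrArg _ (Fin.ext h.symm))) (fun h' => h h'.symm))
  · exact kxa _ _ _ (fun h => f3 (congrArg _ (Fin.ext h))) h
  · exact absurd rfl f1
  · exact absurd rfl f1
  · exact kxb _ _ _ (fun h => f4 (congrArg _ (Fin.ext h))) h
  · exact absurd rfl f1
  · exact absurd rfl f1

/-- The standard drawing. -/
noncomputable def plU (m n : ℕ) : PL (src3 (A := Fin m) (B := Fin n)) tgt3 CU where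
  N := fun _ => 1
  hN := fun _ => one_pos
  P := Sum.elim posU (fun _ => 0)
  cross_imp := by
    intro e f i j hi hj h1 h2
    obtain rfl : i = 0 := by omega
    obtain rfl : j = 0 := by omega
    simp only [lab, if_true, zero_add, one_ne_zero, if_false, le_refl, Sum.elim_inl] at h1 h2
    obtain ⟨f1, f2, f3, f4⟩ := h1
    exact posU_cross e f ⟨fun h => f1 (congrArg _ h), fun h => f2 (congrArg _ h),
      fun h => f3 (congrArg _ h), fun h => f4 (congrArg _ h)⟩ h2
  uniq := by
    intro e f i j i' j' hi hj hi' hj' _ _ _ _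
    omega

lemma sum_par (m r : ℕ) : ∑ i ∈ Finset.range m, ind (i % 2 = r % 2) = (m + 1 - r % 2) / 2 := by
  induction m with
  | zero => simp; omega
  | succ m ih =>
    rw [Finset.sum_range_succ, ih]
    unfold ind
    split_ifs <;> omega

lemma sum_odd (m : ℕ) : ∑ i : Fin m, ind ((i : ℕ) % 2 = 1) = m / 2 := by
  rw [Fin.sum_univ_eq_sum_range (fun i => ind (i % 2 = 1))]
  have := sum_par m 1
  simpa using this

lemma sum_bef (m : ℕ) : ∑ i : Fin m, ∑ i' : Fin m, ind (bef i i') = m / 2 * ((m - 1) / 2) := by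
  induction m with
  | zero => simp
  | succ m ih =>
    rw [Fin.sum_univ_castSucc]
    simp only [Fin.sum_univ_castSucc (n := m), Finset.sum_add_distrib, Fin.val_castSucc, Fin.val_last]
    rw [ih]
    have h1 : ∑ i : Fin m, ind (bef i m) = m / 2 := by
      rw [Fin.sum_univ_eq_sum_range (fun i => ind (bef i m))]
      have h := sum_par m m
      rw [show (m + 1 - m % 2) / 2 = m / 2 by omega] at h
      rw [← h]
      refine Finset.sum_congr rfl fun i hi => ind_congr ?_
      have := Finset.mem_range.1 hi
      unfold bef; omega
    have h2 : ∑ i : Fin m, ind (bef m i) = 0 :=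
      Finset.sum_eq_zero fun i _ => ind_false (by unfold bef; omega)
    have h3 : ind (bef m m) = 0 := ind_false (by unfold bef; omega)
    rw [h1, h2, h3]
    obtain ⟨k, rfl | rfl⟩ := Nat.even_or_odd' m
    · rw [show 2 * k / 2 = k by omega, show (2 * k + 1) / 2 = k by omega,
        show (2 * k + 1 - 1) / 2 = k by omega]
      cases k with
      | zero => simp
      | succ k =>
        rw [show (2 * (k + 1) - 1) / 2 = k by omega]; ring
    · rw [show (2 * k + 1) / 2 = k by omega, show (2 * k + 1 + 1) / 2 = k + 1 by omega,
        show (2 * k + 1 - 1) / 2 = k by omega, show (2 * k + 1 + 1 - 1) / 2 = k by omega]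
      ring

lemma sum_bef' (m : ℕ) : ∑ i : Fin m, ∑ i' : Fin m, ind (bef i' i) = m / 2 * ((m - 1) / 2) := by
  rw [Finset.sum_comm]; exact sum_bef m

lemma ind_and (p q : Prop) : ind (p ∧ q) = ind p * ind q := by
  unfold ind; by_cases p <;> by_cases q <;> simp_all

lemma ind_or (p q : Prop) : ind (p ∨ q) ≤ ind p + ind q := by
  unfold ind; by_cases p <;> by_cases q <;> simp_all

lemma sum4 {α β : Type} [Fintype α] [Fintype β] (f : α → α → ℕ) (g : β → β → ℕ) :
    ∑ q : α × β, ∑ q' : α × β, f q.1 q'.1 * g q.2 q'.2 = (∑ i, ∑ i', f i i') * ∑ j, ∑ j', g j j' := by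
  have : ∀ q : α × β, ∑ q' : α × β, f q.1 q'.1 * g q.2 q'.2 = (∑ i', f q.1 i') * ∑ j', g q.2 j' := by
    intro q
    rw [Finset.sum_mul_sum, Fintype.sum_prod_type]
  simp only [this]
  rw [Finset.sum_mul_sum, Fintype.sum_prod_type]

lemma caa_CU (m n : ℕ) : caa (CU (m := m) (n := n)) ≤
    2 * (m / 2 * ((m - 1) / 2) * (n / 2 * ((n - 1) / 2))) := by
  have : caa (CU (m := m) (n := n)) ≤
      ∑ q : Fin m × Fin n, ∑ q' : Fin m × Fin n, ind (bef q.1 q'.1) * ind (bef q'.2 q.2) +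
      ∑ q : Fin m × Fin n, ∑ q' : Fin m × Fin n, ind (bef q'.1 q.1) * ind (bef q.2 q'.2) := by
    unfold caa
    rw [← Finset.sum_add_distrib]
    refine Finset.sum_le_sum fun q _ => ?_
    rw [← Finset.sum_add_distrib]
    refine Finset.sum_le_sum fun q' _ => ?_
    rw [← ind_and, ← ind_and]
    exact ind_or _ _
  refine this.trans (le_of_eq ?_)
  rw [sum4 (fun i i' : Fin m => ind (bef i i')) (fun j j' : Fin n => ind (bef j' j)),
    sum4 (fun i i' : Fin m => ind (bef i' i)) (fun j j' : Fin n => ind (bef j j')), sum_bef, sum_bef,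
    sum_bef', sum_bef']
  ring

lemma cgg_CU (m n : ℕ) : cgg (CU (m := m) (n := n)) = m / 2 * ((m - 1) / 2) * (n / 2) := by
  rw [← sum_bef', ← sum_odd n, Finset.sum_mul]
  unfold cgg
  refine Finset.sum_congr rfl fun i _ => ?_
  rw [Finset.sum_mul_sum, Fintype.sum_prod_type]
  refine Finset.sum_congr rfl fun i' _ => Finset.sum_congr rfl fun j' _ => ?_
  rw [← ind_and]; rfl

lemma cbb_CU (m n : ℕ) : cbb (CU (m := m) (n := n)) = n / 2 * ((n - 1) / 2) * (m / 2) := by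
  rw [← sum_bef', ← sum_odd m, Finset.sum_mul]
  unfold cbb
  refine Finset.sum_congr rfl fun i _ => ?_
  rw [Finset.sum_mul_sum, Fintype.sum_prod_type, Finset.sum_comm]
  refine Finset.sum_congr rfl fun i' _ => Finset.sum_congr rfl fun j' _ => ?_
  rw [← ind_and]; rfl

/-- The vertices of `K_{1,m,n}`. -/
def phi : V3 (Fin m) (Fin n) → (Σ i : Fin 3, ![Fin 1, Fin m, Fin n] i)
  | .x => ⟨0, (0 : Fin 1)⟩
  | .a i => ⟨1, i⟩
  | .b j => ⟨2, j⟩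

/-- Inverse of `phi`. -/
def psi : (Σ i : Fin 3, ![Fin 1, Fin m, Fin n] i) → V3 (Fin m) (Fin n)
  | ⟨0, _⟩ => .x
  | ⟨1, i⟩ => .a i
  | ⟨2, j⟩ => .b j

lemma psi_phi (v : V3 (Fin m) (Fin n)) : psi (phi v) = v := by
  cases v <;> rfl

lemma phi_psi (v : Σ i : Fin 3, ![Fin 1, Fin m, Fin n] i) : phi (psi v) = v := by
  rcases v with ⟨i, v⟩
  fin_cases i
  · have : v = (0 : Fin 1) := Subsingleton.elim (α := Fin 1) _ _
    subst this
    rfl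
  · rfl
  · rfl

lemma phi_inj : Function.Injective (phi (m := m) (n := n)) := Function.LeftInverse.injective psi_phi
lemma psi_inj : Function.Injective (psi (m := m) (n := n)) := Function.LeftInverse.injective phi_psi

lemma pres_phi : Pres (triK 1 m n) (phi ∘ src3) (phi ∘ tgt3) := by
  refine ⟨fun e => ?_, fun u v h => ?_, fun e f h => ?_⟩
  · cases e <;> simp [phi, src3, tgt3, SimpleGraph.completeMultipartiteGraph]
  · rw [← phi_psi u, ← phi_psi v] at h ⊢
    generalize psi u = u at *
    generalize psi v = v at *
    rcases u with _ | i | j <;> rcases v with _ | i' | j' <;>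
      simp [phi, SimpleGraph.completeMultipartiteGraph] at h
    · exact ⟨.xa i', rfl⟩
    · exact ⟨.xb j', rfl⟩
    · exact ⟨.xa i, Sym2.eq_swap⟩
    · exact ⟨.ab i j', rfl⟩
    · exact ⟨.xb j, Sym2.eq_swap⟩
    · exact ⟨.ab i' j, Sym2.eq_swap⟩
  · simp only [Function.comp_apply, Sym2.eq_iff, phi_inj.eq_iff] at h
    cases e <;> cases f <;> simp [src3, tgt3] at h <;> simp [h]

theorem main16 (hZC : ∀ a b : ℕ, 0 < a → 0 < b → crossingNumber (bipK a b) = Z a b)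
    (m n : ℕ) (hm : 0 < m) (hn : 0 < n) :
    crossingNumber (triK 1 m n) + m / 2 * (n / 2) = Z (m + 1) (n + 1) := by
  have : Finite (Σ i : Fin 3, ![Fin 1, Fin m, Fin n] i) := Finite.of_injective psi psi_inj
  have := Fintype.ofFinite (Σ i : Fin 3, ![Fin 1, Fin m, Fin n] i)
  have : NeZero m := ⟨hm.ne'⟩
  have : NeZero n := ⟨hn.ne'⟩
  obtain ⟨D, hD, hcr⟩ := PL.toDrawing (pres_phi (m := m) (n := n))
    ((plU m n).comap psi id Function.injective_id psi_inj (fun e => (psi_phi _).symm)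
      (fun e => (psi_phi _).symm)) (by
        intro e f h v h1 h2
        refine CU_no_common e f h (psi v) ?_ ?_
        · rcases h1 with rfl | rfl <;> simp [psi_phi]
        · rcases h2 with rfl | rfl <;> simp [psi_phi])
  have hT := total_E3 (CU_symm (m := m) (n := n)) CU_no_common
  simp only [id] at hcr
  rw [hT, cbb_CU, cgg_CU] at hcr
  have ha := caa_CU m n
  have hle : crossingNumber (triK 1 m n) ≤ D.crNum := Nat.sInf_le ⟨D, hD, rfl⟩
  obtain ⟨D', hD', hcr'⟩ : crossingNumber (triK 1 m n) ∈
    {k | ∃ D : Drawing (triK 1 m n), D.IsGood ∧ D.crNum = k} := Nat.sInf_mem ⟨_, D, hD, rfl⟩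
  have hlow := lower_bound hZC phi phi_inj (pres_phi (m := m) (n := n)) D' hD'
  rw [Fintype.card_fin, Fintype.card_fin, hcr'] at hlow
  refine le_antisymm ?_ hlow
  obtain ⟨m, rfl⟩ := Nat.exists_eq_succ_of_ne_zero hm.ne'
  obtain ⟨n, rfl⟩ := Nat.exists_eq_succ_of_ne_zero hn.ne'
  have e1 : (m.succ + 1) / 2 = m / 2 + 1 := by omega
  have e2 : (n.succ + 1) / 2 = n / 2 + 1 := by omega
  unfold Z
  rw [e1, e2]
  simp only [Nat.succ_eq_add_one, Nat.add_sub_cancel] at *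
  generalize m / 2 = a at *
  generalize n / 2 = b at *
  generalize (m + 1) / 2 = c at *
  generalize (n + 1) / 2 = d at *
  nlinarith

end upper
end partQ

/-- Assuming Zarankiewicz's conjecture, for all positive integers `m`, `n`,
`cr(K_{1,m,n}) = Z(m+1,n+1) − ⌊m/2⌋⌊n/2⌋`. -/
theorem statement16
    (hZC : ∀ a b : ℕ, 0 < a → 0 < b → crossingNumber (bipK a b) = Z a b)
    (m n : ℕ) (hm : 0 < m) (hn : 0 < n) :
    (crossingNumber (triK 1 m n) : ℤ) =
      (Z (m + 1) (n + 1) : ℤ) - ((m / 2 : ℕ) : ℤ) * ((n / 2 : ℕ) : ℤ) := by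
  have h := main16 hZC m n hm hn
  have h' : (crossingNumber (triK 1 m n) : ℤ) + ((m / 2 : ℕ) : ℤ) * ((n / 2 : ℕ) : ℤ) =
      (Z (m + 1) (n + 1) : ℤ) := by exact_mod_cast h
  linarith
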